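/- The maximum of the enclosed area over all tetromino fences equals 9. -/

import Mathlib

/-- Cells of the square lattice. -/
abbrev Cell : Type := ℤ × ℤ

/-- Two cells are adjacent if they differ by (±1,0) or (0,±1). -/
def Adj (p q : Cell) : Prop := (p.1 - q.1).natAbs + (p.2 - q.2).natAbs = 1

/-- `q` is reachable from `p` by a path of adjacent cells inside `S`. -/
def ReachIn (S : Set Cell) (p q : Cell) : Prop :=
  Relation.ReflTransGen (fun x y => Adj x y ∧ x ∈ S ∧ y ∈ S) p q

/-- A set of cells is connected if any two of its cells are joined by a path
of adjacent cells inside the set. -/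
def SetConnected (S : Set Cell) : Prop := ∀ p ∈ S, ∀ q ∈ S, ReachIn S p q

/-- The connected component of `c` in `S` under adjacency. -/
def component (S : Set Cell) (c : Cell) : Set Cell := {d | ReachIn S c d}

/-- A cell `c ∉ F` is enclosed by `F` if its connected component in the
complement of `F` is finite. -/
def Enclosed (F : Set Cell) (c : Cell) : Prop := c ∉ F ∧ (component Fᶜ c).Finite

/-- The enclosed area of `F` is the number of cells enclosed by `F`. -/
noncomputable def encArea (F : Set Cell) : ℕ := Set.ncard {c | Enclosed F c}

/-- The eight symmetries of the square lattice (rotations by multiples of 90°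
and reflections). -/
def symms : List (Cell → Cell) :=
  [fun p => (p.1, p.2), fun p => (-p.2, p.1), fun p => (-p.1, -p.2), fun p => (p.2, -p.1),
   fun p => (p.1, -p.2), fun p => (-p.1, p.2), fun p => (p.2, p.1), fun p => (-p.2, -p.1)]

/-- `Q` is a placement of the polyomino `P`: the image of `P` under a composition
of one of the eight symmetries of the square lattice with a translation. -/
def IsPlacement (P Q : Set Cell) : Prop :=
  ∃ f ∈ symms, ∃ t : Cell, Q = (fun c => f c + t) '' P

/-- Two pieces are edge-adjacent if some cell of one is adjacent to a cell of the other. -/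
def PieceAdj (A B : Set Cell) : Prop := ∃ a ∈ A, ∃ b ∈ B, Adj a b

/-- The five free tetrominoes I, L, N, O, T. -/
def tets : Fin 5 → Set Cell :=
  ![{(0,0), (0,1), (0,2), (0,3)},
    {(0,0), (1,0), (0,1), (0,2)},
    {(0,0), (1,0), (1,1), (2,1)},
    {(0,0), (1,0), (0,1), (1,1)},
    {(0,0), (1,0), (2,0), (1,1)}]

/-- A tetromino fence: five pairwise disjoint placements, one of each free
tetromino, whose union is connected, each piece being edge-adjacent to at
least two of the other pieces. -/
structure TetFence where
  piece : Fin 5 → Set Cell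
  placement : ∀ i, IsPlacement (tets i) (piece i)
  disj : Pairwise fun i j => Disjoint (piece i) (piece j)
  conn : SetConnected (⋃ i, piece i)
  adj2 : ∀ i, 2 ≤ Set.ncard {j | j ≠ i ∧ PieceAdj (piece i) (piece j)}

/-- The enclosed area of a tetromino fence. -/
noncomputable def TetFence.area (F : TetFence) : ℕ := encArea (⋃ i, F.piece i)

namespace TF

/-! ### Orientations of the five tetrominoes -/

/-- All orientations of the five tetrominoes, normalised to nonnegative coordinates. -/
def orients : Fin 5 → List (List (ℕ × ℕ)) :=
  ![[[(0,0),(0,1),(0,2),(0,3)], [(0,0),(1,0),(2,0),(3,0)]],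
    [[(0,0),(1,0),(0,1),(0,2)], [(0,0),(1,0),(1,1),(1,2)],
     [(0,2),(1,2),(0,1),(0,0)], [(0,2),(1,2),(1,1),(1,0)],
     [(0,0),(0,1),(1,0),(2,0)], [(0,0),(0,1),(1,1),(2,1)],
     [(2,0),(2,1),(1,0),(0,0)], [(2,0),(2,1),(1,1),(0,1)]],
    [[(0,0),(1,0),(1,1),(2,1)], [(0,1),(1,1),(1,0),(2,0)],
     [(0,0),(0,1),(1,1),(1,2)], [(1,0),(1,1),(0,1),(0,2)]],
    [[(0,0),(1,0),(0,1),(1,1)]],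
    [[(0,0),(1,0),(2,0),(1,1)], [(0,1),(1,1),(2,1),(1,0)],
     [(0,0),(0,1),(0,2),(1,1)], [(1,0),(1,1),(1,2),(0,1)]]]

/-- The canonical orientation of each tetromino. -/
def canon : Fin 5 → List (ℕ × ℕ) :=
  ![[(0,0),(0,1),(0,2),(0,3)], [(0,0),(1,0),(0,1),(0,2)], [(0,0),(1,0),(1,1),(2,1)],
    [(0,0),(1,0),(0,1),(1,1)], [(0,0),(1,0),(2,0),(1,1)]]

/-- The set of cells of an oriented piece translated by `(a, b)`. -/
def pset (o : List (ℕ × ℕ)) (a b : ℤ) : Set Cell :=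
  {c | ∃ p ∈ o, c = ((p.1 : ℤ) + a, (p.2 : ℤ) + b)}

theorem tets_eq (i : Fin 5) : tets i = {c | ∃ p ∈ canon i, c = ((p.1 : ℤ), (p.2 : ℤ))} := by
  fin_cases i <;> ext ⟨x, y⟩ <;> simp [tets, canon]

theorem orient_check : ∀ f ∈ symms, ∀ i, ∃ o ∈ orients i, ∃ a ∈ List.range 4, ∃ b ∈ List.range 4,
    (∀ p ∈ canon i, ∃ q ∈ o, f ((p.1 : ℤ), (p.2 : ℤ)) = ((q.1 : ℤ) - a, (q.2 : ℤ) - b)) ∧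
    (∀ q ∈ o, ∃ p ∈ canon i, f ((p.1 : ℤ), (p.2 : ℤ)) = ((q.1 : ℤ) - a, (q.2 : ℤ) - b)) := by
  decide +kernel

theorem placement_orient {i : Fin 5} {Q : Set Cell} (h : IsPlacement (tets i) Q) :
    ∃ o ∈ orients i, ∃ a b : ℤ, Q = pset o a b := by
  obtain ⟨f, hf, t, rfl⟩ := h
  obtain ⟨o, ho, a, -, b, -, h1, h2⟩ := orient_check f hf i
  refine ⟨o, ho, t.1 - a, t.2 - b, ?_⟩
  rw [tets_eq]
  ext c
  constructor
  · rintro ⟨d, ⟨p, hp, rfl⟩, rfl⟩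
    obtain ⟨q, hq, e⟩ := h1 p hp
    refine ⟨q, hq, ?_⟩
    simp only [e]
    ext <;> simp <;> ring
  · rintro ⟨q, hq, rfl⟩
    obtain ⟨p, hp, e⟩ := h2 q hq
    refine ⟨_, ⟨p, hp, rfl⟩, ?_⟩
    simp only [e]
    ext <;> simp <;> ring

/-! ### Symmetries -/

theorem symm_add : ∀ f ∈ symms, ∀ p q : Cell, f (p + q) = f p + f q := by
  intro f hf p q
  simp only [symms, List.mem_cons, List.not_mem_nil, or_false] at hf
  rcases hf with rfl | rfl | rfl | rfl | rfl | rfl | rfl | rfl <;>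
    refine Prod.ext ?_ ?_ <;> simp <;> ring

theorem symm_adj : ∀ f ∈ symms, ∀ p q : Cell, Adj (f p) (f q) ↔ Adj p q := by
  intro f hf p q
  simp only [symms, List.mem_cons, List.not_mem_nil, or_false] at hf
  unfold Adj
  rcases hf with rfl | rfl | rfl | rfl | rfl | rfl | rfl | rfl <;> dsimp only <;> omega

theorem symm_inv : ∀ f ∈ symms, ∃ g ∈ symms, (∀ p : Cell, g (f p) = p) ∧ ∀ p : Cell, f (g p) = p := by
  simp only [symms, List.forall_mem_cons, List.exists_mem_cons_iff]
  refine ⟨?_, ?_, ?_, ?_, ?_, ?_, ?_, ?_, by simp⟩ <;> simp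

theorem symm_comp : ∀ f ∈ symms, ∀ g ∈ symms, ∃ h ∈ symms, ∀ p : Cell, f (g p) = h p := by
  simp only [symms, List.forall_mem_cons, List.exists_mem_cons_iff]
  refine ⟨?_, ?_, ?_, ?_, ?_, ?_, ?_, ?_, by simp⟩ <;> simp

/-- Five pairwise disjoint placed tetrominoes together with a finite set of at least ten cells that
is closed under adjacency outside the pieces. -/
structure Conf where
  piece : Fin 5 → Set Cell
  placement : ∀ i, IsPlacement (tets i) (piece i)
  disj : Pairwise fun i j => Disjoint (piece i) (piece j)
  adj2 : ∀ i, 2 ≤ Set.ncard {j | j ≠ i ∧ PieceAdj (piece i) (piece j)}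
  E : Finset Cell
  card : 10 ≤ E.card
  avoid : ∀ e ∈ E, ∀ i, e ∉ piece i
  clos : ∀ e ∈ E, ∀ d, Adj e d → d ∈ E ∨ ∃ i, d ∈ piece i

/-- The rigid motion given by a symmetry and a translation. -/
def motion (f : Cell → Cell) (t : Cell) : Cell → Cell := fun c => f c + t

theorem motion_inj {f} (hf : f ∈ symms) (t : Cell) : Function.Injective (motion f t) := by
  obtain ⟨g, -, hg, -⟩ := symm_inv f hf
  intro p q h
  have : f p = f q := by simpa [motion] using h
  rw [← hg p, this, hg]

theorem motion_surj {f} (hf : f ∈ symms) (t : Cell) : Function.Surjective (motion f t) := by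
  obtain ⟨g, -, -, hg⟩ := symm_inv f hf
  intro p
  exact ⟨g (p - t), by simp [motion, hg]⟩

theorem motion_adj {f} (hf : f ∈ symms) (t p q : Cell) :
    Adj (motion f t p) (motion f t q) ↔ Adj p q := by
  rw [← symm_adj f hf p q]
  simp [motion, Adj]

theorem pieceAdj_motion {f} (hf : f ∈ symms) (t : Cell) (A B : Set Cell) :
    PieceAdj (motion f t '' A) (motion f t '' B) ↔ PieceAdj A B := by
  constructor
  · rintro ⟨_, ⟨a, ha, rfl⟩, _, ⟨b, hb, rfl⟩, h⟩
    exact ⟨a, ha, b, hb, (motion_adj hf t a b).1 h⟩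
  · rintro ⟨a, ha, b, hb, h⟩
    exact ⟨_, ⟨a, ha, rfl⟩, _, ⟨b, hb, rfl⟩, (motion_adj hf t a b).2 h⟩

theorem placement_motion {f} (hf : f ∈ symms) (t : Cell) {P Q : Set Cell} (h : IsPlacement P Q) :
    IsPlacement P (motion f t '' Q) := by
  obtain ⟨g, hg, s, rfl⟩ := h
  obtain ⟨k, hk, e⟩ := symm_comp f hf g hg
  refine ⟨k, hk, f s + t, ?_⟩
  rw [Set.image_image]
  congr 1
  funext c
  simp [motion, symm_add f hf, e, add_assoc]

/-- The image of a configuration under a rigid motion. -/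
def Conf.map (C : Conf) {f} (hf : f ∈ symms) (t : Cell) : Conf where
  piece i := motion f t '' C.piece i
  placement i := placement_motion hf t (C.placement i)
  disj i j hij := (Set.disjoint_image_iff (motion_inj hf t)).2 (C.disj hij)
  adj2 i := by simpa only [pieceAdj_motion hf] using C.adj2 i
  E := C.E.map ⟨motion f t, motion_inj hf t⟩
  card := by simpa using C.card
  avoid := by
    intro e he i hi
    obtain ⟨e', he', rfl⟩ := Finset.mem_map.1 he
    obtain ⟨c, hc, e⟩ := hi
    rw [motion_inj hf t e] at hc
    exact C.avoid _ he' i hc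
  clos := by
    intro e he d hd
    obtain ⟨e', he', rfl⟩ := Finset.mem_map.1 he
    obtain ⟨d', rfl⟩ := motion_surj hf t d
    rcases C.clos e' he' d' ((motion_adj hf t _ _).1 hd) with h | ⟨i, h⟩
    · exact Or.inl (Finset.mem_map.2 ⟨d', h, rfl⟩)
    · exact Or.inr ⟨i, d', h, rfl⟩

theorem Conf.map_adj (C : Conf) {f} (hf : f ∈ symms) (t : Cell) (i j : Fin 5) :
    PieceAdj ((C.map hf t).piece i) ((C.map hf t).piece j) ↔ PieceAdj (C.piece i) (C.piece j) :=
  pieceAdj_motion hf t _ _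

/-- Every configuration can be moved so that a chosen piece is in canonical position. -/
theorem Conf.norm (C : Conf) (i : Fin 5) (a b : ℤ) : ∃ C' : Conf, C'.piece i = pset (canon i) a b ∧
    ∀ j k, PieceAdj (C'.piece j) (C'.piece k) ↔ PieceAdj (C.piece j) (C.piece k) := by
  obtain ⟨f, hf, t, ht⟩ := C.placement i
  obtain ⟨g, hg, h1, -⟩ := symm_inv f hf
  refine ⟨C.map hg ((a, b) - g t), ?_, C.map_adj hg _⟩
  show motion g _ '' C.piece i = _
  rw [ht, Set.image_image, tets_eq]
  have : ∀ c, motion g ((a, b) - g t) (f c + t) = c + (a, b) := by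
    intro c
    simp [motion, symm_add g hg, h1]
  simp only [this]
  ext c
  constructor
  · rintro ⟨d, ⟨p, hp, rfl⟩, rfl⟩
    exact ⟨p, hp, by simp⟩
  · rintro ⟨p, hp, rfl⟩
    exact ⟨_, ⟨p, hp, rfl⟩, by simp⟩

/-! ### Rays -/

theorem pieceAdj_symm {A B : Set Cell} (h : PieceAdj A B) : PieceAdj B A := by
  obtain ⟨a, ha, b, hb, h⟩ := h
  refine ⟨b, hb, a, ha, ?_⟩
  unfold Adj at *
  omega

/-- From every trapped cell, every ray hits a piece. -/
theorem Conf.ray (C : Conf) (d : Cell) (hd : d.1.natAbs + d.2.natAbs = 1) (e : Cell) (he : e ∈ C.E) :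
    ∃ k : ℕ, ∃ i, (e.1 + k * d.1, e.2 + k * d.2) ∈ C.piece i := by
  by_contra hcon
  push Not at hcon
  have key : ∀ k : ℕ, (e.1 + k * d.1, e.2 + k * d.2) ∈ C.E := by
    intro k
    induction k with
    | zero => simpa using he
    | succ k ih =>
      rcases C.clos _ ih (e.1 + (k + 1 : ℕ) * d.1, e.2 + (k + 1 : ℕ) * d.2) (by
        simp only [Adj]; push_cast; ring_nf
        rw [Int.natAbs_neg, Int.natAbs_neg]; exact hd) with h | ⟨i, h⟩
      · exact h
      · exact absurd h (hcon _ i)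
  have : Set.Infinite (C.E : Set Cell) := by
    refine Set.infinite_of_injective_forall_mem (f := fun k : ℕ => ((e.1 + k * d.1, e.2 + k * d.2) : Cell)) ?_ key
    intro k l h
    simp only [Prod.mk.injEq, add_right_inj, mul_eq_mul_right_iff, Nat.cast_inj] at h
    rcases h with ⟨h1 | h1, h2 | h2⟩
    all_goals first | assumption | (simp [h1, h2] at hd)
  exact this C.E.finite_toSet

end TF
namespace TF
/-! ### The adjacency graph of the pieces -/

/-- The twelve cyclic orders. -/
def hamL : List (Fin 5 → Fin 5) :=
  [![0, 1, 2, 3, 4], ![0, 1, 2, 4, 3], ![0, 1, 3, 2, 4], ![0, 1, 3, 4, 2], ![0, 1, 4, 2, 3],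
   ![0, 1, 4, 3, 2], ![0, 2, 1, 3, 4], ![0, 2, 1, 4, 3], ![0, 2, 3, 1, 4], ![0, 2, 4, 1, 3],
   ![0, 3, 1, 2, 4], ![0, 3, 2, 1, 4]]

/-- Centre and the two pairs of wing pieces. -/
def bowL : List (Fin 5 → Fin 5) :=
  [![0, 1, 2, 3, 4], ![0, 1, 3, 2, 4], ![0, 1, 4, 2, 3], ![1, 0, 2, 3, 4], ![1, 0, 3, 2, 4],
   ![1, 0, 4, 2, 3], ![2, 0, 1, 3, 4], ![2, 0, 3, 1, 4], ![2, 0, 4, 1, 3], ![3, 0, 1, 2, 4],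
   ![3, 0, 2, 1, 4], ![3, 0, 4, 1, 2], ![4, 0, 1, 2, 3], ![4, 0, 2, 1, 3], ![4, 0, 3, 1, 2]]

/-- The two hubs and the three remaining pieces. -/
def k23L : List (Fin 5 → Fin 5) :=
  [![1, 0, 3, 2, 4], ![2, 0, 3, 4, 1], ![0, 3, 2, 4, 1], ![4, 0, 3, 2, 1], ![1, 2, 3, 0, 4],
   ![1, 3, 0, 2, 4], ![1, 4, 3, 0, 2], ![2, 3, 0, 4, 1], ![2, 4, 3, 0, 1], ![4, 3, 0, 2, 1]]

/-- The symmetric Boolean matrix with the given entries above the diagonal. -/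
def mat (a b c d e f g h i j : Bool) : Fin 5 → Fin 5 → Bool :=
  ![![false, a, b, c, d], ![a, false, e, f, g], ![b, e, false, h, i], ![c, f, h, false, j],
    ![d, g, i, j, false]]

def hamP (r : Fin 5 → Fin 5 → Bool) (p : Fin 5 → Fin 5) : Bool :=
  r (p 0) (p 1) && r (p 1) (p 2) && r (p 2) (p 3) && r (p 3) (p 4) && r (p 4) (p 0)

def bowP (r : Fin 5 → Fin 5 → Bool) (p : Fin 5 → Fin 5) : Bool :=
  r (p 0) (p 1) && r (p 0) (p 2) && r (p 0) (p 3) && r (p 0) (p 4) && r (p 1) (p 2) && r (p 3) (p 4)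

def k23P (r : Fin 5 → Fin 5 → Bool) (p : Fin 5 → Fin 5) : Bool :=
  r (p 0) (p 2) && r (p 0) (p 3) && r (p 0) (p 4) && r (p 1) (p 2) && r (p 1) (p 3) && r (p 1) (p 4)
    && !r (p 2) (p 3) && !r (p 2) (p 4) && !r (p 3) (p 4)

def graphOK (r : Fin 5 → Fin 5 → Bool) : Bool :=
  !((List.finRange 5).all fun i => Nat.ble 2 ((List.finRange 5).countP (r i))) ||
    (hamL.any (hamP r) || bowL.any (bowP r) || k23L.any (k23P r))

theorem graph_check : ∀ a b c d e f g h i j : Bool, graphOK (mat a b c d e f g h i j) = true := by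
  decide +kernel

theorem graph_lemma (r : Fin 5 → Fin 5 → Bool) (hs : ∀ i j, r i j = r j i) (hi : ∀ i, r i i = false)
    (hd : ∀ i, 2 ≤ (List.finRange 5).countP (r i)) :
    (∃ p ∈ hamL, hamP r p = true) ∨ (∃ p ∈ bowL, bowP r p = true) ∨ ∃ p ∈ k23L, k23P r p = true := by
  have hr : r = mat (r 0 1) (r 0 2) (r 0 3) (r 0 4) (r 1 2) (r 1 3) (r 1 4) (r 2 3) (r 2 4) (r 3 4) := by
    funext i j
    fin_cases i <;> fin_cases j <;> simp [mat, hi] <;> exact hs _ _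
  have h : graphOK r = true := by rw [hr]; exact graph_check _ _ _ _ _ _ _ _ _ _
  have h2 : ((List.finRange 5).all fun i => Nat.ble 2 ((List.finRange 5).countP (r i))) = true := by
    rw [List.all_eq_true]
    intro i _
    rw [Nat.ble_eq]
    exact hd i
  simp only [graphOK, h2, Bool.not_true, Bool.false_or, Bool.or_eq_true, List.any_eq_true] at h
  exact or_assoc.1 h

/-- Boolean test for distinctness. -/
def neB (i j : Fin 5) : Bool := !Nat.beq i.val j.val

theorem neB_ne {i j : Fin 5} (h : neB i j = true) : i ≠ j := by
  rintro rfl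
  simp [neB] at h

theorem inj_checkB : ((bowL ++ k23L).all fun p => neB (p 0) (p 1) && neB (p 0) (p 2) && neB (p 0) (p 3) &&
    neB (p 0) (p 4) && neB (p 1) (p 2) && neB (p 1) (p 3) && neB (p 1) (p 4) && neB (p 2) (p 3) &&
    neB (p 2) (p 4) && neB (p 3) (p 4)) = true := by
  decide +kernel

theorem inj_check : ∀ p ∈ bowL ++ k23L, p 0 ≠ p 1 ∧ p 0 ≠ p 2 ∧ p 0 ≠ p 3 ∧ p 0 ≠ p 4 ∧ p 1 ≠ p 2 ∧
    p 1 ≠ p 3 ∧ p 1 ≠ p 4 ∧ p 2 ≠ p 3 ∧ p 2 ≠ p 4 ∧ p 3 ≠ p 4 := by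
  intro p hp
  have h := List.all_eq_true.1 inj_checkB p hp
  simp only [Bool.and_eq_true] at h
  obtain ⟨⟨⟨⟨⟨⟨⟨⟨⟨h0, h1⟩, h2⟩, h3⟩, h4⟩, h5⟩, h6⟩, h7⟩, h8⟩, h9⟩ := h
  exact ⟨neB_ne h0, neB_ne h1, neB_ne h2, neB_ne h3, neB_ne h4, neB_ne h5, neB_ne h6, neB_ne h7,
    neB_ne h8, neB_ne h9⟩

theorem Conf.graph (C : Conf) :
    (∃ p ∈ hamL, ∀ k, PieceAdj (C.piece (p k)) (C.piece (p (k + 1)))) ∨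
    (∃ p ∈ bowL, (∀ k, k ≠ 0 → PieceAdj (C.piece (p 0)) (C.piece (p k))) ∧
      PieceAdj (C.piece (p 1)) (C.piece (p 2)) ∧ PieceAdj (C.piece (p 3)) (C.piece (p 4))) ∨
    (∃ p ∈ k23L, (∀ k, 2 ≤ k → PieceAdj (C.piece (p 0)) (C.piece (p k)) ∧
        PieceAdj (C.piece (p 1)) (C.piece (p k))) ∧
      ¬ PieceAdj (C.piece (p 2)) (C.piece (p 3)) ∧ ¬ PieceAdj (C.piece (p 2)) (C.piece (p 4)) ∧
      ¬ PieceAdj (C.piece (p 3)) (C.piece (p 4))) := by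
  classical
  obtain ⟨r, hr⟩ : ∃ r : Fin 5 → Fin 5 → Bool, ∀ i j, r i j = true ↔
      (j ≠ i ∧ PieceAdj (C.piece i) (C.piece j)) :=
    ⟨fun i j => decide (j ≠ i ∧ PieceAdj (C.piece i) (C.piece j)), fun i j => decide_eq_true_iff⟩
  have rt : ∀ i j, r i j = true → PieceAdj (C.piece i) (C.piece j) := fun i j h => ((hr i j).1 h).2
  have rf : ∀ i j, i ≠ j → r i j = false → ¬ PieceAdj (C.piece i) (C.piece j) := by
    intro i j hij h hp
    rw [(hr i j).2 ⟨hij.symm, hp⟩] at h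
    exact Bool.noConfusion h
  have hs : ∀ i j, r i j = r j i := by
    intro i j
    rw [Bool.eq_iff_iff, hr, hr]
    exact ⟨fun h => ⟨h.1.symm, pieceAdj_symm h.2⟩, fun h => ⟨h.1.symm, pieceAdj_symm h.2⟩⟩
  have hi : ∀ i, r i i = false := by
    intro i
    rw [Bool.eq_false_iff]
    intro h
    exact ((hr i i).1 h).1 rfl
  have hd : ∀ i, 2 ≤ (List.finRange 5).countP (r i) := by
    intro i
    refine (C.adj2 i).trans (le_of_eq ?_)
    rw [List.countP_eq_length_filter,
      ← List.toFinset_card_of_nodup ((List.nodup_finRange 5).filter _), ← Set.ncard_coe_finset]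
    congr 1
    ext j
    simp [hr]
  rcases graph_lemma r hs hi hd with ⟨p, hp, h⟩ | ⟨p, hp, h⟩ | ⟨p, hp, h⟩
  · refine Or.inl ⟨p, hp, ?_⟩
    simp only [hamP, Bool.and_eq_true] at h
    obtain ⟨⟨⟨⟨h0, h1⟩, h2⟩, h3⟩, h4⟩ := h
    intro k
    fin_cases k
    exacts [rt _ _ h0, rt _ _ h1, rt _ _ h2, rt _ _ h3, rt _ _ h4]
  · refine Or.inr (Or.inl ⟨p, hp, ?_⟩)
    simp only [bowP, Bool.and_eq_true] at h
    obtain ⟨⟨⟨⟨⟨h0, h1⟩, h2⟩, h3⟩, h4⟩, h5⟩ := h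
    refine ⟨?_, rt _ _ h4, rt _ _ h5⟩
    intro k hk
    fin_cases k
    · exact absurd rfl hk
    exacts [rt _ _ h0, rt _ _ h1, rt _ _ h2, rt _ _ h3]
  · refine Or.inr (Or.inr ⟨p, hp, ?_⟩)
    obtain ⟨-, -, -, -, -, -, -, i1, i2, i3⟩ := inj_check p (List.mem_append_right _ hp)
    simp only [k23P, Bool.and_eq_true, Bool.not_eq_true'] at h
    obtain ⟨⟨⟨⟨⟨⟨⟨⟨h0, h1⟩, h2⟩, h3⟩, h4⟩, h5⟩, h6⟩, h7⟩, h8⟩ := h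
    refine ⟨?_, rf _ _ i1 h6, rf _ _ i2 h7,
      rf _ _ i3 h8⟩
    intro k hk
    fin_cases k
    · exact absurd hk (by decide)
    · exact absurd hk (by decide)
    exacts [⟨rt _ _ h0, rt _ _ h3⟩, ⟨rt _ _ h1, rt _ _ h4⟩, ⟨rt _ _ h2, rt _ _ h5⟩]

end TF
namespace TF
/-! ### The closed walk argument -/

/-- Maximal travel inside each piece. -/
def capv : Fin 5 → ℕ := ![3, 4, 3, 2, 2]

def dst (a b : ℕ) : ℕ := (a - b) + (b - a)

/-- Possible marks in the first coordinate: `(true, m)` is a right mark, `(false, m)` a left mark. -/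
def xopts (o : List (ℕ × ℕ)) : List (Option (Bool × ℕ × ℕ)) :=
  none :: ((o.filter fun m => !o.contains (m.1 + 1, m.2)).map fun m => some (false, m)) ++
    ((o.filter fun m => !o.any fun q => (q.1 + 1, q.2) == m).map fun m => some (true, m))

def yopts (o : List (ℕ × ℕ)) : List (Option (Bool × ℕ × ℕ)) :=
  none :: ((o.filter fun m => !o.contains (m.1, m.2 + 1)).map fun m => some (false, m)) ++
    ((o.filter fun m => !o.any fun q => (q.1, q.2 + 1) == m).map fun m => some (true, m))

def compatXY : Option (Bool × ℕ × ℕ) → Option (Bool × ℕ × ℕ) → Bool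
  | some (s, m), some (s', m') =>
    (if s then decide (m'.1 < m.1) else decide (m.1 < m'.1)) &&
      (if s' then decide (m.2 < m'.2) else decide (m'.2 < m.2))
  | _, _ => true

def wayX (a : ℕ) : Option (Bool × ℕ × ℕ) → ℕ
  | none => a
  | some (s, m) => if s then max m.1 a else min m.1 a

def wayY (a : ℕ) : Option (Bool × ℕ × ℕ) → ℕ
  | none => a
  | some (s, m) => if s then max m.2 a else min m.2 a

theorem cap_check : ∀ i, ∀ o ∈ orients i, ∀ xm ∈ xopts o, ∀ ym ∈ yopts o, compatXY xm ym = true →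
    ∀ a ∈ o, ∀ c ∈ o,
    dst a.1 (wayX a.1 xm) + dst (wayX a.1 xm) c.1 + dst a.2 (wayY a.2 ym) + dst (wayY a.2 ym) c.2
      ≤ capv i := by
  decide +kernel

theorem two_marks : ∀ i, ∀ o ∈ orients i,
    (∀ m ∈ xopts o, ∀ m' ∈ xopts o, ∀ q q', m = some (false, q) → m' = some (true, q') →
      ¬ q.1 + 2 ≤ q'.1) ∧
    (∀ m ∈ yopts o, ∀ m' ∈ yopts o, ∀ q q', m = some (false, q) → m' = some (true, q') →
      ¬ q.2 + 2 ≤ q'.2) := by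
  have h : ∀ i, ∀ o ∈ orients i,
    (∀ m ∈ xopts o, ∀ m' ∈ xopts o,
      (match m, m' with | some (false, q), some (true, q') => decide (q.1 + 2 ≤ q'.1) | _, _ => false) = false) ∧
    (∀ m ∈ yopts o, ∀ m' ∈ yopts o,
      (match m, m' with | some (false, q), some (true, q') => decide (q.2 + 2 ≤ q'.2) | _, _ => false) = false) := by
    decide +kernel
  intro i o ho
  refine ⟨?_, ?_⟩
  · rintro m hm m' hm' q q' rfl rfl
    simpa using (h i o ho).1 _ hm _ hm'
  · rintro m hm m' hm' q q' rfl rfl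
    simpa using (h i o ho).2 _ hm _ hm'

theorem mem_xl {o : List (ℕ × ℕ)} {m : ℕ × ℕ} (h : m ∈ o) (h' : (m.1 + 1, m.2) ∉ o) :
    some (false, m) ∈ xopts o := by
  simp [xopts, h, h']
theorem mem_xr {o : List (ℕ × ℕ)} {m : ℕ × ℕ} (h : m ∈ o) (h' : ∀ q ∈ o, (q.1 + 1, q.2) ≠ m) :
    some (true, m) ∈ xopts o := by
  simp only [xopts, List.cons_append, List.mem_cons, List.mem_append, List.mem_map, List.mem_filter]
  refine Or.inr (Or.inr ⟨m, ⟨h, ?_⟩, rfl⟩)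
  simpa using fun a b hab => h' (a, b) hab
theorem mem_yl {o : List (ℕ × ℕ)} {m : ℕ × ℕ} (h : m ∈ o) (h' : (m.1, m.2 + 1) ∉ o) :
    some (false, m) ∈ yopts o := by
  simp [yopts, h, h']
theorem mem_yr {o : List (ℕ × ℕ)} {m : ℕ × ℕ} (h : m ∈ o) (h' : ∀ q ∈ o, (q.1, q.2 + 1) ≠ m) :
    some (true, m) ∈ yopts o := by
  simp only [yopts, List.cons_append, List.mem_cons, List.mem_append, List.mem_map, List.mem_filter]
  refine Or.inr (Or.inr ⟨m, ⟨h, ?_⟩, rfl⟩)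
  simpa using fun a b hab => h' (a, b) hab

/-- The four marks. -/
structure Marks (l r t b : Cell) : Prop where
  lt : l.1 < t.1
  lb : l.1 < b.1
  tr : t.1 < r.1
  br : b.1 < r.1
  bl : b.2 < l.2
  br' : b.2 < r.2
  lt' : l.2 < t.2
  rt' : r.2 < t.2

theorem piece_cap {i : Fin 5} {Q : Set Cell} (hQ : IsPlacement (tets i) Q) {l r t b : Cell}
    (hm : Marks l r t b) (hl : (l.1 + 1, l.2) ∉ Q) (hr : (r.1 - 1, r.2) ∉ Q)
    (ht : (t.1, t.2 - 1) ∉ Q) (hb : (b.1, b.2 + 1) ∉ Q) {a c : Cell} (ha : a ∈ Q) (hc : c ∈ Q) :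
    ∃ sx sy : ℤ, (r ∈ Q → r.1 ≤ sx) ∧ (l ∈ Q → sx ≤ l.1) ∧ (t ∈ Q → t.2 ≤ sy) ∧ (b ∈ Q → sy ≤ b.2) ∧
      |a.1 - sx| + |sx - c.1| + |a.2 - sy| + |sy - c.2| ≤ capv i := by
  obtain ⟨o, ho, A, B, rfl⟩ := placement_orient hQ
  obtain ⟨a, hao, rfl⟩ := ha
  obtain ⟨c, hco, rfl⟩ := hc
  obtain ⟨m1, m2, m3, m4, m5, m6, m7, m8⟩ := hm
  -- the mark in the first coordinate
  have hx : ∃ xm ∈ xopts o, (r ∈ pset o A B → r.1 ≤ (wayX a.1 xm : ℤ) + A) ∧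
      (l ∈ pset o A B → (wayX a.1 xm : ℤ) + A ≤ l.1) ∧
      (xm = none ∨ (∃ q, xm = some (false, q) ∧ l = ((q.1 : ℤ) + A, (q.2 : ℤ) + B)) ∨
        (∃ q, xm = some (true, q) ∧ r = ((q.1 : ℤ) + A, (q.2 : ℤ) + B))) := by
    have L : ∀ q ∈ o, l = ((q.1 : ℤ) + A, (q.2 : ℤ) + B) → some (false, q) ∈ xopts o := by
      rintro q hq rfl
      refine mem_xl hq fun h => hl ⟨_, h, ?_⟩
      ext <;> simp <;> ring
    have R : ∀ q ∈ o, r = ((q.1 : ℤ) + A, (q.2 : ℤ) + B) → some (true, q) ∈ xopts o := by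
      rintro q hq rfl
      refine mem_xr hq fun q' h e => hr ⟨_, h, ?_⟩
      subst e
      ext <;> simp; ring
    by_cases hrQ : r ∈ pset o A B
    · obtain ⟨q, hq, e⟩ := hrQ
      refine ⟨_, R q hq e, ?_, ?_, Or.inr (Or.inr ⟨q, rfl, e⟩)⟩
      · intro _; subst e; simp [wayX]
      · rintro ⟨q', hq', e'⟩
        exfalso
        refine (two_marks i o ho).1 _ (L q' hq' e') _ (R q hq e) _ _ rfl rfl ?_
        have h1 := congrArg Prod.fst e
        have h2 := congrArg Prod.fst e'
        simp only at h1 h2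
        omega
    · by_cases hlQ : l ∈ pset o A B
      · obtain ⟨q, hq, e⟩ := hlQ
        refine ⟨_, L q hq e, fun h => absurd h hrQ, ?_, Or.inr (Or.inl ⟨q, rfl, e⟩)⟩
        intro _; subst e; simp [wayX]
      · exact ⟨none, by simp [xopts], fun h => absurd h hrQ, fun h => absurd h hlQ, Or.inl rfl⟩
  have hy : ∃ ym ∈ yopts o, (t ∈ pset o A B → t.2 ≤ (wayY a.2 ym : ℤ) + B) ∧
      (b ∈ pset o A B → (wayY a.2 ym : ℤ) + B ≤ b.2) ∧
      (ym = none ∨ (∃ q, ym = some (false, q) ∧ b = ((q.1 : ℤ) + A, (q.2 : ℤ) + B)) ∨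
        (∃ q, ym = some (true, q) ∧ t = ((q.1 : ℤ) + A, (q.2 : ℤ) + B))) := by
    have L : ∀ q ∈ o, b = ((q.1 : ℤ) + A, (q.2 : ℤ) + B) → some (false, q) ∈ yopts o := by
      rintro q hq rfl
      refine mem_yl hq fun h => hb ⟨_, h, ?_⟩
      ext <;> simp <;> ring
    have R : ∀ q ∈ o, t = ((q.1 : ℤ) + A, (q.2 : ℤ) + B) → some (true, q) ∈ yopts o := by
      rintro q hq rfl
      refine mem_yr hq fun q' h e => ht ⟨_, h, ?_⟩
      subst e
      ext <;> simp; ring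
    by_cases hrQ : t ∈ pset o A B
    · obtain ⟨q, hq, e⟩ := hrQ
      refine ⟨_, R q hq e, ?_, ?_, Or.inr (Or.inr ⟨q, rfl, e⟩)⟩
      · intro _; subst e; simp [wayY]
      · rintro ⟨q', hq', e'⟩
        exfalso
        refine (two_marks i o ho).2 _ (L q' hq' e') _ (R q hq e) _ _ rfl rfl ?_
        have h1 := congrArg Prod.snd e
        have h2 := congrArg Prod.snd e'
        simp only at h1 h2
        omega
    · by_cases hlQ : b ∈ pset o A B
      · obtain ⟨q, hq, e⟩ := hlQ
        refine ⟨_, L q hq e, fun h => absurd h hrQ, ?_, Or.inr (Or.inl ⟨q, rfl, e⟩)⟩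
        intro _; subst e; simp [wayY]
      · exact ⟨none, by simp [yopts], fun h => absurd h hrQ, fun h => absurd h hlQ, Or.inl rfl⟩
  obtain ⟨xm, hxm, hx1, hx2, hx3⟩ := hx
  obtain ⟨ym, hym, hy1, hy2, hy3⟩ := hy
  refine ⟨_, _, hx1, hx2, hy1, hy2, ?_⟩
  have hcomp : compatXY xm ym = true := by
    rcases hx3 with rfl | ⟨q, rfl, e⟩ | ⟨q, rfl, e⟩
    · rfl
    all_goals
      rcases hy3 with rfl | ⟨q', rfl, e'⟩ | ⟨q', rfl, e'⟩
      · rfl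
      all_goals
        subst e e'
        simp only at m1 m2 m3 m4 m5 m6 m7 m8
        simp [compatXY]
        omega
  have key := cap_check i o ho xm hxm ym hym hcomp a hao c hco
  have D : ∀ (x y : ℕ), |(x : ℤ) - y| = dst x y := by
    intro x y
    unfold dst
    rcases le_total x y with h | h
    · rw [abs_of_nonpos (by omega)]; omega
    · rw [abs_of_nonneg (by omega)]; omega
  have e1 : ∀ x y z : ℤ, x + z - (y + z) = x - y := fun x y z => by ring
  simp only [e1, D]
  exact_mod_cast key

theorem cyc5 (s : Fin 5 → ℤ) (i j : Fin 5) : 2 * (s i - s j) ≤ ∑ k, |s k - s (k + 1)| := by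
  have p : ∀ k, s k - s (k+1) ≤ |s k - s (k + 1)| := fun k => le_abs_self _
  have q : ∀ k, -(s k - s (k+1)) ≤ |s k - s (k + 1)| := fun k => neg_le_abs _
  have p0 := p 0
  have p1 := p 1
  have p2 := p 2
  have p3 := p 3
  have p4 := p 4
  have q0 := q 0
  have q1 := q 1
  have q2 := q 2
  have q3 := q 3
  have q4 := q 4
  have a0 : (0 : Fin 5) + 1 = 1 := rfl
  have a1 : (1 : Fin 5) + 1 = 2 := rfl
  have a2 : (2 : Fin 5) + 1 = 3 := rfl
  have a3 : (3 : Fin 5) + 1 = 4 := rfl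
  have a4 : (4 : Fin 5) + 1 = 0 := rfl
  rw [Fin.sum_univ_five]
  simp only [a0, a1, a2, a3, a4] at *
  clear p q
  fin_cases i <;> fin_cases j <;> simp only [Fin.mk_zero, Fin.mk_one, Fin.reduceFinMk, Fin.zero_eta] <;> linarith

theorem ham_permB : (hamL.all fun p => Nat.beq (capv (p 0) + capv (p 1) + capv (p 2) + capv (p 3) + capv (p 4)) 14 &&
    ((List.finRange 5).all fun i => (List.finRange 5).any fun k => Nat.beq (p k).val i.val)) = true := by
  decide +kernel

theorem ham_perm : ∀ p ∈ hamL, (∀ i, ∃ k, p k = i) ∧ ∑ k, capv (p k) = 14 := by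
  intro p hp
  have h := List.all_eq_true.1 ham_permB p hp
  rw [Bool.and_eq_true, List.all_eq_true, Nat.beq_eq] at h
  rw [Fin.sum_univ_five]
  refine ⟨fun i => ?_, h.1⟩
  obtain ⟨k, -, hk⟩ := List.any_eq_true.1 (h.2 i (List.mem_finRange i))
  exact ⟨k, Fin.ext (Nat.eq_of_beq_eq_true hk)⟩

/-- The walk inequality along a Hamiltonian cycle. -/
theorem Conf.walk (C : Conf) {p : Fin 5 → Fin 5} (hp : p ∈ hamL)
    (hadj : ∀ k, PieceAdj (C.piece (p k)) (C.piece (p (k + 1)))) {l r t b : Cell} (hm : Marks l r t b)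
    (hl : (l.1 + 1, l.2) ∈ C.E) (hr : (r.1 - 1, r.2) ∈ C.E)
    (ht : (t.1, t.2 - 1) ∈ C.E) (hb : (b.1, b.2 + 1) ∈ C.E)
    (hl' : ∃ i, l ∈ C.piece i) (hr' : ∃ i, r ∈ C.piece i)
    (ht' : ∃ i, t ∈ C.piece i) (hb' : ∃ i, b ∈ C.piece i) :
    2 * (r.1 - l.1) + 2 * (t.2 - b.2) ≤ 19 := by
  choose c hc a ha hca using hadj
  obtain ⟨hsurj, hsum⟩ := ham_perm p hp
  -- entry cell of piece `k + 1` is `a k`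
  have cap : ∀ k, ∃ sx sy : ℤ, (r ∈ C.piece (p (k+1)) → r.1 ≤ sx) ∧ (l ∈ C.piece (p (k+1)) → sx ≤ l.1) ∧
      (t ∈ C.piece (p (k+1)) → t.2 ≤ sy) ∧ (b ∈ C.piece (p (k+1)) → sy ≤ b.2) ∧
      |(a k).1 - sx| + |sx - (c (k+1)).1| + |(a k).2 - sy| + |sy - (c (k+1)).2| ≤ capv (p (k+1)) := fun k =>
    piece_cap (C.placement _) hm (C.avoid _ hl _) (C.avoid _ hr _) (C.avoid _ ht _) (C.avoid _ hb _)
      (ha k) (hc (k+1))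
  choose sx sy h1 h2 h3 h4 h5 using cap
  have find : ∀ i, ∃ k, p (k + 1) = i := by
    intro i
    obtain ⟨k, rfl⟩ := hsurj i
    exact ⟨k - 1, by rw [sub_add_cancel]⟩
  obtain ⟨_, hri⟩ := hr'
  obtain ⟨kr, rfl⟩ := find ‹_›
  obtain ⟨_, hli⟩ := hl'
  obtain ⟨kl, rfl⟩ := find ‹_›
  obtain ⟨_, hti⟩ := ht'
  obtain ⟨kt, rfl⟩ := find ‹_›
  obtain ⟨_, hbi⟩ := hb'
  obtain ⟨kb, rfl⟩ := find ‹_›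
  have X := cyc5 sx kr kl
  have Y := cyc5 sy kt kb
  have x1 := h1 kr hri
  have x2 := h2 kl hli
  have x3 := h3 kt hti
  have x4 := h4 kb hbi
  have link : ∀ k, |(c k).1 - (a k).1| + |(c k).2 - (a k).2| = 1 := by
    intro k
    have := hca k
    unfold Adj at this
    zify at this
    exact this
  have stepx : ∀ k, |sx k - sx (k+1)| ≤ |sx k - (c (k+1)).1| + |(c (k+1)).1 - (a (k+1)).1| + |(a (k+1)).1 - sx (k+1)| := by
    intro k
    have e : sx k - sx (k+1) = (sx k - (c (k+1)).1) + ((c (k+1)).1 - (a (k+1)).1) + ((a (k+1)).1 - sx (k+1)) := by ring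
    rw [e]; exact abs_add_three _ _ _
  have stepy : ∀ k, |sy k - sy (k+1)| ≤ |sy k - (c (k+1)).2| + |(c (k+1)).2 - (a (k+1)).2| + |(a (k+1)).2 - sy (k+1)| := by
    intro k
    have e : sy k - sy (k+1) = (sy k - (c (k+1)).2) + ((c (k+1)).2 - (a (k+1)).2) + ((a (k+1)).2 - sy (k+1)) := by ring
    rw [e]; exact abs_add_three _ _ _
  have S1 : ∀ k, |sx k - sx (k+1)| + |sy k - sy (k+1)| ≤ 1 + (|sx k - (c (k+1)).1| + |sy k - (c (k+1)).2|)
      + (|(a (k+1)).1 - sx (k+1)| + |(a (k+1)).2 - sy (k+1)|) := by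
    intro k
    have := stepx k
    have := stepy k
    have := link (k+1)
    linarith
  have T := Finset.sum_le_sum (s := Finset.univ) fun k _ => S1 k
  have T5 := Finset.sum_le_sum (s := Finset.univ) fun k _ => h5 k
  simp only [Finset.sum_add_distrib] at T T5
  have sh : ∀ g : Fin 5 → ℤ, ∑ k, g (k + 1) = ∑ k, g k := fun g => Equiv.sum_comp (Equiv.addRight (1 : Fin 5)) g
  have s1 := sh fun k => |(a k).1 - sx k|
  have s2 := sh fun k => |(a k).2 - sy k|
  have s3 := sh fun k => (capv (p k) : ℤ)
  have s4 : ∑ k, (capv (p k) : ℤ) = 14 := by exact_mod_cast hsum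
  rw [s1, s2] at T
  rw [s3, s4] at T5
  have c5 : ∑ _k : Fin 5, (1 : ℤ) = 5 := by simp
  rw [c5] at T
  linarith

end TF
namespace TF
/-! ### The bounding box of the trapped cells -/

theorem Conf.box (C : Conf) {p : Fin 5 → Fin 5} (hp : p ∈ hamL)
    (hadj : ∀ k, PieceAdj (C.piece (p k)) (C.piece (p (k + 1)))) :
    ∃ x y w h : ℤ, (∀ e ∈ C.E, x ≤ e.1 ∧ e.1 ≤ x + w ∧ y ≤ e.2 ∧ e.2 ≤ y + h) ∧
      ((w = 3 ∧ h = 2) ∨ (w = 2 ∧ h = 3) ∨ (w = 4 ∧ h = 1) ∨ (w = 1 ∧ h = 4)) := by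
  have hne : C.E.Nonempty := Finset.card_pos.1 (by have := C.card; omega)
  obtain ⟨l, hl, hlm⟩ := C.E.exists_min_image (fun e => e.1) hne
  obtain ⟨r, hr, hrm⟩ := C.E.exists_max_image (fun e => e.1) hne
  obtain ⟨b, hb, hbm⟩ := C.E.exists_min_image (fun e => e.2) hne
  obtain ⟨t, ht, htm⟩ := C.E.exists_max_image (fun e => e.2) hne
  have l' : ∃ i, ((l.1 - 1, l.2) : Cell) ∈ C.piece i := by
    rcases C.clos l hl (l.1 - 1, l.2) (by simp [Adj]) with h | h
    · have := hlm _ h; simp only at this; omega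
    · exact h
  have r' : ∃ i, ((r.1 + 1, r.2) : Cell) ∈ C.piece i := by
    rcases C.clos r hr (r.1 + 1, r.2) (by simp [Adj]) with h | h
    · have := hrm _ h; simp only at this; omega
    · exact h
  have b' : ∃ i, ((b.1, b.2 - 1) : Cell) ∈ C.piece i := by
    rcases C.clos b hb (b.1, b.2 - 1) (by simp [Adj]) with h | h
    · have := hbm _ h; simp only at this; omega
    · exact h
  have t' : ∃ i, ((t.1, t.2 + 1) : Cell) ∈ C.piece i := by
    rcases C.clos t ht (t.1, t.2 + 1) (by simp [Adj]) with h | h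
    · have := htm _ h; simp only at this; omega
    · exact h
  have key := C.walk hp hadj (l := (l.1 - 1, l.2)) (r := (r.1 + 1, r.2)) (b := (b.1, b.2 - 1))
    (t := (t.1, t.2 + 1))
    (by
      have := hlm _ hr
      have := hlm _ ht
      have := hlm _ hb
      have := hrm _ ht
      have := hrm _ hb
      have := hbm _ hr
      have := hbm _ hl
      have := htm _ hr
      have := htm _ hl
      constructor <;> simp only at * <;> omega)
    (by simpa using hl) (by simpa using hr) (by simpa using ht) (by simpa using hb) l' r' t' b'
  simp only at key
  have hsub : C.E ⊆ Finset.Icc l.1 r.1 ×ˢ Finset.Icc b.2 t.2 := by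
    intro e he
    simp only [Finset.mem_product, Finset.mem_Icc]
    exact ⟨⟨hlm e he, hrm e he⟩, hbm e he, htm e he⟩
  have hc := C.card.trans (Finset.card_le_card hsub)
  rw [Finset.card_product, Int.card_Icc, Int.card_Icc] at hc
  have hlr := hlm _ hr
  have hbt := hbm _ ht
  refine ⟨l.1, b.2, r.1 - l.1, t.2 - b.2, ?_, ?_⟩
  · intro e he
    have := hlm e he
    have := hrm e he
    have := hbm e he
    have := htm e he
    omega
  · obtain ⟨w, hw⟩ : ∃ w : ℕ, (r.1 + 1 - l.1).toNat = w := ⟨_, rfl⟩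
    obtain ⟨h, hh⟩ : ∃ h : ℕ, (t.2 + 1 - b.2).toNat = h := ⟨_, rfl⟩
    rw [hw, hh] at hc
    have h7 : w + h ≤ 7 := by omega
    have hw7 : w ≤ 7 := by omega
    interval_cases w <;> omega

theorem Conf.boxed (C : Conf) {p : Fin 5 → Fin 5} (hp : p ∈ hamL)
    (hadj : ∀ k, PieceAdj (C.piece (p k)) (C.piece (p (k + 1)))) :
    ∃ C' : Conf, (∀ e ∈ C'.E, 4 ≤ e.1 ∧ e.1 ≤ 7 ∧ 4 ≤ e.2 ∧ e.2 ≤ 6) ∨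
      (∀ e ∈ C'.E, 4 ≤ e.1 ∧ e.1 ≤ 8 ∧ 4 ≤ e.2 ∧ e.2 ≤ 5) := by
  obtain ⟨x, y, w, h, hb, hwh⟩ := C.box hp hadj
  have h0 : (fun p : Cell => ((p.1, p.2) : Cell)) ∈ symms := by simp [symms]
  have h1 : (fun p : Cell => ((p.2, p.1) : Cell)) ∈ symms := by simp [symms]
  have m0 : ∀ e ∈ (C.map h0 (4 - x, 4 - y)).E, ∃ e' ∈ C.E, e = (e'.1 + (4 - x), e'.2 + (4 - y)) := by
    intro e he
    obtain ⟨e', he', rfl⟩ := Finset.mem_map.1 he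
    exact ⟨e', he', rfl⟩
  have m1 : ∀ e ∈ (C.map h1 (4 - y, 4 - x)).E, ∃ e' ∈ C.E, e = (e'.2 + (4 - y), e'.1 + (4 - x)) := by
    intro e he
    obtain ⟨e', he', rfl⟩ := Finset.mem_map.1 he
    exact ⟨e', he', rfl⟩
  rcases hwh with ⟨rfl, rfl⟩ | ⟨rfl, rfl⟩ | ⟨rfl, rfl⟩ | ⟨rfl, rfl⟩
  · refine ⟨C.map h0 (4 - x, 4 - y), Or.inl fun e he => ?_⟩
    obtain ⟨e', he', rfl⟩ := m0 e he
    have := hb e' he'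
    simp only
    omega
  · refine ⟨C.map h1 (4 - y, 4 - x), Or.inl fun e he => ?_⟩
    obtain ⟨e', he', rfl⟩ := m1 e he
    have := hb e' he'
    simp only
    omega
  · refine ⟨C.map h0 (4 - x, 4 - y), Or.inr fun e he => ?_⟩
    obtain ⟨e', he', rfl⟩ := m0 e he
    have := hb e' he'
    simp only
    omega
  · refine ⟨C.map h1 (4 - y, 4 - x), Or.inr fun e he => ?_⟩
    obtain ⟨e', he', rfl⟩ := m1 e he
    have := hb e' he'
    simp only
    omega

end TF
namespace TF
/-! ### Bit masks -/

/-- Evaluate a natural number before passing it on; equal to `k n`. -/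
def force {α : Type} (n : ℕ) (k : ℕ → α) : α :=
  Nat.rec (k 0) (fun p _ => k (Nat.shiftRight (Nat.succ p) 64))
    (Nat.add (Nat.shiftLeft n 64) (Nat.mod n 2305843009213693951))

/-- The mask of an oriented piece, the cell `(x, y)` being bit `x + 24 * y`. -/
def base (o : List (ℕ × ℕ)) : ℕ :=
  o.foldr (fun c acc => Nat.lor acc (Nat.shiftLeft 1 (Nat.add c.1 (Nat.mul 24 c.2)))) 0

/-- The neighbours of a mask. -/
def nb (m : ℕ) : ℕ :=
  Nat.lor (Nat.lor (Nat.shiftLeft m 1) (Nat.shiftRight m 1))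
    (Nat.lor (Nat.shiftLeft m 24) (Nat.shiftRight m 24))

/-- Codes of the translations in `[0, 8]²`. -/
def shifts : List ℕ := (List.range 9).flatMap fun y => (List.range 9).map fun x => x + 24 * y

/-- Collect the translates of `b` that are disjoint from `c` and meet `cn`. -/
noncomputable def collect (c cn b : ℕ) (l : List ℕ) : List ℕ → (List ℕ → Bool) → Bool :=
  List.rec (fun acc k => k acc) (fun s _ ih acc k => force (Nat.shiftLeft b s) fun m =>
      cond (Nat.beq (Nat.land m c) 0)
        (cond (Nat.beq (Nat.land m cn) 0) (ih acc k) (ih (m :: acc) k))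
        (ih acc k)) l

noncomputable def near (c cn : ℕ) (sh : List ℕ) (l : List (List (ℕ × ℕ))) :
    List ℕ → (List ℕ → Bool) → Bool :=
  List.rec (fun acc k => k acc) (fun o _ ih acc k =>
    force (base o) fun b => collect c cn b sh acc fun acc' => ih acc' k) l

/-! ### The bow tie case -/

noncomputable def wing1 (c x xn : ℕ) (l : List ℕ) : List ℕ → (List ℕ → Bool) → Bool :=
  List.rec (fun acc k => k acc) (fun y _ ih acc k =>
      cond (Nat.beq (Nat.land x y) 0)
        (cond (Nat.beq (Nat.land xn y) 0) (ih acc k)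
           (force (Nat.lor c (Nat.lor x y)) fun m => ih (m :: acc) k))
        (ih acc k)) l

/-- All unions of `c` with two adjacent disjoint masks. -/
noncomputable def wing (c : ℕ) (ys : List ℕ) (l : List ℕ) : List ℕ → (List ℕ → Bool) → Bool :=
  List.rec (fun acc k => k acc)
    (fun x _ ih acc k => force (nb x) fun xn => wing1 c x xn ys acc fun acc' => ih acc' k) l

/-- Binary trees storing the four shadows of sets of masks. -/
inductive T
  | leaf (U D L R : ℕ)
  | node (n U D L R : ℕ) (l r : T)

noncomputable def smL (k m : ℕ) : ℕ :=
  force (Nat.lor m (Nat.shiftLeft m k)) fun a =>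
  force (Nat.lor a (Nat.shiftLeft a (Nat.mul 2 k))) fun a =>
  force (Nat.lor a (Nat.shiftLeft a (Nat.mul 4 k))) fun a =>
  Nat.lor a (Nat.shiftLeft a (Nat.mul 4 k))
noncomputable def smR (k m : ℕ) : ℕ :=
  force (Nat.lor m (Nat.shiftRight m k)) fun a =>
  force (Nat.lor a (Nat.shiftRight a (Nat.mul 2 k))) fun a =>
  force (Nat.lor a (Nat.shiftRight a (Nat.mul 4 k))) fun a =>
  Nat.lor a (Nat.shiftRight a (Nat.mul 4 k))

def T.n : T → ℕ | .leaf .. => 1 | .node n .. => n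
def T.U : T → ℕ | .leaf U _ _ _ => U | .node _ U .. => U
def T.D : T → ℕ | .leaf _ U _ _ => U | .node _ _ U .. => U
def T.L : T → ℕ | .leaf _ _ U _ => U | .node _ _ _ U .. => U
def T.R : T → ℕ | .leaf _ _ _ U => U | .node _ _ _ _ U .. => U

noncomputable def orall (l : List ℕ) : ℕ → ℕ :=
  List.rec (fun a => a) (fun x _ ih a => force (Nat.lor x a) ih) l

noncomputable def part (p : ℕ) (l : List ℕ) : List ℕ → List ℕ → (List ℕ → List ℕ → Bool) → Bool :=
  List.rec (fun a b k => k a b) (fun x _ ih a b k =>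
    cond (Nat.beq (Nat.land (Nat.shiftRight x p) 1) 0) (ih a (x :: b) k) (ih (x :: a) b k)) l

noncomputable def mkleaf (l : List ℕ) (k : T → Bool) : Bool :=
  force (orall l 0) fun m => force (smL 24 m) fun U => force (smR 24 m) fun D =>
    force (smL 1 m) fun L => force (smR 1 m) fun R => k (.leaf U D L R)
noncomputable def mknode (a b : T) (k : T → Bool) : Bool :=
  force (Nat.add a.n b.n) fun n =>
  force (Nat.lor a.U b.U) fun U => force (Nat.lor a.D b.D) fun D =>
    force (Nat.lor a.L b.L) fun L => force (Nat.lor a.R b.R) fun R => k (.node n U D L R a b)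

/-- Case distinction on the length of a list: zero, one, or at least two. -/
noncomputable def short {α : Type} (a b c : α) (l : List ℕ) : α :=
  List.rec a (fun _ t _ => List.rec b (fun _ _ _ => c) t) l

noncomputable def build (ps : List ℕ) : List ℕ → (T → Bool) → Bool :=
  List.rec (fun l k => mkleaf l k) (fun p _ ih l k =>
    short (mkleaf l k) (mkleaf l k) (part p l [] [] fun a b =>
      short (ih b k)
        (short (ih a k) (mkleaf a fun ta => mkleaf b fun tb => mknode ta tb k)
          (mkleaf a fun ta => ih b fun tb => mknode ta tb k) b)
        (short (ih a k) (ih a fun ta => mkleaf b fun tb => mknode ta tb k)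
          (ih a fun ta => ih b fun tb => mknode ta tb k) b) a) l) ps

/-- The number of ones below bit 297. -/
def pop (n m : ℕ) : ℕ :=
  Nat.mod (Nat.add (Nat.add (Nat.add (Nat.add (Nat.land n m) (Nat.land (Nat.shiftRight n 1) m))
   (Nat.add (Nat.land (Nat.shiftRight n 2) m) (Nat.land (Nat.shiftRight n 3) m)))
   (Nat.add (Nat.add (Nat.land (Nat.shiftRight n 4) m) (Nat.land (Nat.shiftRight n 5) m))
   (Nat.add (Nat.land (Nat.shiftRight n 6) m) (Nat.land (Nat.shiftRight n 7) m))))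
   (Nat.land (Nat.shiftRight n 8) m)) 511

noncomputable def small (m : ℕ) (a b : T) : Bool :=
  force (Nat.land (Nat.land (Nat.lor a.U b.U) (Nat.lor a.D b.D))
      (Nat.land (Nat.lor a.L b.L) (Nat.lor a.R b.R)))
    fun h => Nat.ble (pop h m) 29

/-- Check that all pairs of masks have a small hull. -/
noncomputable def rc (m : ℕ) : ℕ → T → T → Bool
  | 0, _, _ => false
  | f+1, a, b => cond (small m a b) true
     (match a, b with
      | .leaf .., .leaf .. => false
      | .leaf .., .node _ _ _ _ _ l r => cond (rc m f a l) (rc m f a r) false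
      | .node _ _ _ _ _ l r, .leaf .. => cond (rc m f l b) (rc m f r b) false
      | .node n _ _ _ _ l r, .node n' _ _ _ _ l' r' =>
        cond (Nat.ble n' n) (cond (rc m f l b) (rc m f r b) false) (cond (rc m f a l') (rc m f a r') false))

/-- Splitting cells for each central piece. -/
def pivots : Fin 5 → List ℕ :=
  ![[123, 99, 76, 101, 125, 149, 173, 196, 171, 147, 122, 98, 75, 52, 77, 102, 126, 150, 174,
    197, 220, 195, 170, 146, 121, 97, 74, 51, 28, 53, 78, 103, 127, 151, 175, 198, 221, 244, 219,
    194, 169, 145, 120, 96, 73, 50, 27, 4, 29, 54, 79, 104, 128, 152, 176, 199, 222, 245, 268, 243,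
    218, 193, 168, 144, 72, 49, 26, 3, 5, 30, 55, 80, 105, 129, 153, 177, 200, 223, 246, 269, 267,
    242, 217, 192, 48, 25, 2, 6, 31, 56, 81, 106, 130, 154, 178, 201, 224, 247, 270, 266, 241,
    216],
    [99, 76, 77, 102, 125, 149, 172, 147, 123, 98, 75, 52, 53, 78, 103, 126, 150, 173, 196, 171,
    146, 122, 97, 74, 51, 28, 29, 54, 79, 104, 127, 151, 174, 197, 220, 195, 170, 145, 121, 96, 73,
    50, 27, 4, 5, 30, 55, 80, 105, 128, 152, 175, 198, 221, 244, 219, 194, 169, 144, 120, 72, 49,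
    26, 3, 6, 31, 56, 81, 106, 129, 153, 176, 199, 222, 245, 268, 243, 218, 193, 168, 48, 25, 2, 7,
    32, 57, 82, 107, 130, 154, 177, 200, 223, 246, 269, 267, 242, 217, 192],
    [99, 76, 77, 102, 127, 150, 149, 124, 98, 75, 52, 53, 78, 103, 128, 151, 174, 173, 148, 123,
    97, 74, 51, 28, 29, 54, 79, 104, 129, 152, 175, 198, 197, 172, 147, 122, 96, 73, 50, 27, 4, 5,
    30, 55, 80, 105, 130, 153, 176, 199, 222, 221, 196, 171, 146, 121, 72, 49, 26, 3, 6, 31, 56,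
    81, 106, 131, 154, 177, 200, 223, 246, 245, 220, 195, 170, 145, 120, 48, 25, 2, 7, 32, 57, 82,
    107, 155, 178, 201, 224, 247, 270, 269, 244, 219, 194, 169, 144],
    [99, 76, 77, 102, 126, 149, 148, 123, 98, 75, 52, 53, 78, 103, 127, 150, 173, 172, 147, 122,
    97, 74, 51, 28, 29, 54, 79, 104, 128, 151, 174, 197, 196, 171, 146, 121, 96, 73, 50, 27, 4, 5,
    30, 55, 80, 105, 129, 152, 175, 198, 221, 220, 195, 170, 145, 120, 72, 49, 26, 3, 6, 31, 56,
    81, 106, 130, 153, 176, 199, 222, 245, 244, 219, 194, 169, 144, 48, 25, 2, 7, 32, 57, 82, 107,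
    131, 154, 177, 200, 223, 246, 269, 268, 243, 218, 193, 168],
    [99, 76, 77, 78, 103, 126, 149, 124, 98, 75, 52, 53, 54, 79, 104, 127, 150, 173, 148, 123, 97,
    74, 51, 28, 29, 30, 55, 80, 105, 128, 151, 174, 197, 172, 147, 122, 96, 73, 50, 27, 4, 5, 6,
    31, 56, 81, 106, 129, 152, 175, 198, 221, 196, 171, 146, 121, 72, 49, 26, 3, 7, 32, 57, 82,
    107, 130, 153, 176, 199, 222, 245, 220, 195, 170, 145, 120, 48, 25, 2, 8, 33, 58, 83, 131, 154,
    177, 200, 223, 246, 269, 244, 219, 194, 169, 144]]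

/-- Every ninth bit, 33 times. -/
def ninth : ℕ → ℕ
  | 0 => 0
  | n+1 => 1 + 512 * ninth n

noncomputable def bow (C A1 A2 B1 B2 : Fin 5) : Bool :=
  force (Nat.shiftLeft (base (canon C)) 100) fun c => force (nb c) fun cn =>
  force (ninth 33) fun m =>
  near c cn shifts (orients A1) [] fun a1 => near c cn shifts (orients A2) [] fun a2 =>
  near c cn shifts (orients B1) [] fun b1 => near c cn shifts (orients B2) [] fun b2 =>
  wing c a1 a2 [] fun wa => wing c b1 b2 [] fun wb =>
  build (pivots C) wa fun ta => build (pivots C) wb fun tb => rc m 100 ta tb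

theorem bow_check : (bowL.all fun p => bow (p 0) (p 1) (p 2) (p 3) (p 4)) = true := by
  decide +kernel
end TF
namespace TF
/-! ### Meaning of the masks -/

theorem force_eq {α : Type} (n : ℕ) (k : ℕ → α) : force n k = k n := by
  have h1 : ∀ t : ℕ, (Nat.rec (k 0) (fun p _ => k (Nat.shiftRight (Nat.succ p) 64)) t : α) =
      k (t >>> 64) := by
    intro t
    cases t <;> rfl
  unfold force
  rw [h1]
  congr 1
  show (n <<< 64 + n % 2305843009213693951) >>> 64 = n
  rw [Nat.shiftLeft_eq, Nat.shiftRight_eq_div_pow]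
  omega

theorem beq_zero (n : ℕ) : Nat.beq n 0 = decide (n = 0) := by
  cases n <;> rfl

theorem land_def (a b : ℕ) : Nat.land a b = a &&& b := rfl
theorem lor_def (a b : ℕ) : Nat.lor a b = a ||| b := rfl
theorem shl_def (a b : ℕ) : Nat.shiftLeft a b = a <<< b := rfl
theorem shr_def (a b : ℕ) : Nat.shiftRight a b = a >>> b := rfl

theorem land_eq_zero {a b : ℕ} : a &&& b = 0 ↔ ∀ k, ¬ (a.testBit k = true ∧ b.testBit k = true) := by
  constructor
  · intro h k hk
    have := congrArg (fun n => n.testBit k) h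
    simp [Nat.testBit_and, hk.1, hk.2] at this
  · intro h
    apply Nat.eq_of_testBit_eq
    intro k
    have := h k
    rw [Nat.testBit_and, Nat.zero_testBit]
    cases h1 : a.testBit k <;> cases h2 : b.testBit k <;> simp_all

/-- The code of a cell. -/
def code (c : Cell) : ℕ := (c.1 + 24 * c.2).toNat

/-- The mask `m` represents the set `Q` of cells with coordinates in `[0, 20]`. -/
structure Rep (m : ℕ) (Q : Set Cell) : Prop where
  rng : ∀ c ∈ Q, 0 ≤ c.1 ∧ c.1 ≤ 20 ∧ 0 ≤ c.2 ∧ c.2 ≤ 20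
  bit : ∀ k, m.testBit k = true ↔ ∃ c ∈ Q, code c = k

theorem code_inj {c d : Cell} (hc : 0 ≤ c.1 ∧ c.1 ≤ 20 ∧ 0 ≤ c.2 ∧ c.2 ≤ 20)
    (hd : 0 ≤ d.1 ∧ d.1 ≤ 20 ∧ 0 ≤ d.2 ∧ d.2 ≤ 20) (h : code c = code d) : c = d := by
  unfold code at h
  ext <;> omega

theorem Rep.mem {m : ℕ} {Q : Set Cell} (h : Rep m Q) {c : Cell} (hc : c ∈ Q) :
    m.testBit (code c) = true := (h.bit _).2 ⟨c, hc, rfl⟩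

theorem Rep.disj {m m' : ℕ} {Q Q' : Set Cell} (h : Rep m Q) (h' : Rep m' Q') :
    m &&& m' = 0 ↔ Disjoint Q Q' := by
  rw [land_eq_zero, Set.disjoint_left]
  constructor
  · intro hk c hc hc'
    exact hk (code c) ⟨h.mem hc, h'.mem hc'⟩
  · rintro hd k ⟨h1, h2⟩
    obtain ⟨c, hc, rfl⟩ := (h.bit k).1 h1
    obtain ⟨d, hd', e⟩ := (h'.bit _).1 h2
    rw [code_inj (h'.rng d hd') (h.rng c hc) e] at hd'
    exact hd hc hd'

theorem nb_bit (m k : ℕ) : (nb m).testBit k = true ↔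
    (1 ≤ k ∧ m.testBit (k - 1) = true) ∨ m.testBit (k + 1) = true ∨
    (24 ≤ k ∧ m.testBit (k - 24) = true) ∨ m.testBit (k + 24) = true := by
  simp only [nb, lor_def, shl_def, shr_def, Nat.testBit_or, Nat.testBit_shiftLeft,
    Nat.testBit_shiftRight, Bool.or_eq_true, Bool.and_eq_true, decide_eq_true_eq]
  rw [add_comm 1 k, add_comm 24 k]
  tauto

theorem Rep.adj {m m' : ℕ} {Q Q' : Set Cell} (h : Rep m Q) (h' : Rep m' Q') :
    PieceAdj Q Q' ↔ nb m &&& m' ≠ 0 := by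
  constructor
  · rintro ⟨a, ha, b, hb, hab⟩ h0
    refine land_eq_zero.1 h0 (code b) ⟨?_, h'.mem hb⟩
    rw [nb_bit]
    have ra := h.rng a ha
    have rb := h'.rng b hb
    have ma := h.mem ha
    unfold Adj at hab
    unfold code at *
    have cases4 : (b.1 = a.1 + 1 ∧ b.2 = a.2) ∨ (b.1 = a.1 - 1 ∧ b.2 = a.2) ∨
        (b.1 = a.1 ∧ b.2 = a.2 + 1) ∨ (b.1 = a.1 ∧ b.2 = a.2 - 1) := by omega
    rcases cases4 with ⟨h1, h2⟩ | ⟨h1, h2⟩ | ⟨h1, h2⟩ | ⟨h1, h2⟩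
    · exact Or.inl ⟨by omega, by convert ma using 2; omega⟩
    · exact Or.inr (Or.inl (by convert ma using 2; omega))
    · exact Or.inr (Or.inr (Or.inl ⟨by omega, by convert ma using 2; omega⟩))
    · exact Or.inr (Or.inr (Or.inr (by convert ma using 2; omega)))
  · intro h0
    by_contra hcon
    refine h0 (land_eq_zero.2 ?_)
    rintro k ⟨h1, h2⟩
    obtain ⟨b, hb, rfl⟩ := (h'.bit k).1 h2
    have rb := h'.rng b hb
    rw [nb_bit] at h1
    have key : ∀ j, m.testBit j = true → (j + 1 = code b ∨ j = code b + 1 ∨ j + 24 = code b ∨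
        j = code b + 24) → False := by
      intro j hj hjb
      obtain ⟨a, ha, rfl⟩ := (h.bit j).1 hj
      have ra := h.rng a ha
      refine hcon ⟨a, ha, b, hb, ?_⟩
      unfold code at hjb
      unfold Adj
      omega
    rcases h1 with ⟨h3, h4⟩ | h4 | ⟨h3, h4⟩ | h4
    · exact key _ h4 (by omega)
    · exact key _ h4 (by omega)
    · exact key _ h4 (by omega)
    · exact key _ h4 (by omega)

theorem Rep.union {m m' : ℕ} {Q Q' : Set Cell} (h : Rep m Q) (h' : Rep m' Q') :
    Rep (m ||| m') (Q ∪ Q') := by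
  refine ⟨?_, ?_⟩
  · rintro c (hc | hc)
    · exact h.rng c hc
    · exact h'.rng c hc
  · intro k
    rw [Nat.testBit_or, Bool.or_eq_true, h.bit, h'.bit]
    constructor
    · rintro (⟨c, hc, e⟩ | ⟨c, hc, e⟩)
      · exact ⟨c, Or.inl hc, e⟩
      · exact ⟨c, Or.inr hc, e⟩
    · rintro ⟨c, hc | hc, e⟩
      · exact Or.inl ⟨c, hc, e⟩
      · exact Or.inr ⟨c, hc, e⟩

theorem base_bit (o : List (ℕ × ℕ)) (k : ℕ) :
    (base o).testBit k = true ↔ ∃ p ∈ o, p.1 + 24 * p.2 = k := by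
  induction o with
  | nil => simp [base]
  | cons p o ih =>
    have e : base (p :: o) = base o ||| 1 <<< (p.1 + 24 * p.2) := rfl
    rw [e, Nat.testBit_or, Bool.or_eq_true, ih, Nat.testBit_shiftLeft]
    have t1 : ∀ j : ℕ, (1 : ℕ).testBit j = true ↔ j = 0 := by
      intro j
      cases j <;> simp [Nat.testBit_succ]
    simp only [List.mem_cons, exists_eq_or_imp, Bool.and_eq_true, decide_eq_true_eq, t1]
    constructor
    · rintro (h | ⟨h1, h2⟩)
      · exact Or.inr h
      · left; omega
    · rintro (h | h)
      · right; omega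
      · exact Or.inl h

theorem rep_pset {o : List (ℕ × ℕ)} (ho : ∀ p ∈ o, p.1 ≤ 3 ∧ p.2 ≤ 3) {a b : ℕ} (ha : a ≤ 17)
    (hb : b ≤ 17) : Rep (base o <<< (a + 24 * b)) (pset o a b) := by
  refine ⟨?_, ?_⟩
  · rintro c ⟨p, hp, rfl⟩
    have := ho p hp
    simp only
    omega
  · intro k
    rw [Nat.testBit_shiftLeft, Bool.and_eq_true, base_bit, decide_eq_true_eq]
    constructor
    · rintro ⟨h, p, hp, e⟩
      refine ⟨_, ⟨p, hp, rfl⟩, ?_⟩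
      simp only [code]
      omega
    · rintro ⟨_, ⟨p, hp, rfl⟩, e⟩
      simp only [code] at e
      refine ⟨by omega, p, hp, by omega⟩

theorem orients_check : ∀ i, ∀ o ∈ orients i, (∀ p ∈ o, p.1 ≤ 3 ∧ p.2 ≤ 3) ∧ (∃ p ∈ o, p.1 = 0) ∧
    (∃ p ∈ o, p.2 = 0) := by
  decide +kernel

theorem canon_mem : ∀ i, canon i ∈ orients i := by
  decide +kernel

theorem canon_le (i : Fin 5) : ∀ p ∈ canon i, p.1 ≤ 3 ∧ p.2 ≤ 3 :=
  (orients_check i _ (canon_mem i)).1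

/-- Two touching pieces have nearby translation vectors. -/
theorem adj_near {o o' : List (ℕ × ℕ)} (ho : ∀ p ∈ o, p.1 ≤ 3 ∧ p.2 ≤ 3)
    (ho' : ∀ p ∈ o', p.1 ≤ 3 ∧ p.2 ≤ 3) {a b a' b' : ℤ} (h : PieceAdj (pset o a b) (pset o' a' b')) :
    a - 4 ≤ a' ∧ a' ≤ a + 4 ∧ b - 4 ≤ b' ∧ b' ≤ b + 4 := by
  obtain ⟨_, ⟨p, hp, rfl⟩, _, ⟨q, hq, rfl⟩, h⟩ := h
  have := ho p hp
  have := ho' q hq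
  unfold Adj at h
  simp only at h
  omega

/-! ### Collecting pieces -/

theorem collect_spec (c cn b : ℕ) (l : List ℕ) : ∀ (acc : List ℕ) (k : List ℕ → Bool),
    collect c cn b l acc k = true → ∃ acc', k acc' = true ∧ (∀ m ∈ acc, m ∈ acc') ∧
      ∀ s ∈ l, (b <<< s) &&& c = 0 → (b <<< s) &&& cn ≠ 0 → b <<< s ∈ acc' := by
  induction l with
  | nil => exact fun acc k h => ⟨acc, h, fun m hm => hm, by simp⟩
  | cons s l ih =>
    intro acc k h
    have e : collect c cn b (s :: l) acc k = force (Nat.shiftLeft b s) (fun m =>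
      cond (Nat.beq (Nat.land m c) 0)
        (cond (Nat.beq (Nat.land m cn) 0) (collect c cn b l acc k) (collect c cn b l (m :: acc) k))
        (collect c cn b l acc k)) := rfl
    rw [e, force_eq] at h
    simp only [beq_zero, land_def, shl_def, Bool.cond_decide] at h
    split_ifs at h with h1 h2
    · obtain ⟨acc', h3, h4, h5⟩ := ih _ _ h
      refine ⟨acc', h3, h4, ?_⟩
      intro t ht ht1 ht2
      rcases List.mem_cons.1 ht with rfl | ht
      · exact absurd h2 ht2
      · exact h5 t ht ht1 ht2
    · obtain ⟨acc', h3, h4, h5⟩ := ih _ _ h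
      refine ⟨acc', h3, fun m hm => h4 m (List.mem_cons_of_mem _ hm), ?_⟩
      intro t ht ht1 ht2
      rcases List.mem_cons.1 ht with rfl | ht
      · exact h4 _ List.mem_cons_self
      · exact h5 t ht ht1 ht2
    · obtain ⟨acc', h3, h4, h5⟩ := ih _ _ h
      refine ⟨acc', h3, h4, ?_⟩
      intro t ht ht1 ht2
      rcases List.mem_cons.1 ht with rfl | ht
      · exact absurd ht1 h1
      · exact h5 t ht ht1 ht2

theorem near_spec (c cn : ℕ) (sh : List ℕ) (l : List (List (ℕ × ℕ))) :
    ∀ (acc : List ℕ) (k : List ℕ → Bool),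
    near c cn sh l acc k = true → ∃ acc', k acc' = true ∧ (∀ m ∈ acc, m ∈ acc') ∧
      ∀ o ∈ l, ∀ s ∈ sh, (base o <<< s) &&& c = 0 → (base o <<< s) &&& cn ≠ 0 → base o <<< s ∈ acc' := by
  induction l with
  | nil => exact fun acc k h => ⟨acc, h, fun m hm => hm, by simp⟩
  | cons o l ih =>
    intro acc k h
    have e : near c cn sh (o :: l) acc k = force (base o) (fun b => collect c cn b sh acc fun acc' =>
      near c cn sh l acc' k) := rfl
    rw [e, force_eq] at h
    obtain ⟨acc1, h1, h2, h3⟩ := collect_spec _ _ _ _ _ _ h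
    obtain ⟨acc', h4, h5, h6⟩ := ih _ _ h1
    refine ⟨acc', h4, fun m hm => h5 m (h2 m hm), ?_⟩
    intro o' ho' s hs hs1 hs2
    rcases List.mem_cons.1 ho' with rfl | ho'
    · exact h5 _ (h3 s hs hs1 hs2)
    · exact h6 o' ho' s hs hs1 hs2

/-- The list produced by `near` contains the masks of all touching disjoint pieces. -/
theorem near_rep {c d e : ℕ} {sh : List ℕ} {o₀ : List (ℕ × ℕ)} (ho₀ : ∀ p ∈ o₀, p.1 ≤ 3 ∧ p.2 ≤ 3)
    (hc : Rep c (pset o₀ d e)) (hd : 4 ≤ d) (he : 4 ≤ e) (hd' : d + 4 ≤ 17) (he' : e + 4 ≤ 17)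
    (hsh : ∀ x y : ℕ, d ≤ x + 4 → x ≤ d + 4 → e ≤ y + 4 → y ≤ e + 4 → x + 24 * y ∈ sh)
    {i : Fin 5} {k : List ℕ → Bool} (h : near c (nb c) sh (orients i) [] k = true) :
    ∃ l, k l = true ∧ ∀ Q, IsPlacement (tets i) Q → Disjoint Q (pset o₀ d e) →
      PieceAdj (pset o₀ d e) Q → ∃ m ∈ l, Rep m Q := by
  obtain ⟨l, h1, -, h2⟩ := near_spec _ _ _ _ _ _ h
  refine ⟨l, h1, ?_⟩
  intro Q hQ hdis hadj
  obtain ⟨o, ho, a, b, rfl⟩ := placement_orient hQ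
  have hol := (orients_check i o ho).1
  have hn := adj_near ho₀ hol hadj
  lift a to ℕ using by omega
  lift b to ℕ using by omega
  have hr : Rep (base o <<< (a + 24 * b)) (pset o a b) := rep_pset hol (by omega) (by omega)
  refine ⟨_, h2 o ho (a + 24 * b) (hsh a b (by omega) (by omega) (by omega) (by omega)) ?_ ?_, hr⟩
  · exact (hr.disj hc).2 hdis
  · rw [Nat.land_comm]
    exact (hc.adj hr).1 hadj

end TF
namespace TF
/-! ### Correctness of the bow tie computation -/

theorem wing1_spec (c x xn : ℕ) (l : List ℕ) : ∀ (acc : List ℕ) (k : List ℕ → Bool),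
    wing1 c x xn l acc k = true → ∃ acc', k acc' = true ∧ (∀ m ∈ acc, m ∈ acc') ∧
      ∀ y ∈ l, x &&& y = 0 → xn &&& y ≠ 0 → c ||| (x ||| y) ∈ acc' := by
  induction l with
  | nil => exact fun acc k h => ⟨acc, h, fun m hm => hm, by simp⟩
  | cons y l ih =>
    intro acc k h
    have e : wing1 c x xn (y :: l) acc k =
      cond (Nat.beq (Nat.land x y) 0)
        (cond (Nat.beq (Nat.land xn y) 0) (wing1 c x xn l acc k)
          (force (Nat.lor c (Nat.lor x y)) fun m => wing1 c x xn l (m :: acc) k))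
        (wing1 c x xn l acc k) := rfl
    rw [e, force_eq] at h
    simp only [beq_zero, land_def, lor_def, Bool.cond_decide] at h
    split_ifs at h with h1 h2
    · obtain ⟨acc', h3, h4, h5⟩ := ih _ _ h
      refine ⟨acc', h3, h4, ?_⟩
      intro t ht ht1 ht2
      rcases List.mem_cons.1 ht with rfl | ht
      · exact absurd h2 ht2
      · exact h5 t ht ht1 ht2
    · obtain ⟨acc', h3, h4, h5⟩ := ih _ _ h
      refine ⟨acc', h3, fun m hm => h4 m (List.mem_cons_of_mem _ hm), ?_⟩
      intro t ht ht1 ht2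
      rcases List.mem_cons.1 ht with rfl | ht
      · exact h4 _ List.mem_cons_self
      · exact h5 t ht ht1 ht2
    · obtain ⟨acc', h3, h4, h5⟩ := ih _ _ h
      refine ⟨acc', h3, h4, ?_⟩
      intro t ht ht1 ht2
      rcases List.mem_cons.1 ht with rfl | ht
      · exact absurd ht1 h1
      · exact h5 t ht ht1 ht2

theorem wing_spec (c : ℕ) (ys : List ℕ) (l : List ℕ) : ∀ (acc : List ℕ) (k : List ℕ → Bool),
    wing c ys l acc k = true → ∃ acc', k acc' = true ∧ (∀ m ∈ acc, m ∈ acc') ∧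
      ∀ x ∈ l, ∀ y ∈ ys, x &&& y = 0 → nb x &&& y ≠ 0 → c ||| (x ||| y) ∈ acc' := by
  induction l with
  | nil => exact fun acc k h => ⟨acc, h, fun m hm => hm, by simp⟩
  | cons x l ih =>
    intro acc k h
    have e : wing c ys (x :: l) acc k = force (nb x) (fun xn => wing1 c x xn ys acc fun acc' =>
      wing c ys l acc' k) := rfl
    rw [e, force_eq] at h
    obtain ⟨acc1, h1, h2, h3⟩ := wing1_spec _ _ _ _ _ _ h
    obtain ⟨acc', h4, h5, h6⟩ := ih _ _ h1
    refine ⟨acc', h4, fun m hm => h5 m (h2 m hm), ?_⟩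
    intro x' hx' s hs hs1 hs2
    rcases List.mem_cons.1 hx' with rfl | hx'
    · exact h5 _ (h3 s hs hs1 hs2)
    · exact h6 x' hx' s hs hs1 hs2

/-- All shadows of the mask `x` are below the given masks. -/
def Sub (x U D L R : ℕ) : Prop := ∀ k, x.testBit k = true → ∀ j ≤ 11,
  U.testBit (k + 24 * j) = true ∧ L.testBit (k + j) = true ∧
  (∀ k', k' + 24 * j = k → D.testBit k' = true) ∧ (∀ k', k' + j = k → R.testBit k' = true)

def T.has (x : ℕ) : T → Prop
  | .leaf U D L R => Sub x U D L R
  | .node _ U D L R l r => Sub x U D L R ∧ (l.has x ∨ r.has x)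

theorem T.has.has_sub {x : ℕ} {t : T} (h : t.has x) : Sub x t.U t.D t.L t.R := by
  cases t with
  | leaf U D L R => exact h
  | node n U D L R l r => exact h.1

theorem smL_spec (d m k j : ℕ) (hj : j ≤ 11) (h : m.testBit k = true) :
    (smL d m).testBit (k + d * j) = true := by
  have key : ∀ (a s k : ℕ), a.testBit k = true → (a ||| a <<< s).testBit k = true ∧
      (a ||| a <<< s).testBit (k + s) = true := by
    intro a s k h
    simp [Nat.testBit_or, Nat.testBit_shiftLeft, h]
  have key2 : ∀ (a s k : ℕ) (b : ℕ), b ≤ 1 → a.testBit k = true →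
      (a ||| a <<< s).testBit (k + s * b) = true := by
    intro a s k b hb h
    interval_cases b
    · simpa using (key a s k h).1
    · simpa using (key a s k h).2
  unfold smL
  simp only [force_eq, lor_def, shl_def, Nat.mul_eq]
  obtain ⟨b0, b1, b2, b3, h0, h1, h2, h3, e⟩ : ∃ b0 b1 b2 b3 : ℕ, b0 ≤ 1 ∧ b1 ≤ 1 ∧ b2 ≤ 1 ∧ b3 ≤ 1 ∧
      j = b0 + 2 * b1 + 4 * b2 + 4 * b3 := by
    refine ⟨j % 2, j / 2 % 2, (if 4 ≤ j then 1 else 0), (if 8 ≤ j then 1 else 0), ?_, ?_, ?_, ?_, ?_⟩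
    · omega
    · omega
    · split_ifs <;> omega
    · split_ifs <;> omega
    · split_ifs <;> omega
  have := key2 _ (4 * d) _ b3 h3 (key2 _ (4 * d) _ b2 h2 (key2 _ (2 * d) _ b1 h1 (key2 _ d _ b0 h0 h)))
  rw [show k + d * j = k + d * b0 + 2 * d * b1 + 4 * d * b2 + 4 * d * b3 by rw [e]; ring]
  exact this

theorem smR_spec (d m k k' j : ℕ) (hj : j ≤ 11) (h : m.testBit k = true) (hk : k' + d * j = k) :
    (smR d m).testBit k' = true := by
  have key2 : ∀ (a s k : ℕ) (b : ℕ), b ≤ 1 → a.testBit (k + s * b) = true →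
      (a ||| a >>> s).testBit k = true := by
    intro a s k b hb h
    interval_cases b
    · simp at h; simp [Nat.testBit_or, h]
    · simp at h; simp [Nat.testBit_or, Nat.testBit_shiftRight, add_comm s k, h]
  unfold smR
  simp only [force_eq, lor_def, shr_def, Nat.mul_eq]
  obtain ⟨b0, b1, b2, b3, h0, h1, h2, h3, e⟩ : ∃ b0 b1 b2 b3 : ℕ, b0 ≤ 1 ∧ b1 ≤ 1 ∧ b2 ≤ 1 ∧ b3 ≤ 1 ∧
      j = b0 + 2 * b1 + 4 * b2 + 4 * b3 := by
    refine ⟨j % 2, j / 2 % 2, (if 4 ≤ j then 1 else 0), (if 8 ≤ j then 1 else 0), ?_, ?_, ?_, ?_, ?_⟩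
    · omega
    · omega
    · split_ifs <;> omega
    · split_ifs <;> omega
    · split_ifs <;> omega
  refine key2 _ (4 * d) _ b3 h3 (key2 _ (4 * d) _ b2 h2 (key2 _ (2 * d) _ b1 h1 (key2 _ d _ b0 h0 ?_)))
  rw [show k' + 4 * d * b3 + 4 * d * b2 + 2 * d * b1 + d * b0 = k by rw [← hk, e]; ring]
  exact h

theorem orall_spec (l : List ℕ) : ∀ (a k : ℕ), (a.testBit k = true ∨ ∃ x ∈ l, x.testBit k = true) →
    (orall l a).testBit k = true := by
  induction l with
  | nil =>
    intro a k h
    rcases h with h | ⟨x, hx, -⟩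
    · exact h
    · simp at hx
  | cons y l ih =>
    intro a k h
    have e : orall (y :: l) a = force (Nat.lor y a) (fun b => orall l b) := rfl
    rw [e, force_eq]
    apply ih
    rw [lor_def, Nat.testBit_or, Bool.or_eq_true]
    rcases h with h | ⟨x, hx, hk⟩
    · exact Or.inl (Or.inr h)
    · rcases List.mem_cons.1 hx with rfl | hx
      · exact Or.inl (Or.inl hk)
      · exact Or.inr ⟨x, hx, hk⟩

theorem part_spec (p : ℕ) (l : List ℕ) : ∀ (a b : List ℕ) (k : List ℕ → List ℕ → Bool),
    part p l a b k = true → ∃ a' b', k a' b' = true ∧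
      ∀ x, (x ∈ l ∨ x ∈ a ∨ x ∈ b) → x ∈ a' ∨ x ∈ b' := by
  induction l with
  | nil => exact fun a b k h => ⟨a, b, h, by simp⟩
  | cons y l ih =>
    intro a b k h
    have e : part p (y :: l) a b k = cond (Nat.beq (Nat.land (Nat.shiftRight y p) 1) 0)
      (part p l a (y :: b) k) (part p l (y :: a) b k) := rfl
    rw [e] at h
    cases hc : Nat.beq (Nat.land (Nat.shiftRight y p) 1) 0
    all_goals
      rw [hc] at h
      obtain ⟨a', b', h1, h2⟩ := ih _ _ _ h
      refine ⟨a', b', h1, fun x hx => h2 x ?_⟩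
      simp only [List.mem_cons] at hx ⊢
      tauto

theorem mkleaf_spec (l : List ℕ) (k : T → Bool) (h : mkleaf l k = true) :
    ∃ t, k t = true ∧ ∀ x ∈ l, t.has x := by
  unfold mkleaf at h
  simp only [force_eq] at h
  refine ⟨_, h, ?_⟩
  intro x hx b hb j hj
  have hm := orall_spec l 0 b (Or.inr ⟨x, hx, hb⟩)
  refine ⟨smL_spec 24 _ _ _ hj hm, ?_, fun k' hk => smR_spec 24 _ _ _ _ hj hm hk,
    fun k' hk => smR_spec 1 _ _ _ j hj hm (by omega)⟩
  simpa using smL_spec 1 _ _ _ hj hm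

theorem mknode_spec (a b : T) (k : T → Bool) (h : mknode a b k = true) :
    ∃ t, k t = true ∧ ∀ x, (a.has x ∨ b.has x) → t.has x := by
  unfold mknode at h
  simp only [force_eq] at h
  refine ⟨_, h, ?_⟩
  intro x hx
  refine ⟨?_, hx⟩
  simp only [lor_def]
  intro i hi j hj
  simp only [Nat.testBit_or, Bool.or_eq_true]
  rcases hx with hx | hx
  · obtain ⟨h1, h2, h3, h4⟩ := hx.has_sub i hi j hj
    exact ⟨Or.inl h1, Or.inl h2, fun k' hk => Or.inl (h3 k' hk), fun k' hk => Or.inl (h4 k' hk)⟩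
  · obtain ⟨h1, h2, h3, h4⟩ := hx.has_sub i hi j hj
    exact ⟨Or.inr h1, Or.inr h2, fun k' hk => Or.inr (h3 k' hk), fun k' hk => Or.inr (h4 k' hk)⟩

theorem short_cases {α : Type} (a b c : α) (l : List ℕ) :
    (l = [] ∧ short a b c l = a) ∨ short a b c l = b ∨ short a b c l = c := by
  rcases l with _ | ⟨x, _ | ⟨y, l⟩⟩
  · exact Or.inl ⟨rfl, rfl⟩
  · exact Or.inr (Or.inl rfl)
  · exact Or.inr (Or.inr rfl)

theorem build_spec (ps : List ℕ) : ∀ (l : List ℕ) (k : T → Bool), build ps l k = true →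
    ∃ t, k t = true ∧ ∀ x ∈ l, t.has x := by
  induction ps with
  | nil => exact fun l k h => mkleaf_spec l k h
  | cons p ps ih =>
    intro l k h
    have e : build (p :: ps) l k =
      short (mkleaf l k) (mkleaf l k) (part p l [] [] fun a b =>
      short (build ps b k)
        (short (build ps a k) (mkleaf a fun ta => mkleaf b fun tb => mknode ta tb k)
          (mkleaf a fun ta => build ps b fun tb => mknode ta tb k) b)
        (short (build ps a k) (build ps a fun ta => mkleaf b fun tb => mknode ta tb k)
          (build ps a fun ta => build ps b fun tb => mknode ta tb k) b) a) l := rfl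
    rw [e] at h
    -- combining two subtrees
    have comb : ∀ (a b : List ℕ) (f g : (T → Bool) → Bool),
        (∀ k, f k = true → ∃ t, k t = true ∧ ∀ x ∈ a, t.has x) →
        (∀ k, g k = true → ∃ t, k t = true ∧ ∀ x ∈ b, t.has x) →
        (f fun ta => g fun tb => mknode ta tb k) = true →
        ∃ t, k t = true ∧ ∀ x, (x ∈ a ∨ x ∈ b) → t.has x := by
      intro a b f g hf hg h
      obtain ⟨ta, h1, ha⟩ := hf _ h
      obtain ⟨tb, h2, hb⟩ := hg _ h1
      obtain ⟨t, h3, ht⟩ := mknode_spec _ _ _ h2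
      exact ⟨t, h3, fun x hx => ht x (hx.imp (ha x) (hb x))⟩
    rcases short_cases (mkleaf l k) (mkleaf l k) (part p l [] [] fun a b =>
      short (build ps b k)
        (short (build ps a k) (mkleaf a fun ta => mkleaf b fun tb => mknode ta tb k)
          (mkleaf a fun ta => build ps b fun tb => mknode ta tb k) b)
        (short (build ps a k) (build ps a fun ta => mkleaf b fun tb => mknode ta tb k)
          (build ps a fun ta => build ps b fun tb => mknode ta tb k) b) a) l with ⟨-, hs⟩ | hs | hs
    · rw [hs] at h; exact mkleaf_spec l k h
    · rw [hs] at h; exact mkleaf_spec l k h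
    · rw [hs] at h
      obtain ⟨a, b, h1, h2⟩ := part_spec _ _ _ _ _ h
      have h3 : ∀ x ∈ l, x ∈ a ∨ x ∈ b := fun x hx => h2 x (Or.inl hx)
      suffices hh : ∃ t, k t = true ∧ ∀ x, (x ∈ a ∨ x ∈ b) → t.has x by
        obtain ⟨t, ht, hh⟩ := hh
        exact ⟨t, ht, fun x hx => hh x (h3 x hx)⟩
      rcases short_cases (build ps b k)
        (short (build ps a k) (mkleaf a fun ta => mkleaf b fun tb => mknode ta tb k)
          (mkleaf a fun ta => build ps b fun tb => mknode ta tb k) b)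
        (short (build ps a k) (build ps a fun ta => mkleaf b fun tb => mknode ta tb k)
          (build ps a fun ta => build ps b fun tb => mknode ta tb k) b) a with ⟨ea, hs⟩ | hs | hs
      · rw [hs] at h1
        obtain ⟨t, ht, hh⟩ := ih _ _ h1
        refine ⟨t, ht, fun x hx => hh x ?_⟩
        rcases hx with hx | hx
        · simp [ea] at hx
        · exact hx
      all_goals
        rw [hs] at h1
        rcases short_cases (build ps a k) (mkleaf a fun ta => mkleaf b fun tb => mknode ta tb k)
          (mkleaf a fun ta => build ps b fun tb => mknode ta tb k) b with ⟨eb, hs⟩ | hs | hs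
        all_goals try rw [hs] at h1
      · obtain ⟨t, ht, hh⟩ := ih _ _ h1
        refine ⟨t, ht, fun x hx => hh x ?_⟩
        rcases hx with hx | hx
        · exact hx
        · simp [eb] at hx
      · exact comb a b _ _ (mkleaf_spec a) (mkleaf_spec b) h1
      · exact comb a b _ _ (mkleaf_spec a) (ih b) h1
      all_goals
        rcases short_cases (build ps a k) (build ps a fun ta => mkleaf b fun tb => mknode ta tb k)
          (build ps a fun ta => build ps b fun tb => mknode ta tb k) b with ⟨eb, hs⟩ | hs | hs
        · rw [hs] at h1
          obtain ⟨t, ht, hh⟩ := ih _ _ h1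
          refine ⟨t, ht, fun x hx => hh x ?_⟩
          rcases hx with hx | hx
          · exact hx
          · simp [eb] at hx
        · rw [hs] at h1
          exact comb a b _ _ (ih a) (mkleaf_spec b) h1
        · rw [hs] at h1
          exact comb a b _ _ (ih a) (ih b) h1

/-! #### Counting bits -/

theorem land_ninth (n : ℕ) : ∀ G, n &&& ninth G = ∑ g ∈ Finset.range G, (n.testBit (9 * g)).toNat * 512 ^ g := by
  intro G
  induction G generalizing n with
  | zero => simp [ninth]
  | succ G ih =>
    rw [Finset.sum_range_succ']
    have e : n &&& ninth (G + 1) = (n.testBit 0).toNat + 512 * ((n / 512) &&& ninth G) := by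
      apply Nat.eq_of_testBit_eq
      intro k
      have hb : (n.testBit 0).toNat < 2 ^ 9 := by cases n.testBit 0 <;> simp
      have s1 : (n.testBit 0).toNat + 512 * ((n / 512) &&& ninth G) =
        2 ^ 9 * ((n / 512) &&& ninth G) + (n.testBit 0).toNat := by omega
      have s2 : ninth (G + 1) = 2 ^ 9 * ninth G + 1 := by simp only [ninth]; omega
      rw [s1, Nat.testBit_two_pow_mul_add _ hb, Nat.testBit_and, s2,
        Nat.testBit_two_pow_mul_add _ (by norm_num)]
      split_ifs with hk
      · rcases k with _ | k
        · cases n.testBit 0 <;> simp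
        · have : (1 : ℕ).testBit (k + 1) = false := by simp [Nat.testBit_succ]
          rw [this]
          cases n.testBit 0 <;> simp [Nat.testBit_succ]
      · rw [Nat.testBit_and, show (512 : ℕ) = 2 ^ 9 by norm_num, Nat.testBit_div_two_pow]
        rw [Nat.sub_add_cancel (by omega)]
    rw [e, ih, Finset.mul_sum, add_comm]
    congr 1
    · apply Finset.sum_congr rfl
      intro g _
      rw [show (512 : ℕ) = 2 ^ 9 by norm_num, Nat.testBit_div_two_pow,
        show 9 * g + 9 = 9 * (g + 1) by ring]
      ring
    · simp

theorem land_ninth_mod (n G : ℕ) :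
    n &&& ninth G ≡ ∑ g ∈ Finset.range G, (n.testBit (9 * g)).toNat [MOD 511] := by
  rw [land_ninth]
  induction G with
  | zero => rfl
  | succ G ih =>
    rw [Finset.sum_range_succ, Finset.sum_range_succ]
    refine ih.add ?_
    have : 512 ^ G ≡ 1 ^ G [MOD 511] := Nat.ModEq.pow G (by decide)
    rw [one_pow] at this
    simpa using (Nat.ModEq.refl ((n.testBit (9 * G)).toNat)).mul this

theorem pop_eq (n : ℕ) : pop n (ninth 33) =
    ∑ r ∈ Finset.range 9, ∑ g ∈ Finset.range 33, (n.testBit (9 * g + r)).toNat := by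
  have hs : ∀ r, (n >>> r) &&& ninth 33 ≡ ∑ g ∈ Finset.range 33, (n.testBit (9 * g + r)).toNat [MOD 511] := by
    intro r
    refine (land_ninth_mod _ _).trans ?_
    simp only [Nat.testBit_shiftRight, add_comm r]
    rfl
  have hlt : ∑ r ∈ Finset.range 9, ∑ g ∈ Finset.range 33, (n.testBit (9 * g + r)).toNat < 511 := by
    calc _ ≤ ∑ r ∈ Finset.range 9, ∑ g ∈ Finset.range 33, 1 :=
          Finset.sum_le_sum fun r _ => Finset.sum_le_sum fun g _ => Bool.toNat_le _
      _ < 511 := by simp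
  rw [← Nat.mod_eq_of_lt hlt]
  show (_ : ℕ) % 511 = _
  simp only [Finset.sum_range_succ _ 8, Finset.sum_range_succ _ 7, Finset.sum_range_succ _ 6,
    Finset.sum_range_succ _ 5, Finset.sum_range_succ _ 4, Finset.sum_range_succ _ 3,
    Finset.sum_range_succ _ 2, Finset.sum_range_succ _ 1, Finset.sum_range_succ _ 0,
    Finset.sum_range_zero, zero_add]
  have := ((((((((hs 0).add (hs 1)).add (hs 2)).add (hs 3)).add (hs 4)).add (hs 5)).add (hs 6)).add
    (hs 7)).add (hs 8)
  refine Eq.trans ?_ this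
  congr 1
  simp only [land_def, shr_def, Nat.add_eq, Nat.shiftRight_zero]
  ring

theorem card_le_pop (n : ℕ) (S : Finset ℕ) (hS : ∀ k ∈ S, k < 297 ∧ n.testBit k = true) :
    S.card ≤ pop n (ninth 33) := by
  rw [pop_eq, Finset.card_eq_sum_card_fiberwise (f := fun k => k % 9) (t := Finset.range 9)
    (fun k _ => by simpa using Nat.mod_lt k (by norm_num))]
  apply Finset.sum_le_sum
  intro r hr
  have : ∑ g ∈ Finset.range 33, (n.testBit (9 * g + r)).toNat =
      ((Finset.range 33).filter fun g => n.testBit (9 * g + r) = true).card := by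
    rw [Finset.card_filter]
    apply Finset.sum_congr rfl
    intro g _
    cases n.testBit (9 * g + r) <;> simp
  rw [this]
  apply Finset.card_le_card_of_injOn (fun k => k / 9)
  · intro k hk
    simp only [Finset.coe_filter, Set.mem_ofPred_eq, Finset.mem_range] at hk ⊢
    obtain ⟨h1, h2⟩ := hS k hk.1
    refine ⟨by omega, ?_⟩
    rw [← hk.2, Nat.div_add_mod]
    exact h2
  · intro k hk l hl e
    simp only [Finset.coe_filter, Set.mem_ofPred_eq] at hk hl
    simp only at e
    omega

/-- The cell with code `k` is between cells of the union of the masks in all four directions. -/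
def InHull (x y k : ℕ) : Prop :=
  (∃ j ≤ 11, ∃ k0, k0 + 24 * j = k ∧ (x.testBit k0 = true ∨ y.testBit k0 = true)) ∧
  (∃ j ≤ 11, ∃ k0, k + 24 * j = k0 ∧ (x.testBit k0 = true ∨ y.testBit k0 = true)) ∧
  (∃ j ≤ 11, ∃ k0, k0 + j = k ∧ (x.testBit k0 = true ∨ y.testBit k0 = true)) ∧
  (∃ j ≤ 11, ∃ k0, k + j = k0 ∧ (x.testBit k0 = true ∨ y.testBit k0 = true))

theorem small_spec {a b : T} {x y : ℕ} (h : small (ninth 33) a b = true) (ha : a.has x) (hb : b.has y)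
    (S : Finset ℕ) (hS : ∀ k ∈ S, k < 297 ∧ InHull x y k) : S.card ≤ 29 := by
  unfold small at h
  rw [force_eq, Nat.ble_eq] at h
  refine le_trans (card_le_pop _ S ?_) h
  intro k hk
  obtain ⟨h1, ⟨j1, hj1, k1, e1, h2⟩, ⟨j2, hj2, k2, e2, h3⟩, ⟨j3, hj3, k3, e3, h4⟩, ⟨j4, hj4, k4, e4, h5⟩⟩ := hS k hk
  refine ⟨h1, ?_⟩
  simp only [land_def, lor_def, Nat.testBit_and, Nat.testBit_or, Bool.and_eq_true, Bool.or_eq_true]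
  have A := ha.has_sub
  have B := hb.has_sub
  refine ⟨⟨?_, ?_⟩, ?_, ?_⟩
  · exact h2.imp (fun h => e1 ▸ (A _ h _ hj1).1) (fun h => e1 ▸ (B _ h _ hj1).1)
  · exact h3.imp (fun h => (A _ h _ hj2).2.2.1 _ e2) (fun h => (B _ h _ hj2).2.2.1 _ e2)
  · exact h4.imp (fun h => e3 ▸ (A _ h _ hj3).2.1) (fun h => e3 ▸ (B _ h _ hj3).2.1)
  · exact h5.imp (fun h => (A _ h _ hj4).2.2.2 _ e4) (fun h => (B _ h _ hj4).2.2.2 _ e4)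

theorem rc_spec {x y : ℕ} : ∀ (f : ℕ) (a b : T), rc (ninth 33) f a b = true → a.has x → b.has y →
    ∀ (S : Finset ℕ), (∀ k ∈ S, k < 297 ∧ InHull x y k) → S.card ≤ 29 := by
  intro f
  induction f with
  | zero => intro a b h; simp [rc] at h
  | succ f ih =>
    intro a b h ha hb S hS
    unfold rc at h
    cases hs : small (ninth 33) a b
    · rw [hs, cond_false] at h
      rcases a with ⟨U, D, L, R⟩ | ⟨n, U, D, L, R, l, r⟩ <;>
        rcases b with ⟨U', D', L', R'⟩ | ⟨n', U', D', L', R', l', r'⟩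
      · simp at h
      · simp only [Bool.cond_false_right, Bool.and_eq_true] at h
        exact hb.2.elim (fun hb => ih _ _ h.1 ha hb S hS) (fun hb => ih _ _ h.2 ha hb S hS)
      · simp only [Bool.cond_false_right, Bool.and_eq_true] at h
        exact ha.2.elim (fun ha => ih _ _ h.1 ha hb S hS) (fun ha => ih _ _ h.2 ha hb S hS)
      · cases hn : Nat.ble n' n
        · simp only [hn, Bool.cond_false_right, cond_false, Bool.and_eq_true] at h
          exact hb.2.elim (fun hb => ih _ _ h.1 ha hb S hS) (fun hb => ih _ _ h.2 ha hb S hS)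
        · simp only [hn, Bool.cond_false_right, cond_true, Bool.and_eq_true] at h
          exact ha.2.elim (fun ha => ih _ _ h.1 ha hb S hS) (fun ha => ih _ _ h.2 ha hb S hS)
    · exact small_spec hs ha hb S hS

end TF
namespace TF

theorem orients_check2 : ∀ i, ∀ o ∈ orients i, o.Nodup ∧ o.length = 4 := by
  decide +kernel

theorem placement_finset {i : Fin 5} {Q : Set Cell} (hQ : IsPlacement (tets i) Q) :
    ∃ s : Finset Cell, (s : Set Cell) = Q ∧ s.card = 4 := by
  obtain ⟨o, ho, a, b, rfl⟩ := placement_orient hQ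
  obtain ⟨h1, h2⟩ := orients_check2 i o ho
  refine ⟨o.toFinset.image fun p => ((p.1 : ℤ) + a, (p.2 : ℤ) + b), ?_, ?_⟩
  · ext c
    simp only [Finset.coe_image, Set.mem_image, Finset.mem_coe, List.mem_toFinset, pset]
    constructor
    · rintro ⟨p, hp, rfl⟩
      exact ⟨p, hp, rfl⟩
    · rintro ⟨p, hp, rfl⟩
      exact ⟨p, hp, rfl⟩
  · rw [Finset.card_image_of_injective, List.toFinset_card_of_nodup h1, h2]
    intro p q h
    simp only [Prod.mk.injEq, add_left_inj, Nat.cast_inj] at h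
    exact Prod.ext h.1 h.2

/-- The trapped cells together with the pieces. -/
theorem Conf.total (C : Conf) : ∃ Z : Finset Cell, 30 ≤ Z.card ∧ ∀ z ∈ Z, z ∈ C.E ∨ ∃ i, z ∈ C.piece i := by
  choose s hs hs4 using fun i => placement_finset (C.placement i)
  have hmem : ∀ i c, c ∈ s i ↔ c ∈ C.piece i := fun i c => by rw [← hs i]; simp
  have hd : ((Finset.univ : Finset (Fin 5)) : Set (Fin 5)).PairwiseDisjoint s := by
    intro i _ j _ hij
    rw [Function.onFun, ← Finset.disjoint_coe, hs, hs]
    exact C.disj hij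
  have hc : (Finset.univ.biUnion s).card = 20 := by
    rw [Finset.card_biUnion hd]
    simp [hs4]
  have hdE : Disjoint C.E (Finset.univ.biUnion s) := by
    rw [Finset.disjoint_left]
    intro e he h
    obtain ⟨i, -, hi⟩ := Finset.mem_biUnion.1 h
    exact C.avoid e he i ((hmem i e).1 hi)
  refine ⟨C.E ∪ Finset.univ.biUnion s, ?_, ?_⟩
  · rw [Finset.card_union_of_disjoint hdE, hc]
    have := C.card
    omega
  · intro z hz
    rcases Finset.mem_union.1 hz with h | h
    · exact Or.inl h
    · obtain ⟨i, -, hi⟩ := Finset.mem_biUnion.1 h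
      exact Or.inr ⟨i, (hmem i z).1 hi⟩

theorem Conf.hull (C : Conf) (hB : ∀ i, ∀ c ∈ C.piece i, 0 ≤ c.1 ∧ c.1 ≤ 11 ∧ 0 ≤ c.2 ∧ c.2 ≤ 11)
    {x y : ℕ} (hxy : ∀ i, ∀ c ∈ C.piece i, x.testBit (code c) = true ∨ y.testBit (code c) = true) :
    ∃ S : Finset ℕ, 30 ≤ S.card ∧ ∀ k ∈ S, k < 297 ∧ InHull x y k := by
  obtain ⟨Z, hZ, hZm⟩ := C.total
  have ray : ∀ z ∈ Z, ∀ d : Cell, d.1.natAbs + d.2.natAbs = 1 →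
      ∃ k : ℕ, ∃ i, (z.1 + k * d.1, z.2 + k * d.2) ∈ C.piece i := by
    intro z hz d hd
    rcases hZm z hz with h | ⟨i, h⟩
    · exact C.ray d hd z h
    · exact ⟨0, i, by simpa using h⟩
  have four : ∀ z ∈ Z, (0 ≤ z.1 ∧ z.1 ≤ 11 ∧ 0 ≤ z.2 ∧ z.2 ≤ 11) ∧ InHull x y (code z) := by
    intro z hz
    obtain ⟨k1, i1, h1⟩ := ray z hz (0, -1) (by simp)
    obtain ⟨k2, i2, h2⟩ := ray z hz (0, 1) (by simp)
    obtain ⟨k3, i3, h3⟩ := ray z hz (-1, 0) (by simp)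
    obtain ⟨k4, i4, h4⟩ := ray z hz (1, 0) (by simp)
    have b1 := hB _ _ h1
    have b2 := hB _ _ h2
    have b3 := hB _ _ h3
    have b4 := hB _ _ h4
    simp only [mul_zero, mul_one, mul_neg, add_zero] at b1 b2 b3 b4 h1 h2 h3 h4
    refine ⟨by omega, ?_, ?_, ?_, ?_⟩
    · refine ⟨k1, by omega, _, ?_, hxy _ _ h1⟩
      simp only [code]; omega
    · refine ⟨k2, by omega, _, ?_, hxy _ _ h2⟩
      simp only [code]; omega
    · refine ⟨k3, by omega, _, ?_, hxy _ _ h3⟩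
      simp only [code]; omega
    · refine ⟨k4, by omega, _, ?_, hxy _ _ h4⟩
      simp only [code]; omega
  refine ⟨Z.image code, ?_, ?_⟩
  · rw [Finset.card_image_of_injOn]
    · exact hZ
    · intro z hz w hw e
      have := (four z hz).1
      have := (four w hw).1
      exact code_inj (by omega) (by omega) e
  · intro k hk
    obtain ⟨z, hz, rfl⟩ := Finset.mem_image.1 hk
    have := (four z hz).1
    refine ⟨?_, (four z hz).2⟩
    unfold code
    omega

theorem near_rng {C : Fin 5} {i : Fin 5} {Q : Set Cell} (hQ : IsPlacement (tets i) Q)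
    (h : PieceAdj (pset (canon C) 4 4) Q) : ∀ c ∈ Q, 0 ≤ c.1 ∧ c.1 ≤ 11 ∧ 0 ≤ c.2 ∧ c.2 ≤ 11 := by
  obtain ⟨o, ho, a, b, rfl⟩ := placement_orient hQ
  have hol := (orients_check i o ho).1
  have hn := adj_near (canon_le C) hol h
  rintro c ⟨p, hp, rfl⟩
  have := hol p hp
  simp only
  omega

theorem shifts_mem (x y : ℕ) (hx : x ≤ 8) (hy : y ≤ 8) : x + 24 * y ∈ shifts := by
  simp only [shifts, List.mem_flatMap, List.mem_map, List.mem_range]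
  exact ⟨y, by omega, x, by omega, rfl⟩

theorem Conf.no_bow (C : Conf) {p : Fin 5 → Fin 5} (hp : p ∈ bowL)
    (h0 : ∀ k, k ≠ 0 → PieceAdj (C.piece (p 0)) (C.piece (p k)))
    (h12 : PieceAdj (C.piece (p 1)) (C.piece (p 2))) (h34 : PieceAdj (C.piece (p 3)) (C.piece (p 4)))
    (hsurj : ∀ i, ∃ k, p k = i) : False := by
  obtain ⟨n1, n2, n3, n4, n12, -, -, -, -, n34⟩ := inj_check p (List.mem_append_left _ hp)
  obtain ⟨D, hD, hDa⟩ := C.norm (p 0) 4 4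
  have hb := List.all_eq_true.1 bow_check p hp
  have hc : Rep (Nat.shiftLeft (base (canon (p 0))) 100) (pset (canon (p 0)) ((4 : ℕ) : ℤ) ((4 : ℕ) : ℤ)) :=
    rep_pset (a := 4) (b := 4) (canon_le _) (by norm_num) (by norm_num)
  have hs : ∀ x y : ℕ, 4 ≤ x + 4 → x ≤ 4 + 4 → 4 ≤ y + 4 → y ≤ 4 + 4 → x + 24 * y ∈ shifts :=
    fun x y _ hx _ hy => shifts_mem x y hx hy
  unfold bow at hb
  simp only [force_eq] at hb
  have nr := fun i k h => near_rep (i := i) (k := k) (canon_le (p 0)) hc (by norm_num) (by norm_num) (by norm_num)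
    (by norm_num) hs h
  obtain ⟨a1, hb, ha1⟩ := nr _ _ hb
  obtain ⟨a2, hb, ha2⟩ := nr _ _ hb
  obtain ⟨b1, hb, hb1⟩ := nr _ _ hb
  obtain ⟨b2, hb, hb2⟩ := nr _ _ hb
  obtain ⟨wa, hb, -, hwa⟩ := wing_spec _ _ _ _ _ hb
  obtain ⟨wb, hb, -, hwb⟩ := wing_spec _ _ _ _ _ hb
  obtain ⟨ta, hb, hta⟩ := build_spec _ _ _ hb
  obtain ⟨tb, hb, htb⟩ := build_spec _ _ _ hb
  have key := fun x y hx hy => rc_spec (x := x) (y := y) _ _ _ hb hx hy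
  have a0 : ∀ k, k ≠ 0 → PieceAdj (pset (canon (p 0)) ((4 : ℕ) : ℤ) ((4 : ℕ) : ℤ)) (D.piece (p k)) := by
    intro k hk
    have := (hDa (p 0) (p k)).2 (h0 k hk)
    rwa [hD] at this
  have d0 : ∀ k, p 0 ≠ p k → Disjoint (D.piece (p k)) (pset (canon (p 0)) ((4 : ℕ) : ℤ) ((4 : ℕ) : ℤ)) := by
    intro k hk
    have : Disjoint (D.piece (p k)) (D.piece (p 0)) := D.disj hk.symm
    rwa [hD] at this
  obtain ⟨m1, hm1, r1⟩ := ha1 _ (D.placement (p 1)) (d0 1 n1) (a0 1 (by decide))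
  obtain ⟨m2, hm2, r2⟩ := ha2 _ (D.placement (p 2)) (d0 2 n2) (a0 2 (by decide))
  obtain ⟨m3, hm3, r3⟩ := hb1 _ (D.placement (p 3)) (d0 3 n3) (a0 3 (by decide))
  obtain ⟨m4, hm4, r4⟩ := hb2 _ (D.placement (p 4)) (d0 4 n4) (a0 4 (by decide))
  have w1 := hwa m2 hm2 m1 hm1 ((r2.disj r1).2 (D.disj n12.symm))
    ((r2.adj r1).1 (pieceAdj_symm ((hDa _ _).2 h12)))
  have w2 := hwb m4 hm4 m3 hm3 ((r4.disj r3).2 (D.disj n34.symm))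
    ((r4.adj r3).1 (pieceAdj_symm ((hDa _ _).2 h34)))
  have R1 := hc.union (r2.union r1)
  have R2 := hc.union (r4.union r3)
  have every : ∀ i, i = p 0 ∨ i = p 1 ∨ i = p 2 ∨ i = p 3 ∨ i = p 4 := by
    intro i
    obtain ⟨k, rfl⟩ := hsurj i
    fin_cases k <;> simp
  obtain ⟨S, hS, hS2⟩ := D.hull (x := Nat.shiftLeft (base (canon (p 0))) 100 ||| (m2 ||| m1))
    (y := Nat.shiftLeft (base (canon (p 0))) 100 ||| (m4 ||| m3)) (by
      intro i c hci
      have cc : ∀ k, k ≠ 0 → c ∈ D.piece (p k) → 0 ≤ c.1 ∧ c.1 ≤ 11 ∧ 0 ≤ c.2 ∧ c.2 ≤ 11 :=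
        fun k hk h => near_rng (D.placement (p k)) (a0 k hk) c h
      rcases every i with rfl | rfl | rfl | rfl | rfl
      · rw [hD] at hci
        obtain ⟨q, hq, rfl⟩ := hci
        have := canon_le _ q hq
        simp only
        omega
      · exact cc 1 (by decide) hci
      · exact cc 2 (by decide) hci
      · exact cc 3 (by decide) hci
      · exact cc 4 (by decide) hci) (by
      intro i c hci
      rcases every i with rfl | rfl | rfl | rfl | rfl
      · rw [hD] at hci
        exact Or.inl (R1.mem (Or.inl hci))
      · exact Or.inl (R1.mem (Or.inr (Or.inr hci)))
      · exact Or.inl (R1.mem (Or.inr (Or.inl hci)))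
      · exact Or.inr (R2.mem (Or.inr (Or.inr hci)))
      · exact Or.inr (R2.mem (Or.inr (Or.inl hci))))
  have := key _ _ (hta _ w1) (htb _ w2) S hS2
  omega

end TF
namespace TF
/-! ### The case of a complete bipartite graph -/

/-- Codes of the translations in `[4, 12]²`. -/
def shifts2 : List ℕ := (List.range 9).flatMap fun y => (List.range 9).map fun x => (x + 4) + 24 * (y + 4)

/-- Codes of the translations in `[0, 16]²`. -/
def shifts3 : List ℕ := (List.range 17).flatMap fun y => (List.range 17).map fun x => x + 24 * y

/-- The masks that are disjoint from `v` and meet `vn`. -/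
noncomputable def touch (v vn : ℕ) (l : List ℕ) : List ℕ → (List ℕ → Bool) → Bool :=
  List.rec (fun acc k => k acc) (fun q _ ih acc k =>
      cond (Nat.beq (Nat.land q v) 0)
        (cond (Nat.beq (Nat.land q vn) 0) (ih acc k) (ih (q :: acc) k))
        (ih acc k)) l

/-- Nothing to check for the empty list. -/
noncomputable def nilOr (l : List ℕ) (b : Bool) : Bool := List.rec true (fun _ _ _ => b) l

/-- All masks avoiding `a` satisfy `k`. -/
noncomputable def every (a : ℕ) (k : ℕ → Bool) (l : List ℕ) : Bool :=
  List.rec true (fun q _ ih => cond (Nat.beq (Nat.land q a) 0) (cond (k q) ih false) ih) l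

/-- All translates of `b` avoiding `c` satisfy `k`. -/
noncomputable def trans (c b : ℕ) (k : ℕ → Bool) (l : List ℕ) : Bool :=
  List.rec true (fun s _ ih => force (Nat.shiftLeft b s) fun v =>
    cond (Nat.beq (Nat.land v c) 0) (cond (k v) ih false) ih) l

noncomputable def oris (c : ℕ) (k : ℕ → Bool) (l : List (List (ℕ × ℕ))) : Bool :=
  List.rec true (fun o _ ih => force (base o) fun b => cond (trans c b k shifts3) ih false) l

noncomputable def triple (xs ys zs : List ℕ) : Bool :=
  every 0 (fun x => force (Nat.lor x (nb x)) fun xn =>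
    every xn (fun y => force (Nat.lor xn (Nat.lor y (nb y))) fun yn => every yn (fun _ => false) zs) ys) xs

noncomputable def kcheck (U V X Y Z : Fin 5) : Bool :=
  force (Nat.shiftLeft (base (canon U)) 200) fun c => force (nb c) fun cn =>
  near c cn shifts2 (orients X) [] fun xs => near c cn shifts2 (orients Y) [] fun ys =>
  near c cn shifts2 (orients Z) [] fun zs =>
  oris c (fun v => force (nb v) fun vn =>
    touch v vn xs [] fun xs => nilOr xs (touch v vn ys [] fun ys => nilOr ys (touch v vn zs [] fun zs =>
      triple xs ys zs))) (orients V)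

theorem k_check : (k23L.all fun p => kcheck (p 0) (p 1) (p 2) (p 3) (p 4)) = true := by
  decide +kernel

theorem touch_spec (v vn : ℕ) (l : List ℕ) : ∀ (acc : List ℕ) (k : List ℕ → Bool),
    touch v vn l acc k = true → ∃ acc', k acc' = true ∧ (∀ m ∈ acc, m ∈ acc') ∧
      ∀ q ∈ l, q &&& v = 0 → q &&& vn ≠ 0 → q ∈ acc' := by
  induction l with
  | nil => exact fun acc k h => ⟨acc, h, fun m hm => hm, by simp⟩
  | cons s l ih =>
    intro acc k h
    have e : touch v vn (s :: l) acc k = cond (Nat.beq (Nat.land s v) 0)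
        (cond (Nat.beq (Nat.land s vn) 0) (touch v vn l acc k) (touch v vn l (s :: acc) k))
        (touch v vn l acc k) := rfl
    rw [e] at h
    simp only [beq_zero, land_def, Bool.cond_decide] at h
    split_ifs at h with h1 h2
    · obtain ⟨acc', h3, h4, h5⟩ := ih _ _ h
      refine ⟨acc', h3, h4, ?_⟩
      intro t ht ht1 ht2
      rcases List.mem_cons.1 ht with rfl | ht
      · exact absurd h2 ht2
      · exact h5 t ht ht1 ht2
    · obtain ⟨acc', h3, h4, h5⟩ := ih _ _ h
      refine ⟨acc', h3, fun m hm => h4 m (List.mem_cons_of_mem _ hm), ?_⟩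
      intro t ht ht1 ht2
      rcases List.mem_cons.1 ht with rfl | ht
      · exact h4 _ List.mem_cons_self
      · exact h5 t ht ht1 ht2
    · obtain ⟨acc', h3, h4, h5⟩ := ih _ _ h
      refine ⟨acc', h3, h4, ?_⟩
      intro t ht ht1 ht2
      rcases List.mem_cons.1 ht with rfl | ht
      · exact absurd ht1 h1
      · exact h5 t ht ht1 ht2

theorem nilOr_spec {l : List ℕ} {b : Bool} (h : nilOr l b = true) {m : ℕ} (hm : m ∈ l) : b = true := by
  cases l with
  | nil => simp at hm
  | cons x l => exact h

theorem every_spec {a : ℕ} {k : ℕ → Bool} {l : List ℕ} (h : every a k l = true) {q : ℕ} (hq : q ∈ l)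
    (ha : q &&& a = 0) : k q = true := by
  induction l with
  | nil => simp at hq
  | cons x l ih =>
    have e : every a k (x :: l) = cond (Nat.beq (Nat.land x a) 0) (cond (k x) (every a k l) false)
      (every a k l) := rfl
    rw [e] at h
    simp only [beq_zero, land_def, Bool.cond_decide] at h
    rcases List.mem_cons.1 hq with rfl | hq
    · rw [if_pos ha] at h
      cases hk : k q
      · rw [hk] at h; exact h
      · rfl
    · refine ih ?_ hq
      split_ifs at h with h1
      · cases hk : k x
        · rw [hk] at h; exact absurd h (by simp)
        · rw [hk] at h; exact h
      · exact h

theorem trans_spec {c b : ℕ} {k : ℕ → Bool} {l : List ℕ} (h : trans c b k l = true) {s : ℕ} (hs : s ∈ l)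
    (hc : (b <<< s) &&& c = 0) : k (b <<< s) = true := by
  induction l with
  | nil => simp at hs
  | cons x l ih =>
    have e : trans c b k (x :: l) = force (Nat.shiftLeft b x) (fun v =>
      cond (Nat.beq (Nat.land v c) 0) (cond (k v) (trans c b k l) false) (trans c b k l)) := rfl
    rw [e, force_eq] at h
    simp only [beq_zero, land_def, shl_def, Bool.cond_decide] at h
    rcases List.mem_cons.1 hs with rfl | hs
    · rw [if_pos hc] at h
      cases hk : k (b <<< s)
      · rw [hk] at h; exact h
      · rfl
    · refine ih ?_ hs
      split_ifs at h with h1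
      · cases hk : k (b <<< x)
        · rw [hk] at h; exact absurd h (by simp)
        · rw [hk] at h; exact h
      · exact h

theorem oris_spec {c : ℕ} {k : ℕ → Bool} {l : List (List (ℕ × ℕ))} (h : oris c k l = true)
    {o : List (ℕ × ℕ)} (ho : o ∈ l) : trans c (base o) k shifts3 = true := by
  induction l with
  | nil => simp at ho
  | cons x l ih =>
    have e : oris c k (x :: l) = force (base x) (fun b => cond (trans c b k shifts3) (oris c k l) false) := rfl
    rw [e, force_eq] at h
    cases hk : trans c (base x) k shifts3
    · rw [hk] at h; exact absurd h (by simp)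
    · rw [hk] at h
      rcases List.mem_cons.1 ho with rfl | ho
      · exact hk
      · exact ih h ho

theorem far {m m' : ℕ} {Q Q' : Set Cell} (h : Rep m Q) (h' : Rep m' Q') (hd : Disjoint Q Q')
    (ha : ¬ PieceAdj Q Q') : m' &&& (m ||| nb m) = 0 := by
  have h1 := (h.disj h').2 hd
  have h2 : nb m &&& m' = 0 := by
    by_contra h2
    exact ha ((h.adj h').2 h2)
  rw [Nat.and_or_distrib_left, Nat.land_comm, h1, Nat.land_comm, h2]
  rfl

theorem triple_spec {xs ys zs : List ℕ} (h : triple xs ys zs = true) {x y z : ℕ} (hx : x ∈ xs) (hy : y ∈ ys)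
    (hz : z ∈ zs) (hxy : y &&& (x ||| nb x) = 0) (hxz : z &&& (x ||| nb x) = 0)
    (hyz : z &&& (y ||| nb y) = 0) : False := by
  have h1 := every_spec h hx (by simp)
  rw [force_eq] at h1
  have h2 := every_spec h1 hy hxy
  rw [force_eq] at h2
  have h3 := every_spec h2 hz (by
    show z &&& ((x ||| nb x) ||| (y ||| nb y)) = 0
    rw [Nat.and_or_distrib_left, hxz, hyz]; rfl)
  exact Bool.noConfusion h3

theorem Conf.no_k23 (C : Conf) {p : Fin 5 → Fin 5} (hp : p ∈ k23L)
    (h : ∀ k, 2 ≤ k → PieceAdj (C.piece (p 0)) (C.piece (p k)) ∧ PieceAdj (C.piece (p 1)) (C.piece (p k)))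
    (h23 : ¬ PieceAdj (C.piece (p 2)) (C.piece (p 3))) (h24 : ¬ PieceAdj (C.piece (p 2)) (C.piece (p 4)))
    (h34 : ¬ PieceAdj (C.piece (p 3)) (C.piece (p 4))) : False := by
  obtain ⟨n1, n2, n3, n4, n12, n13, n14, n23, n24, n34⟩ := inj_check p (List.mem_append_right _ hp)
  obtain ⟨D, hD, hDa⟩ := C.norm (p 0) ((8 : ℕ) : ℤ) ((8 : ℕ) : ℤ)
  have hb := List.all_eq_true.1 k_check p hp
  have hc : Rep (Nat.shiftLeft (base (canon (p 0))) 200) (pset (canon (p 0)) ((8 : ℕ) : ℤ) ((8 : ℕ) : ℤ)) :=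
    rep_pset (a := 8) (b := 8) (canon_le _) (by norm_num) (by norm_num)
  have hs : ∀ x y : ℕ, 8 ≤ x + 4 → x ≤ 8 + 4 → 8 ≤ y + 4 → y ≤ 8 + 4 → x + 24 * y ∈ shifts2 := by
    intro x y h1 h2 h3 h4
    simp only [shifts2, List.mem_flatMap, List.mem_map, List.mem_range]
    exact ⟨y - 4, by omega, x - 4, by omega, by omega⟩
  unfold kcheck at hb
  simp only [force_eq] at hb
  have nr := fun i k h => near_rep (i := i) (k := k) (canon_le (p 0)) hc (by norm_num) (by norm_num) (by norm_num)
    (by norm_num) hs h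
  obtain ⟨xs, hb, hxs⟩ := nr _ _ hb
  obtain ⟨ys, hb, hys⟩ := nr _ _ hb
  obtain ⟨zs, hb, hzs⟩ := nr _ _ hb
  have a0 : ∀ k, 2 ≤ k → PieceAdj (pset (canon (p 0)) ((8 : ℕ) : ℤ) ((8 : ℕ) : ℤ)) (D.piece (p k)) := by
    intro k hk
    have := (hDa (p 0) (p k)).2 (h k hk).1
    rwa [hD] at this
  have a1 : ∀ k, 2 ≤ k → PieceAdj (D.piece (p 1)) (D.piece (p k)) :=
    fun k hk => (hDa _ _).2 (h k hk).2
  have d0 : ∀ k, p 0 ≠ p k → Disjoint (D.piece (p k)) (pset (canon (p 0)) ((8 : ℕ) : ℤ) ((8 : ℕ) : ℤ)) := by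
    intro k hk
    have : Disjoint (D.piece (p k)) (D.piece (p 0)) := D.disj hk.symm
    rwa [hD] at this
  obtain ⟨m2, hm2, r2⟩ := hxs _ (D.placement (p 2)) (d0 2 n2) (a0 2 (by decide))
  obtain ⟨m3, hm3, r3⟩ := hys _ (D.placement (p 3)) (d0 3 n3) (a0 3 (by decide))
  obtain ⟨m4, hm4, r4⟩ := hzs _ (D.placement (p 4)) (d0 4 n4) (a0 4 (by decide))
  -- the second hub
  obtain ⟨o, ho, a, b, hV⟩ := placement_orient (D.placement (p 1))
  obtain ⟨o', ho', a', b', hX⟩ := placement_orient (D.placement (p 2))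
  have hol := (orients_check _ o ho).1
  have hol' := (orients_check _ o' ho').1
  have q1 := a0 2 (by decide)
  have q2 := a1 2 (by decide)
  rw [hX] at q1 q2
  rw [hV] at q2
  have q3 := adj_near (canon_le _) hol' q1
  have q4 := adj_near hol hol' q2
  lift a to ℕ using by omega
  lift b to ℕ using by omega
  have rv : Rep (base o <<< (a + 24 * b)) (D.piece (p 1)) := by
    rw [hV]
    exact rep_pset hol (by omega) (by omega)
  have hb := trans_spec (oris_spec hb ho) (s := a + 24 * b) (by
    simp only [shifts3, List.mem_flatMap, List.mem_map, List.mem_range]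
    exact ⟨b, by omega, a, by omega, rfl⟩) ((rv.disj hc).2 (d0 1 n1))
  have tt : ∀ {k m}, 2 ≤ k → p 1 ≠ p k → Rep m (D.piece (p k)) →
      m &&& (base o <<< (a + 24 * b)) = 0 ∧ m &&& nb (base o <<< (a + 24 * b)) ≠ 0 := by
    intro k m hk hne r
    refine ⟨(r.disj rv).2 (D.disj hne.symm), ?_⟩
    rw [Nat.land_comm]
    exact (rv.adj r).1 (a1 k hk)
  obtain ⟨xs', hb, -, hx'⟩ := touch_spec _ _ _ _ _ hb
  have hx := hx' m2 hm2 (tt (by decide) n12 r2).1 (tt (by decide) n12 r2).2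
  have hb := nilOr_spec hb hx
  obtain ⟨ys', hb, -, hy'⟩ := touch_spec _ _ _ _ _ hb
  have hy := hy' m3 hm3 (tt (by decide) n13 r3).1 (tt (by decide) n13 r3).2
  have hb := nilOr_spec hb hy
  obtain ⟨zs', hb, -, hz'⟩ := touch_spec _ _ _ _ _ hb
  have hz := hz' m4 hm4 (tt (by decide) n14 r4).1 (tt (by decide) n14 r4).2
  exact triple_spec hb hx hy hz (far r2 r3 (D.disj n23) fun e => h23 ((hDa _ _).1 e))
    (far r2 r4 (D.disj n24) fun e => h24 ((hDa _ _).1 e))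
    (far r3 r4 (D.disj n34) fun e => h34 ((hDa _ _).1 e))

/-- The lists for the bow tie case contain all pieces. -/
theorem bow_surjB : (bowL.all fun p =>
    ((List.finRange 5).all fun i => (List.finRange 5).any fun k => Nat.beq (p k).val i.val)) = true := by
  decide +kernel

theorem bow_surj : ∀ p ∈ bowL, ∀ i, ∃ k, p k = i := by
  intro p hp i
  have h := List.all_eq_true.1 bow_surjB p hp
  rw [List.all_eq_true] at h
  obtain ⟨k, -, hk⟩ := List.any_eq_true.1 (h i (List.mem_finRange i))
  exact ⟨k, Fin.ext (Nat.eq_of_beq_eq_true hk)⟩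

end TF
namespace TF
/-! ### The Hamiltonian case: covering the boundary of the trapped cells -/

/-- An oriented piece: a bit for its type, a bound for the number of boundary cells it covers, its mask
and the codes of its cells. -/
structure Ent where
  tag : ℕ
  cap : ℕ
  b : ℕ
  cs : List ℕ

def capE : Fin 5 → ℕ := ![4, 3, 3, 2, 3]

/-- The 19 oriented pieces; the tag of the piece `i` is the bit of the cell `(2 * i, 20)`. -/
def tab : List Ent :=
  [⟨1 <<< 480, 4, 4722366764344638701569, [0, 24, 48, 72]⟩,
   ⟨1 <<< 480, 4, 15, [0, 1, 2, 3]⟩,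
   ⟨1 <<< 482, 3, 281474993487875, [0, 1, 24, 48]⟩,
   ⟨1 <<< 482, 3, 562949986975747, [0, 1, 25, 49]⟩,
   ⟨1 <<< 482, 3, 844424946909185, [48, 49, 24, 0]⟩,
   ⟨1 <<< 482, 3, 844424963686402, [48, 49, 25, 1]⟩,
   ⟨1 <<< 482, 3, 16777223, [0, 24, 1, 2]⟩,
   ⟨1 <<< 482, 3, 117440513, [0, 24, 25, 26]⟩,
   ⟨1 <<< 482, 3, 67108871, [2, 26, 1, 0]⟩,
   ⟨1 <<< 482, 3, 117440516, [2, 26, 25, 24]⟩,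
   ⟨1 <<< 484, 3, 100663299, [0, 1, 25, 26]⟩,
   ⟨1 <<< 484, 3, 50331654, [24, 25, 1, 2]⟩,
   ⟨1 <<< 484, 3, 562950003752961, [0, 24, 25, 49]⟩,
   ⟨1 <<< 484, 3, 281475027042306, [1, 25, 24, 48]⟩,
   ⟨1 <<< 486, 2, 50331651, [0, 1, 24, 25]⟩,
   ⟨1 <<< 488, 3, 33554439, [0, 1, 2, 25]⟩,
   ⟨1 <<< 488, 3, 117440514, [24, 25, 26, 1]⟩,
   ⟨1 <<< 488, 3, 281475027042305, [0, 24, 48, 25]⟩,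
   ⟨1 <<< 488, 3, 562950003752962, [1, 25, 49, 24]⟩]

/-- Number of the positions in `l` that are bits of `D`. -/
noncomputable def cnt (D : ℕ) (l : List ℕ) : ℕ :=
  List.rec 0 (fun c _ ih => Nat.add (Nat.land (Nat.shiftRight D c) 1) ih) l

/-- Four lists of masks, by waste. -/
abbrev Lev := List ℕ → List ℕ → List ℕ → List ℕ → Bool

/-- Collect the translates of a piece that cover `p` and avoid `forb`. -/
noncomputable def gath1 (e : Ent) (p forb D : ℕ) (l : List ℕ) : List ℕ → List ℕ → List ℕ → List ℕ → Lev → Bool :=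
  List.rec (fun a0 a1 a2 a3 k => k a0 a1 a2 a3) (fun c _ ih a0 a1 a2 a3 k =>
    force (Nat.sub p c) fun off => force (Nat.shiftLeft e.b off) fun m =>
    cond (Nat.beq (Nat.land m forb) 0)
      (force (Nat.shiftRight D off) fun Ds => force (cnt Ds e.cs) fun n =>
       force (Nat.lor m e.tag) fun tm =>
       cond (Nat.beq (Nat.add n 0) e.cap) (ih (tm :: a0) a1 a2 a3 k)
       (cond (Nat.beq (Nat.add n 1) e.cap) (ih a0 (tm :: a1) a2 a3 k)
       (cond (Nat.beq (Nat.add n 2) e.cap) (ih a0 a1 (tm :: a2) a3 k)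
       (cond (Nat.beq (Nat.add n 3) e.cap) (ih a0 a1 a2 (tm :: a3) k) false))))
      (ih a0 a1 a2 a3 k)) l

noncomputable def gath (p forb D : ℕ) (l : List Ent) : List ℕ → List ℕ → List ℕ → List ℕ → Lev → Bool :=
  List.rec (fun a0 a1 a2 a3 k => k a0 a1 a2 a3) (fun e _ ih a0 a1 a2 a3 k =>
    gath1 e p forb D e.cs a0 a1 a2 a3 fun a0 a1 a2 a3 => ih a0 a1 a2 a3 k) l

/-- The boundary cells with their lists of pieces. -/
noncomputable def cells (E D : ℕ) (l : List ℕ) :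
    ℕ → List (ℕ × List (List ℕ)) → (List (ℕ × List (List ℕ)) → Bool) → Bool :=
  List.rec (fun forb acc k => cond (Nat.beq forb E) (k acc) false) (fun p _ ih forb acc k =>
    force (Nat.shiftLeft 1 p) fun bp =>
    cond (Nat.beq (Nat.land D bp) 0) (ih forb acc k)
      (force (Nat.xor forb bp) fun forb' => gath p forb' D tab [] [] [] [] fun a0 a1 a2 a3 =>
        ih forb' ((bp, [a0, a1, a2, a3]) :: acc) k)) l

/-- Number of masks in the list not meeting `mn`. -/
noncomputable def nonadj (mn : ℕ) (l : List ℕ) : ℕ :=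
  List.rec 0 (fun q _ ih => cond (Nat.beq (Nat.land mn q) 0) (Nat.add ih 1) ih) l

/-- Some piece is not adjacent to at least three others. -/
noncomputable def leaf (pl l : List ℕ) : Bool :=
  List.rec false (fun m _ ih => force (nb m) fun mn => cond (Nat.ble 3 (nonadj mn pl)) true ih) l

/-- Try all pieces within the slack `s`. -/
noncomputable def lev (U : ℕ) (k : ℕ → ℕ → Bool) (ls : List (List ℕ)) : ℕ → Bool :=
  List.rec (fun _ => true) (fun l _ ih s =>
    cond (every U (k s) l) (Nat.rec true (fun s' _ => ih s') s) false) ls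

noncomputable def dfs (l : List (ℕ × List (List ℕ))) : ℕ → ℕ → List ℕ → Bool :=
  List.rec (fun _ _ pl => leaf pl pl) (fun c _ ih U s pl =>
    cond (Nat.beq (Nat.land U c.1) 0)
      (lev U (fun s m => force (Nat.lor U m) fun U' => ih U' s (m :: pl)) c.2 s)
      (ih U s pl)) l

/-- Codes of the cells around the trapped cells. -/
def frame : List ℕ :=
  [75, 76, 77, 78, 79, 80, 81, 99, 100, 101, 102, 103, 104, 105, 123, 124, 125, 126, 127, 128, 129,
   147, 148, 149, 150, 151, 152, 153, 171, 172, 173, 174, 175, 176, 177]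

noncomputable def chk (E : ℕ) : Bool :=
  force (Nat.xor (Nat.lor (nb E) E) E) fun D => force (cnt D frame) fun d =>
  force (Nat.lor E D) fun forb => force (Nat.sub 15 d) fun s =>
    cells E D frame forb [] fun l => cond (Nat.ble d 15) (dfs l 0 s []) true

/-- All sets obtained from `l` by leaving out at most `b` elements. -/
noncomputable def sets (l : List ℕ) : ℕ → ℕ → Bool :=
  List.rec (fun _ acc => chk acc) (fun c _ ih b acc =>
    cond (force (Nat.lor acc (Nat.shiftLeft 1 c)) fun a => ih b a)
      (Nat.rec true (fun b' _ => ih b' acc) b) false) l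

def box1 : List ℕ := [100, 101, 102, 103, 124, 125, 126, 127, 148, 149, 150, 151]
def box2 : List ℕ := [100, 101, 102, 103, 104, 124, 125, 126, 127, 128]

theorem sets_check1 : sets box1 2 0 = true := by
  decide +kernel

theorem sets_check2 : sets box2 0 0 = true := by
  decide +kernel


end TF
namespace TF
/-! ### Soundness of the covering search -/

theorem bit_land (D c : ℕ) : Nat.land (Nat.shiftRight D c) 1 = if D.testBit c then 1 else 0 := by
  rw [land_def, shr_def, Nat.testBit_eq_decide_div_mod_eq, Nat.and_one_is_mod, Nat.shiftRight_eq_div_pow]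
  rcases Nat.mod_two_eq_zero_or_one (D / 2 ^ c) with h | h <;> simp [h]

theorem cnt_eq (D : ℕ) (l : List ℕ) : cnt D l = l.countP fun c => D.testBit c := by
  induction l with
  | nil => rfl
  | cons c l ih =>
    have e : cnt D (c :: l) = Nat.land (Nat.shiftRight D c) 1 + cnt D l := rfl
    rw [e, ih, bit_land, List.countP_cons, add_comm]

theorem one_bit (m p : ℕ) : m &&& 1 <<< p = 0 ↔ m.testBit p = false := by
  rw [land_eq_zero]
  have t1 : ∀ k, (1 <<< p).testBit k = true ↔ k = p := by
    intro k
    rw [Nat.one_shiftLeft, Nat.testBit_two_pow, decide_eq_true_eq]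
    exact eq_comm
  constructor
  · intro h
    have := h p
    rw [t1] at this
    simpa using this
  · rintro h k ⟨h1, h2⟩
    rw [(t1 k).1 h2, h] at h1
    exact Bool.noConfusion h1

theorem one_bit' (m p : ℕ) : m &&& 1 <<< p ≠ 0 ↔ m.testBit p = true := by
  rw [ne_eq, one_bit, Bool.not_eq_false]

/-- The lists contain the mask `tm` at level `w`. -/
def At (ls : List (List ℕ)) (w tm : ℕ) : Prop := ∃ l, ls[w]? = some l ∧ tm ∈ l

theorem At.mono {a0 a1 a2 a3 b0 b1 b2 b3 : List ℕ} (h0 : a0 ⊆ b0) (h1 : a1 ⊆ b1) (h2 : a2 ⊆ b2) (h3 : a3 ⊆ b3)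
    {w tm : ℕ} (h : At [a0, a1, a2, a3] w tm) : At [b0, b1, b2, b3] w tm := by
  obtain ⟨l, hl, hm⟩ := h
  match w, hl with
  | 0, hl => simp at hl; subst hl; exact ⟨_, rfl, h0 hm⟩
  | 1, hl => simp at hl; subst hl; exact ⟨_, rfl, h1 hm⟩
  | 2, hl => simp at hl; subst hl; exact ⟨_, rfl, h2 hm⟩
  | 3, hl => simp at hl; subst hl; exact ⟨_, rfl, h3 hm⟩
  | w + 4, hl => simp at hl

theorem gath1_spec (e : Ent) (p forb D : ℕ) (l : List ℕ) : ∀ (a0 a1 a2 a3 : List ℕ) (k : Lev),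
    gath1 e p forb D l a0 a1 a2 a3 k = true → ∃ b0 b1 b2 b3, k b0 b1 b2 b3 = true ∧
      a0 ⊆ b0 ∧ a1 ⊆ b1 ∧ a2 ⊆ b2 ∧ a3 ⊆ b3 ∧
      ∀ c ∈ l, (e.b <<< (p - c)) &&& forb = 0 → ∃ w, cnt (D >>> (p - c)) e.cs + w = e.cap ∧
        At [b0, b1, b2, b3] w (e.b <<< (p - c) ||| e.tag) := by
  induction l with
  | nil => exact fun a0 a1 a2 a3 k h => ⟨a0, a1, a2, a3, h, fun _ h => h, fun _ h => h, fun _ h => h, fun _ h => h, by simp⟩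
  | cons c l ih =>
    intro a0 a1 a2 a3 k h
    have eq : gath1 e p forb D (c :: l) a0 a1 a2 a3 k =
      force (Nat.sub p c) (fun off => force (Nat.shiftLeft e.b off) fun m =>
        cond (Nat.beq (Nat.land m forb) 0)
          (force (Nat.shiftRight D off) fun Ds => force (cnt Ds e.cs) fun n =>
          force (Nat.lor m e.tag) fun tm =>
          cond (Nat.beq (Nat.add n 0) e.cap) (gath1 e p forb D l (tm :: a0) a1 a2 a3 k)
          (cond (Nat.beq (Nat.add n 1) e.cap) (gath1 e p forb D l a0 (tm :: a1) a2 a3 k)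
          (cond (Nat.beq (Nat.add n 2) e.cap) (gath1 e p forb D l a0 a1 (tm :: a2) a3 k)
          (cond (Nat.beq (Nat.add n 3) e.cap) (gath1 e p forb D l a0 a1 a2 (tm :: a3) k) false))))
          (gath1 e p forb D l a0 a1 a2 a3 k)) := rfl
    have bq : ∀ a b, Nat.beq a b = decide (a = b) := fun a b => by
      rw [Bool.eq_iff_iff, Nat.beq_eq, decide_eq_true_eq]
    rw [eq] at h
    simp only [force_eq, beq_zero] at h
    simp only [bq, Bool.cond_decide] at h
    have done : ∀ a0' a1' a2' a3', a0 ⊆ a0' → a1 ⊆ a1' → a2 ⊆ a2' → a3 ⊆ a3' →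
        gath1 e p forb D l a0' a1' a2' a3' k = true →
        ((e.b <<< (p - c)) &&& forb = 0 → ∃ w, cnt (D >>> (p - c)) e.cs + w = e.cap ∧
          At [a0', a1', a2', a3'] w (e.b <<< (p - c) ||| e.tag)) →
        ∃ b0 b1 b2 b3, k b0 b1 b2 b3 = true ∧
        a0 ⊆ b0 ∧ a1 ⊆ b1 ∧ a2 ⊆ b2 ∧ a3 ⊆ b3 ∧
        ∀ c' ∈ c :: l, (e.b <<< (p - c')) &&& forb = 0 → ∃ w, cnt (D >>> (p - c')) e.cs + w = e.cap ∧
          At [b0, b1, b2, b3] w (e.b <<< (p - c') ||| e.tag) := by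
      intro a0' a1' a2' a3' s0 s1 s2 s3 hg hc
      obtain ⟨b0, b1, b2, b3, hk, t0, t1, t2, t3, hl⟩ := ih _ _ _ _ _ hg
      refine ⟨b0, b1, b2, b3, hk, fun _ h => t0 (s0 h), fun _ h => t1 (s1 h), fun _ h => t2 (s2 h),
        fun _ h => t3 (s3 h), ?_⟩
      intro c' hc' hf
      rcases List.mem_cons.1 hc' with rfl | hc'
      · obtain ⟨w, h1, h2⟩ := hc hf
        exact ⟨w, h1, h2.mono t0 t1 t2 t3⟩
      · exact hl c' hc' hf
    have sr : ∀ a : List ℕ, a ⊆ a := fun _ _ h => h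
    have sc : ∀ (m : ℕ) (a : List ℕ), a ⊆ m :: a := fun _ _ _ h => List.mem_cons_of_mem _ h
    split_ifs at h with h1 h2 h3 h4 h5
    · exact done _ _ _ _ (sc _ _) (sr _) (sr _) (sr _) h fun _ => ⟨0, h2, _, rfl, List.mem_cons_self⟩
    · exact done _ _ _ _ (sr _) (sc _ _) (sr _) (sr _) h fun _ => ⟨1, h3, _, rfl, List.mem_cons_self⟩
    · exact done _ _ _ _ (sr _) (sr _) (sc _ _) (sr _) h fun _ => ⟨2, h4, _, rfl, List.mem_cons_self⟩
    · exact done _ _ _ _ (sr _) (sr _) (sr _) (sc _ _) h fun _ => ⟨3, h5, _, rfl, List.mem_cons_self⟩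
    · exact done _ _ _ _ (sr _) (sr _) (sr _) (sr _) h fun hf => absurd hf h1

theorem gath_spec (p forb D : ℕ) (l : List Ent) : ∀ (a0 a1 a2 a3 : List ℕ) (k : Lev),
    gath p forb D l a0 a1 a2 a3 k = true → ∃ b0 b1 b2 b3, k b0 b1 b2 b3 = true ∧
      a0 ⊆ b0 ∧ a1 ⊆ b1 ∧ a2 ⊆ b2 ∧ a3 ⊆ b3 ∧
      ∀ e ∈ l, ∀ c ∈ e.cs, (e.b <<< (p - c)) &&& forb = 0 → ∃ w, cnt (D >>> (p - c)) e.cs + w = e.cap ∧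
        At [b0, b1, b2, b3] w (e.b <<< (p - c) ||| e.tag) := by
  induction l with
  | nil => exact fun a0 a1 a2 a3 k h => ⟨a0, a1, a2, a3, h, fun _ h => h, fun _ h => h, fun _ h => h, fun _ h => h, by simp⟩
  | cons e l ih =>
    intro a0 a1 a2 a3 k h
    obtain ⟨c0, c1, c2, c3, h1, s0, s1, s2, s3, hc⟩ := gath1_spec _ _ _ _ _ _ _ _ _ _ h
    obtain ⟨b0, b1, b2, b3, hk, t0, t1, t2, t3, hl⟩ := ih _ _ _ _ _ h1
    refine ⟨b0, b1, b2, b3, hk, fun _ h => t0 (s0 h), fun _ h => t1 (s1 h), fun _ h => t2 (s2 h),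
        fun _ h => t3 (s3 h), ?_⟩
    intro e' he' c' hc' hf
    rcases List.mem_cons.1 he' with rfl | he'
    · obtain ⟨w, h1, h2⟩ := hc c' hc' hf
      exact ⟨w, h1, h2.mono t0 t1 t2 t3⟩
    · exact hl e' he' c' hc' hf

/-- Data of five placed pieces: entry in the table and translation. -/
structure Five where
  e : Fin 5 → Ent
  off : Fin 5 → ℕ
  tm : Fin 5 → ℕ
  he : ∀ i, e i ∈ tab
  htm : ∀ i, tm i = (e i).b <<< off i ||| (e i).tag
  bits : ∀ i k, ((e i).b <<< off i).testBit k = true ↔ ∃ c ∈ (e i).cs, k = c + off i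

/-- The number of cells of `D` that are covered by the piece `i`. -/
noncomputable def Five.n (V : Five) (D : ℕ) (i : Fin 5) : ℕ := cnt (D >>> V.off i) (V.e i).cs

/-- The property of the list of cells that is needed for the search. -/
def Good (V : Five) (D : ℕ) : ℕ → List (ℕ × List (List ℕ)) → Prop
  | _, [] => True
  | F, c :: r => (∃ p, c.1 = 1 <<< p ∧ p < 480 ∧ (∃ i, (V.tm i).testBit p = true) ∧
      ∀ i, (V.tm i).testBit p = true → V.tm i &&& F = 0 →
        ∃ w, V.n D i + w = (V.e i).cap ∧ At c.2 w (V.tm i)) ∧ Good V D (F ||| c.1) r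

theorem sub_land {a b F : ℕ} (h : (a ||| b) &&& F = 0) : a &&& F = 0 := by
  rw [land_eq_zero] at h ⊢
  intro k hk
  exact h k ⟨by rw [Nat.testBit_or, hk.1]; rfl, hk.2⟩

theorem cells_spec (V : Five) (E D : ℕ) (l : List ℕ) (hl : ∀ p ∈ l, p < 480)
    (htag : ∀ i k, k < 480 → ((V.e i).tag).testBit k = false)
    (hcov : ∀ p ∈ l, D.testBit p = true → ∃ i, (V.tm i).testBit p = true) :
    ∀ (forb : ℕ) (acc : List (ℕ × List (List ℕ))) (k : List (ℕ × List (List ℕ)) → Bool),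
    cells E D l forb acc k = true → Good V D forb acc → (∀ p ∈ l, D.testBit p = true → forb.testBit p = true) →
    l.Nodup →
    ∃ acc', k acc' = true ∧ Good V D E acc' ∧
      ∀ i, (V.e i).b <<< V.off i &&& E = 0 → (V.e i).b <<< V.off i &&& forb ≠ 0 → V.n D i ≤ (V.e i).cap := by
  induction l with
  | nil =>
    intro forb acc k h hg _ _
    have eq : cells E D [] forb acc k = cond (Nat.beq forb E) (k acc) false := rfl
    rw [eq] at h
    cases hb : Nat.beq forb E
    · rw [hb] at h; exact absurd h (by simp)
    · rw [hb] at h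
      have := Nat.eq_of_beq_eq_true hb
      subst this
      exact ⟨acc, h, hg, fun i h1 h2 => absurd h1 h2⟩
  | cons p l ih =>
    intro forb acc k h hg hf hnd
    rw [List.nodup_cons] at hnd
    have ih' := ih (fun q hq => hl q (List.mem_cons_of_mem _ hq)) (fun q hq => hcov q (List.mem_cons_of_mem _ hq))
    have eq : cells E D (p :: l) forb acc k = force (Nat.shiftLeft 1 p) (fun bp =>
      cond (Nat.beq (Nat.land D bp) 0) (cells E D l forb acc k)
      (force (Nat.xor forb bp) fun forb' => gath p forb' D tab [] [] [] [] fun a0 a1 a2 a3 =>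
        cells E D l forb' ((bp, [a0, a1, a2, a3]) :: acc) k)) := rfl
    rw [eq] at h
    simp only [force_eq, beq_zero, Bool.cond_decide, land_def, shl_def] at h
    split_ifs at h with h1
    · exact ih' _ _ _ h hg (fun q hq => hf q (List.mem_cons_of_mem _ hq)) hnd.2
    · have hDp : D.testBit p = true := (one_bit' _ _).1 h1
      obtain ⟨b0, b1, b2, b3, hk, -, -, -, -, hG⟩ := gath_spec _ _ _ _ _ _ _ _ _ h
      change cells E D l (forb ^^^ 1 <<< p) _ k = true at hk
      have tb : ∀ q, (1 <<< p).testBit q = decide (p = q) := by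
        intro q
        rw [Nat.one_shiftLeft, Nat.testBit_two_pow]
      have fb : ∀ q, (forb ^^^ 1 <<< p).testBit q = (forb.testBit q && decide (p ≠ q)) := by
        intro q
        rw [Nat.testBit_xor, tb]
        by_cases hpq : p = q
        · subst hpq
          simp [hf p List.mem_cons_self hDp]
        · simp [hpq]
      have key : ∀ i, (V.tm i).testBit p = true → ((V.e i).b <<< V.off i) &&& (forb ^^^ 1 <<< p) = 0 →
          ∃ w, V.n D i + w = (V.e i).cap ∧ At [b0, b1, b2, b3] w (V.tm i) := by
        intro i hi hF
        rw [V.htm i, Nat.testBit_or, htag i p (hl p List.mem_cons_self), Bool.or_false] at hi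
        obtain ⟨c, hc, rfl⟩ := (V.bits i p).1 hi
        have := hG (V.e i) (V.he i) c hc
        rw [Nat.add_sub_cancel_left] at this
        rw [V.htm i]
        exact this hF
      have hor : (forb ^^^ 1 <<< p) ||| 1 <<< p = forb := by
        apply Nat.eq_of_testBit_eq
        intro q
        rw [Nat.testBit_or, fb, tb]
        by_cases hpq : p = q
        · subst hpq
          simp [hf p List.mem_cons_self hDp]
        · simp [hpq]
      obtain ⟨acc', h3, h4, h5⟩ := ih' _ _ _ hk ⟨⟨p, rfl, hl p List.mem_cons_self, hcov p List.mem_cons_self hDp, fun i hi hF =>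
        key i hi (sub_land (by rw [← V.htm i]; exact hF))⟩, by
          show Good V D ((forb ^^^ 1 <<< p) ||| 1 <<< p) acc
          rw [hor]; exact hg⟩ (by
            intro q hq hDq
            rw [fb, hf q (List.mem_cons_of_mem _ hq) hDq]
            have : p ≠ q := by rintro rfl; exact hnd.1 hq
            simp [this]) hnd.2
      refine ⟨acc', h3, h4, ?_⟩
      intro i hE hne
      by_cases h0 : (V.e i).b <<< V.off i &&& (forb ^^^ 1 <<< p) = 0
      · have hp : ((V.e i).b <<< V.off i).testBit p = true := by
          by_contra hp
          apply hne
          rw [← hor, Nat.and_or_distrib_left, h0, (one_bit _ _).2 (by simpa using hp)]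
          rfl
        obtain ⟨w, hw, -⟩ := key i (by rw [V.htm i, Nat.testBit_or, hp]; rfl) h0
        omega
      · exact h5 i hE h0

theorem lev_spec {U : ℕ} {k : ℕ → ℕ → Bool} {ls : List (List ℕ)} : ∀ {s w m : ℕ}, lev U k ls s = true →
    w ≤ s → At ls w m → m &&& U = 0 → k (s - w) m = true := by
  induction ls with
  | nil =>
    rintro s w m - - ⟨l, hl, -⟩
    simp at hl
  | cons l ls ih =>
    intro s w m h hw ⟨l', hl', hm⟩ hU
    have eq : lev U k (l :: ls) s = cond (every U (k s) l) (Nat.rec true (fun s' _ => lev U k ls s') s) false := rfl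
    rw [eq] at h
    cases he : every U (k s) l
    · rw [he] at h; exact absurd h (by simp)
    · rw [he] at h
      cases w with
      | zero =>
        simp at hl'
        subst hl'
        exact every_spec he hm hU
      | succ w =>
        cases s with
        | zero => omega
        | succ s =>
          have := ih (s := s) (w := w) h (by omega) ⟨l', by simpa using hl', hm⟩ hU
          simpa using this

theorem nonadj_eq (mn : ℕ) (l : List ℕ) : nonadj mn l = l.countP fun q => decide (mn &&& q = 0) := by
  induction l with
  | nil => rfl
  | cons q l ih =>
    have e : nonadj mn (q :: l) = cond (Nat.beq (Nat.land mn q) 0) (Nat.add (nonadj mn l) 1) (nonadj mn l) := rfl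
    rw [e, List.countP_cons, ← ih, beq_zero, Bool.cond_decide, land_def]
    simp only [decide_eq_true_eq]
    split_ifs <;> simp

theorem leaf_spec {pl l : List ℕ} (h : leaf pl l = true) : ∃ m ∈ l, 3 ≤ nonadj (nb m) pl := by
  induction l with
  | nil => exact Bool.noConfusion h
  | cons m l ih =>
    have e : leaf pl (m :: l) = force (nb m) (fun mn => cond (Nat.ble 3 (nonadj mn pl)) true (leaf pl l)) := rfl
    rw [e, force_eq] at h
    cases hb : Nat.ble 3 (nonadj (nb m) pl)
    · rw [hb] at h
      obtain ⟨m', hm', h'⟩ := ih h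
      exact ⟨m', List.mem_cons_of_mem _ hm', h'⟩
    · exact ⟨m, List.mem_cons_self, Nat.le_of_ble_eq_true hb⟩

theorem dfs_spec (V : Five) (D : ℕ) (hd : ∀ i j, i ≠ j → V.tm i &&& V.tm j = 0)
    (N : Fin 5 → Prop) [DecidablePred N] (hN : ∀ i k, k < 480 → (V.tm i).testBit k = true → N i)
    (hself : ∀ i, N i → nb (V.tm i) &&& V.tm i ≠ 0)
    (hadj : ∀ i, N i → 2 ≤ (Finset.univ.filter fun j => j ≠ i ∧ (N j → nb (V.tm i) &&& V.tm j ≠ 0)).card)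
    (l : List (ℕ × List (List ℕ))) :
    ∀ (F U s : ℕ) (S : List (Fin 5)), S.Nodup → (∀ i ∈ S, N i) → (∀ k, U.testBit k = true ↔ ∃ i ∈ S, (V.tm i).testBit k = true) →
      (∀ i, i ∉ S → V.tm i &&& F = 0) →
      ∑ i ∈ Finset.univ.filter (fun i => i ∉ S), ((V.e i).cap - V.n D i) ≤ s →
      Good V D F l → dfs l U s (S.map V.tm) = true → False := by
  have excl : ∀ i j k, (V.tm i).testBit k = true → (V.tm j).testBit k = true → i = j := by
    intro i j k hi hj
    by_contra hij
    exact land_eq_zero.1 (hd i j hij) k ⟨hi, hj⟩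
  induction l with
  | nil =>
    intro F U s S hS hSN _ _ _ _ h
    obtain ⟨m, hm, h3⟩ := leaf_spec (pl := S.map V.tm) (l := S.map V.tm) h
    obtain ⟨i, hi, rfl⟩ := List.mem_map.1 hm
    rw [nonadj_eq, List.countP_map, List.countP_eq_length_filter] at h3
    have hc := List.toFinset_card_of_nodup (hS.filter ((fun q => decide (nb (V.tm i) &&& q = 0)) ∘ V.tm))
    rw [← hc] at h3
    have h2 := hadj i (hSN i hi)
    have hdis : Disjoint (Finset.univ.filter fun j => j ≠ i ∧ (N j → nb (V.tm i) &&& V.tm j ≠ 0))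
        (insert i (S.filter ((fun q => decide (nb (V.tm i) &&& q = 0)) ∘ V.tm)).toFinset) := by
      rw [Finset.disjoint_left]
      intro j hj hj'
      simp only [Finset.mem_filter, Finset.mem_univ, true_and] at hj
      rcases Finset.mem_insert.1 hj' with rfl | hj'
      · exact hj.1 rfl
      · simp at hj'
        exact hj.2 (hSN j hj'.1) hj'.2
    have hi' : i ∉ (S.filter ((fun q => decide (nb (V.tm i) &&& q = 0)) ∘ V.tm)).toFinset := by
      simp [hself i (hSN i hi)]
    have := Finset.card_le_univ ((Finset.univ.filter fun j => j ≠ i ∧ (N j → nb (V.tm i) &&& V.tm j ≠ 0)) ∪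
        (insert i (S.filter ((fun q => decide (nb (V.tm i) &&& q = 0)) ∘ V.tm)).toFinset))
    rw [Finset.card_union_of_disjoint hdis, Finset.card_insert_of_notMem hi', Fintype.card_fin] at this
    omega
  | cons c l ih =>
    intro F U s S hS hSN hU hF hs hG h
    obtain ⟨⟨p, hp, hp480, ⟨i, hi⟩, hat⟩, hG'⟩ := hG
    have eq : dfs (c :: l) U s (S.map V.tm) = cond (Nat.beq (Nat.land U c.1) 0)
      (lev U (fun s m => force (Nat.lor U m) fun U' => dfs l U' s (m :: S.map V.tm)) c.2 s)
      (dfs l U s (S.map V.tm)) := rfl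
    rw [eq] at h
    simp only [force_eq, beq_zero, Bool.cond_decide, land_def] at h
    rw [hp] at h hG'
    have next : ∀ j, i ≠ j → V.tm j &&& F = 0 → V.tm j &&& (F ||| 1 <<< p) = 0 := by
      intro j hj hjF
      rw [Nat.and_or_distrib_left, hjF, (one_bit _ _).2]
      · rfl
      · by_contra hb
        exact hj (excl i j p hi (by simpa using hb))
    split_ifs at h with h1
    · have hiS : i ∉ S := by
        intro hiS
        have := (hU p).2 ⟨i, hiS, hi⟩
        rw [one_bit, this] at h1
        exact Bool.noConfusion h1
      obtain ⟨w, hw, hwat⟩ := hat i hi (hF i hiS)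
      have hset : Finset.univ.filter (fun j => j ∉ S) = insert i (Finset.univ.filter (fun j => j ∉ i :: S)) := by
        ext j
        simp only [Finset.mem_filter, Finset.mem_univ, true_and, Finset.mem_insert, List.mem_cons]
        by_cases hj : j = i
        · subst hj; simp [hiS]
        · simp [hj]
      rw [hset, Finset.sum_insert (by simp)] at hs
      have h2 := lev_spec h (w := w) (by omega) hwat (by
        rw [land_eq_zero]
        rintro k ⟨hk1, hk2⟩
        obtain ⟨j, hj, hjk⟩ := (hU k).1 hk2
        rw [excl i j k hk1 hjk] at hiS
        exact hiS hj)
      refine ih (F ||| 1 <<< p) (U ||| V.tm i) (s - w) (i :: S) (List.nodup_cons.2 ⟨hiS, hS⟩)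
        (List.forall_mem_cons.2 ⟨hN i p hp480 hi, hSN⟩) ?_ ?_ (by omega) hG' h2
      · intro k
        rw [Nat.testBit_or, Bool.or_eq_true, hU]
        simp only [List.mem_cons, exists_eq_or_imp]
        exact or_comm
      · intro j hj
        rw [List.mem_cons, not_or] at hj
        exact next j (fun e => hj.1 e.symm) (hF j hj.2)
    · refine ih (F ||| 1 <<< p) U s S hS hSN hU ?_ hs hG' h
      intro j hj
      refine next j ?_ (hF j hj)
      rintro rfl
      obtain ⟨i', hi', h3⟩ := (hU p).1 ((one_bit' _ _).1 h1)
      rw [excl i' i p h3 hi] at hi'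
      exact hj hi'

end TF
namespace TF
/-! ### No configuration in the Hamiltonian case -/

theorem sets_spec (f : ℕ → Prop) [DecidablePred f] (l : List ℕ) : ∀ (b acc : ℕ), sets l b acc = true →
    (l.countP fun k => decide (¬ f k)) ≤ b →
    ∃ m, chk m = true ∧ ∀ k, m.testBit k = true ↔ acc.testBit k = true ∨ (k ∈ l ∧ f k) := by
  induction l with
  | nil => exact fun b acc h _ => ⟨acc, h, by simp⟩
  | cons c l ih =>
    intro b acc h hb
    have eq : sets (c :: l) b acc = cond (force (Nat.lor acc (Nat.shiftLeft 1 c)) fun a => sets l b a)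
      (Nat.rec true (fun b' _ => sets l b' acc) b) false := rfl
    rw [eq, force_eq, Bool.cond_false_right, Bool.and_eq_true] at h
    rw [List.countP_cons] at hb
    by_cases hc : f c
    · obtain ⟨m, hm, hk⟩ := ih _ _ h.1 (by simp [hc] at hb ⊢; exact hb)
      refine ⟨m, hm, fun k => ?_⟩
      rw [hk, lor_def, shl_def, Nat.testBit_or, Nat.one_shiftLeft, Nat.testBit_two_pow]
      simp only [Bool.or_eq_true, decide_eq_true_eq, List.mem_cons]
      constructor
      · rintro ((h | rfl) | h)
        · exact Or.inl h
        · exact Or.inr ⟨Or.inl rfl, hc⟩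
        · exact Or.inr ⟨Or.inr h.1, h.2⟩
      · rintro (h | ⟨rfl | h, h'⟩)
        · exact Or.inl (Or.inl h)
        · exact Or.inl (Or.inr rfl)
        · exact Or.inr ⟨h, h'⟩
    · simp only [hc, not_false_eq_true, decide_true, if_true] at hb
      cases b with
      | zero => omega
      | succ b =>
        obtain ⟨m, hm, hk⟩ := ih b acc h.2 (by omega)
        refine ⟨m, hm, fun k => ?_⟩
        rw [hk]
        simp only [List.mem_cons]
        constructor
        · rintro (h | h)
          · exact Or.inl h
          · exact Or.inr ⟨Or.inr h.1, h.2⟩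
        · rintro (h | ⟨rfl | h, h'⟩)
          · exact Or.inl h
          · exact absurd h' hc
          · exact Or.inr ⟨h, h'⟩

/-- The table entry of an orientation. -/
def ent (i : Fin 5) (o : List (ℕ × ℕ)) : Ent :=
  ⟨1 <<< (480 + 2 * i.val), capE i, base o, o.map fun p => p.1 + 24 * p.2⟩

theorem tab_eq : tab = (orients 0).map (ent 0) ++ (orients 1).map (ent 1) ++ (orients 2).map (ent 2) ++
    (orients 3).map (ent 3) ++ (orients 4).map (ent 4) := by
  rfl

theorem ent_mem (i : Fin 5) {o : List (ℕ × ℕ)} (ho : o ∈ orients i) : ent i o ∈ tab := by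
  rw [tab_eq]
  have := List.mem_map_of_mem (f := ent i) ho
  fin_cases i <;> simp only [List.mem_append] <;> tauto

theorem orients_self : ∀ i, ∀ o ∈ orients i, ∃ p ∈ o, ∃ q ∈ o, (q.1 = p.1 + 1 ∧ q.2 = p.2) ∨
    (q.1 = p.1 ∧ q.2 = p.2 + 1) := by
  decide +kernel

theorem frame_check : frame.Nodup ∧ ∀ p ∈ frame, p < 480 ∧ 3 ≤ p % 24 ∧ p % 24 ≤ 9 ∧ 3 ≤ p / 24 ∧ p / 24 ≤ 7 := by
  decide +kernel

theorem capE_sum : ∑ i, capE i = 15 := by decide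

theorem one_shl_bit (p k : ℕ) : (1 <<< p).testBit k = true ↔ k = p := by
  rw [Nat.one_shiftLeft, Nat.testBit_two_pow, decide_eq_true_eq]
  exact eq_comm

theorem rep_single {z : Cell} (hz : 0 ≤ z.1 ∧ z.1 ≤ 20 ∧ 0 ≤ z.2 ∧ z.2 ≤ 20) : Rep (1 <<< code z) {z} := by
  refine ⟨?_, ?_⟩
  · rintro c rfl
    exact hz
  · intro k
    rw [one_shl_bit]
    simp [eq_comm]

/-- The pieces near the frame. -/
def Near (C : Conf) (i : Fin 5) : Prop := ∃ c ∈ C.piece i, 3 ≤ c.1 ∧ c.1 ≤ 9 ∧ 3 ≤ c.2 ∧ c.2 ≤ 7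

theorem Conf.five (C : Conf) : ∃ V : Five, (∀ i, (V.e i).tag = 1 <<< (480 + 2 * i.val)) ∧ (∀ i, (V.e i).cap = capE i) ∧
    (∀ i, (V.e i).cs.Nodup) ∧
    (∀ i, Near C i → Rep ((V.e i).b <<< V.off i) (C.piece i) ∧ ∀ c ∈ C.piece i, c.2 ≤ 18) ∧
    (∀ i, ¬ Near C i → ∀ k, ((V.e i).b <<< V.off i).testBit k = true → 1000 + 200 * i.val ≤ k ∧ k < 1200 + 200 * i.val) := by
  classical
  choose o ho a b hQ using fun i => placement_orient (C.placement i)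
  have h3 : ∀ i, ∀ p ∈ o i, p.1 ≤ 3 ∧ p.2 ≤ 3 := fun i => (orients_check i _ (ho i)).1
  have bits : ∀ (i : Fin 5) (s k : ℕ), (base (o i) <<< s).testBit k = true ↔
      ∃ c ∈ (o i).map fun p => p.1 + 24 * p.2, k = c + s := by
    intro i s k
    rw [Nat.testBit_shiftLeft, Bool.and_eq_true, base_bit, decide_eq_true_eq]
    simp only [List.mem_map]
    constructor
    · rintro ⟨h, p, hp, e⟩
      exact ⟨_, ⟨p, hp, rfl⟩, by omega⟩
    · rintro ⟨_, ⟨p, hp, rfl⟩, e⟩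
      exact ⟨by omega, p, hp, by omega⟩
  let off : Fin 5 → ℕ := fun i => if Near C i then (a i).toNat + 24 * (b i).toNat else 1000 + 200 * i.val
  refine ⟨⟨fun i => ent i (o i), off, fun i => base (o i) <<< off i ||| 1 <<< (480 + 2 * i.val),
    fun i => ent_mem i (ho i), fun i => rfl, fun i k => bits i _ k⟩, fun i => rfl, fun i => rfl, ?_, ?_, ?_⟩
  · intro i
    refine List.Nodup.map_on ?_ (orients_check2 i _ (ho i)).1
    intro p hp q hq h
    have := h3 i p hp
    have := h3 i q hq
    exact Prod.ext (by omega) (by omega)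
  · intro i hi
    obtain ⟨c, hc, hc'⟩ := hi
    have hn : Near C i := ⟨c, hc, hc'⟩
    rw [hQ i] at hc
    obtain ⟨p, hp, rfl⟩ := hc
    have := h3 i p hp
    simp only at hc'
    have ea : a i = ((a i).toNat : ℤ) := by omega
    have eb : b i = ((b i).toNat : ℤ) := by omega
    have eo : off i = (a i).toNat + 24 * (b i).toNat := if_pos hn
    refine ⟨?_, ?_⟩
    · show Rep (base (o i) <<< off i) (C.piece i)
      rw [eo, hQ i]
      have := rep_pset (h3 i) (a := (a i).toNat) (b := (b i).toNat) (by omega) (by omega)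
      rwa [← ea, ← eb] at this
    · intro d hd
      rw [hQ i] at hd
      obtain ⟨q, hq, rfl⟩ := hd
      have := h3 i q hq
      simp only
      omega
  · intro i hi k hk
    obtain ⟨c, hc, e⟩ := (bits i (off i) k).1 hk
    obtain ⟨p, hp, rfl⟩ := List.mem_map.1 hc
    have := h3 i p hp
    have eo : off i = 1000 + 200 * i.val := if_neg hi
    rw [eo] at e
    omega

theorem Conf.no_rep (C : Conf) (hE : ∀ e ∈ C.E, 4 ≤ e.1 ∧ e.1 ≤ 8 ∧ 4 ≤ e.2 ∧ e.2 ≤ 6) {m : ℕ}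
    (hm : Rep m (C.E : Set Cell)) (h : chk m = true) : False := by
  classical
  obtain ⟨V, htag, hcap, hnd, hnear, hfar⟩ := C.five
  set D := Nat.xor (Nat.lor (nb m) m) m with hD
  have Dbit : ∀ k, D.testBit k = true ↔ (nb m).testBit k = true ∧ ¬ m.testBit k = true := by
    intro k
    have : D = (nb m ||| m) ^^^ m := rfl
    rw [this, Nat.testBit_xor, Nat.testBit_or]
    cases (nb m).testBit k <;> cases m.testBit k <;> simp
  have tmb : ∀ i k, (V.tm i).testBit k = true ↔ ((V.e i).b <<< V.off i).testBit k = true ∨ k = 480 + 2 * i.val := by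
    intro i k
    rw [V.htm i, htag i, Nat.testBit_or, Bool.or_eq_true, one_shl_bit]
  have nb480 : ∀ i, Near C i → ∀ k, ((V.e i).b <<< V.off i).testBit k = true → k < 480 := by
    intro i hi k hk
    obtain ⟨hr, h18⟩ := hnear i hi
    obtain ⟨c, hc, rfl⟩ := (hr.bit k).1 hk
    have := hr.rng c hc
    have := h18 c hc
    unfold code
    omega
  have hN : ∀ i k, k < 480 → (V.tm i).testBit k = true → Near C i := by
    intro i k hk hb
    by_contra hn
    rcases (tmb i k).1 hb with h1 | h1
    · have := hfar i hn k h1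
      omega
    · omega
  have hd : ∀ i j, i ≠ j → V.tm i &&& V.tm j = 0 := by
    intro i j hij
    have hij' : i.val ≠ j.val := fun h => hij (Fin.ext h)
    have hi5 := i.isLt
    have hj5 := j.isLt
    rw [land_eq_zero]
    rintro k ⟨h1, h2⟩
    rw [tmb] at h1 h2
    have R : ∀ i, ((V.e i).b <<< V.off i).testBit k = true → (Near C i ∧ k < 480) ∨
        (1000 + 200 * i.val ≤ k ∧ k < 1200 + 200 * i.val) := by
      intro i hi
      by_cases hn : Near C i
      · exact Or.inl ⟨hn, nb480 i hn k hi⟩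
      · exact Or.inr (hfar i hn k hi)
    rcases h1 with h1 | h1 <;> rcases h2 with h2 | h2
    · rcases R i h1 with ⟨ni, r1⟩ | r1 <;> rcases R j h2 with ⟨nj, r2⟩ | r2
      · have hdj : Disjoint (C.piece i) (C.piece j) := C.disj hij
        rw [← (hnear i ni).1.disj (hnear j nj).1, land_eq_zero] at hdj
        exact hdj k ⟨h1, h2⟩
      all_goals omega
    · rcases R i h1 with ⟨ni, r1⟩ | r1 <;> omega
    · rcases R j h2 with ⟨nj, r2⟩ | r2 <;> omega
    · omega
  have hrep : ∀ i, Near C i → Rep (V.tm i) (C.piece i ∪ {(((2 * i.val : ℕ) : ℤ), (20 : ℤ))}) := by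
    intro i hi
    rw [V.htm i, htag i]
    refine (hnear i hi).1.union ?_
    have hi5 := i.isLt
    have := rep_single (z := (((2 * i.val : ℕ) : ℤ), (20 : ℤ))) (by simp only; omega)
    have e : code (((2 * i.val : ℕ) : ℤ), (20 : ℤ)) = 480 + 2 * i.val := by simp only [code]; omega
    rwa [e] at this
  have hself : ∀ i, Near C i → nb (V.tm i) &&& V.tm i ≠ 0 := by
    intro i hi
    rw [← (hrep i hi).adj (hrep i hi)]
    obtain ⟨o, ho, a, b, hQ⟩ := placement_orient (C.placement i)
    obtain ⟨p, hp, q, hq, hpq⟩ := orients_self i o ho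
    refine ⟨_, Or.inl (by rw [hQ]; exact ⟨p, hp, rfl⟩), _, Or.inl (by rw [hQ]; exact ⟨q, hq, rfl⟩), ?_⟩
    unfold Adj
    simp only
    omega
  have hadj : ∀ i, Near C i →
      2 ≤ (Finset.univ.filter fun j => j ≠ i ∧ (Near C j → nb (V.tm i) &&& V.tm j ≠ 0)).card := by
    intro i hi
    refine (C.adj2 i).trans ?_
    rw [← Set.ncard_coe_finset]
    refine Set.ncard_le_ncard ?_ (Set.toFinite _)
    rintro j ⟨hj, x, hx, y, hy, hxy⟩
    simp only [Finset.coe_filter, Finset.mem_univ, true_and, Set.mem_ofPred_eq]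
    refine ⟨hj, fun hnj => ?_⟩
    rw [← (hrep i hi).adj (hrep j hnj)]
    exact ⟨x, Or.inl hx, y, Or.inl hy, hxy⟩
  have hcov : ∀ p ∈ frame, D.testBit p = true → ∃ i, ((V.e i).b <<< V.off i).testBit p = true := by
    intro p hp hDp
    obtain ⟨h1, h2⟩ := (Dbit p).1 hDp
    have hf := frame_check.2 p hp
    have hz : ∃ z : Cell, (3 ≤ z.1 ∧ z.1 ≤ 9 ∧ 3 ≤ z.2 ∧ z.2 ≤ 7) ∧ code z = p :=
      ⟨(((p % 24 : ℕ) : ℤ), ((p / 24 : ℕ) : ℤ)), by simp only; omega, by simp only [code]; omega⟩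
    obtain ⟨z, hz, rfl⟩ := hz
    have hz1 := rep_single (z := z) (by omega)
    have : PieceAdj (C.E : Set Cell) {z} := by
      rw [hm.adj hz1]
      exact (one_bit' _ _).2 h1
    obtain ⟨e, he, z', rfl, hez⟩ := this
    rcases C.clos e he _ hez with h3 | ⟨i, hi⟩
    · exact absurd (hm.mem h3) h2
    · exact ⟨i, (hnear i ⟨_, hi, hz⟩).1.mem hi⟩
  have eq : chk m = force D (fun D => force (cnt D frame) fun d => force (Nat.lor m D) fun forb =>
      force (Nat.sub 15 d) fun s => cells m D frame forb [] fun l => cond (Nat.ble d 15) (dfs l 0 s []) true) := by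
    unfold chk
    rw [force_eq, force_eq]
  rw [eq] at h
  simp only [force_eq] at h
  obtain ⟨acc, hk, hG, hcapn⟩ := cells_spec V m D frame (fun p hp => (frame_check.2 p hp).1)
    (fun i k hk => by
      rw [htag i]
      by_contra hb
      have := (one_shl_bit (480 + 2 * i.val) k).1 (by simpa using hb)
      omega)
    (fun p hp hDp => by
      obtain ⟨i, hi⟩ := hcov p hp hDp
      exact ⟨i, (tmb i p).2 (Or.inl hi)⟩) _ [] _ h trivial
    (fun p _ hDp => by rw [lor_def, Nat.testBit_or, hDp, Bool.or_true]) frame_check.1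
  have hdm : ∀ i, (V.e i).b <<< V.off i &&& m = 0 := by
    intro i
    by_cases hi : Near C i
    · rw [(hnear i hi).1.disj hm, Set.disjoint_left]
      intro c hc hcE
      exact C.avoid c hcE i hc
    · rw [land_eq_zero]
      rintro k ⟨h1, h2⟩
      obtain ⟨c, hc, rfl⟩ := (hm.bit k).1 h2
      have := hfar i hi _ h1
      have := hm.rng c hc
      unfold code at *
      omega
  have hn : ∀ i, V.n D i ≤ (V.e i).cap := by
    intro i
    by_cases h0 : (V.e i).b <<< V.off i &&& Nat.lor m D = 0
    · have : V.n D i = 0 := by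
        unfold Five.n
        rw [cnt_eq, List.countP_eq_zero]
        intro c hc hb
        rw [Nat.testBit_shiftRight] at hb
        refine land_eq_zero.1 h0 (V.off i + c) ⟨(V.bits i _).2 ⟨c, hc, add_comm _ _⟩, ?_⟩
        rw [lor_def, Nat.testBit_or, hb, Bool.or_true]
      omega
    · exact hcapn i (hdm i) h0
  have hsum : cnt D frame ≤ ∑ i, V.n D i := by
    rw [cnt_eq, List.countP_eq_length_filter, ← List.toFinset_card_of_nodup (frame_check.1.filter _)]
    have hsub : (frame.filter fun c => D.testBit c).toFinset ⊆ Finset.univ.biUnion fun i =>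
        (((V.e i).cs.filter fun c => (D >>> V.off i).testBit c).toFinset.image fun c => c + V.off i) := by
      intro p hp
      rw [List.mem_toFinset, List.mem_filter] at hp
      obtain ⟨i, hi⟩ := hcov p hp.1 hp.2
      obtain ⟨c, hc, rfl⟩ := (V.bits i p).1 hi
      refine Finset.mem_biUnion.2 ⟨i, Finset.mem_univ _, Finset.mem_image.2 ⟨c, ?_, rfl⟩⟩
      rw [List.mem_toFinset, List.mem_filter, Nat.testBit_shiftRight, add_comm]
      exact ⟨hc, hp.2⟩
    refine (Finset.card_le_card hsub).trans (Finset.card_biUnion_le.trans (Finset.sum_le_sum fun i _ => ?_))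
    refine Finset.card_image_le.trans ?_
    rw [List.toFinset_card_of_nodup ((hnd i).filter _), ← List.countP_eq_length_filter]
    unfold Five.n
    rw [cnt_eq]
  have hc15 : ∑ i, (V.e i).cap = 15 := by
    rw [← capE_sum]
    exact Finset.sum_congr rfl fun i _ => hcap i
  have hle : ∑ i, V.n D i ≤ ∑ i, (V.e i).cap := Finset.sum_le_sum fun i _ => hn i
  have hs : ∑ i, ((V.e i).cap - V.n D i) + ∑ i, V.n D i = 15 := by
    rw [← hc15, ← Finset.sum_add_distrib]
    exact Finset.sum_congr rfl fun i _ => Nat.sub_add_cancel (hn i)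
  have hb : Nat.ble (cnt D frame) 15 = true := Nat.ble_eq_true_of_le (by omega)
  rw [hb] at hk
  refine dfs_spec V D hd (Near C) hN hself hadj acc m 0 _ [] List.nodup_nil (by simp) (by simp) ?_ ?_ hG hk
  · intro i _
    rw [V.htm i, htag i, Nat.land_comm, Nat.and_or_distrib_left, Nat.land_comm m, hdm i, Nat.zero_or, one_bit]
    by_contra hb
    obtain ⟨c, hc, e⟩ := (hm.bit _).1 (by simpa using hb : m.testBit (480 + 2 * i.val) = true)
    have := hE c hc
    unfold code at e
    omega
  · simp only [List.not_mem_nil, not_false_eq_true, Finset.filter_true]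
    show _ ≤ 15 - cnt D frame
    omega

theorem Conf.no_box (C : Conf) (hE : ∀ e ∈ C.E, 4 ≤ e.1 ∧ e.1 ≤ 8 ∧ 4 ≤ e.2 ∧ e.2 ≤ 6) (l : List ℕ)
    (hl : ∀ e ∈ C.E, code e ∈ l) (hnd : l.Nodup) (h : sets l (l.length - 10) 0 = true) : False := by
  classical
  have hr : ∀ e ∈ C.E, 0 ≤ e.1 ∧ e.1 ≤ 20 ∧ 0 ≤ e.2 ∧ e.2 ≤ 20 := fun e he => by
    have := hE e he
    omega
  have hcount : (l.countP fun k => decide (¬ ∃ e ∈ C.E, code e = k)) ≤ l.length - 10 := by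
    have h1 := List.length_eq_countP_add_countP (l := l) (fun k => decide (∃ e ∈ C.E, code e = k))
    have h2 : 10 ≤ l.countP fun k => decide (∃ e ∈ C.E, code e = k) := by
      rw [List.countP_eq_length_filter, ← List.toFinset_card_of_nodup (hnd.filter _)]
      refine C.card.trans ?_
      rw [← Finset.card_image_of_injOn (s := C.E) (f := code)]
      · apply Finset.card_le_card
        intro k hk
        obtain ⟨e, he, rfl⟩ := Finset.mem_image.1 hk
        rw [List.mem_toFinset, List.mem_filter]
        exact ⟨hl e he, by simpa using ⟨_, _, he, rfl⟩⟩
      · intro e he d hd hed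
        exact code_inj (hr e he) (hr d hd) hed
    have h3 : (l.countP fun k => decide (¬ ∃ e ∈ C.E, code e = k)) =
        l.countP fun k => decide (¬ decide (∃ e ∈ C.E, code e = k) = true) := by
      apply List.countP_congr
      intro k _
      simp
    rw [h3]
    omega
  obtain ⟨m, hm, hk⟩ := sets_spec (fun k => ∃ e ∈ C.E, code e = k) l _ 0 h hcount
  refine C.no_rep hE (m := m) ⟨fun c hc => hr c hc, fun k => ?_⟩ hm
  rw [hk, Nat.zero_testBit]
  constructor
  · rintro (h | h)
    · exact Bool.noConfusion h
    · exact h.2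
  · rintro ⟨e, he, rfl⟩
    exact Or.inr ⟨hl e he, e, he, rfl⟩

theorem box_check : (∀ x ∈ [4, 5, 6, 7], ∀ y ∈ [4, 5, 6], x + 24 * y ∈ box1) ∧
    (∀ x ∈ [4, 5, 6, 7, 8], ∀ y ∈ [4, 5], x + 24 * y ∈ box2) ∧ box1.Nodup ∧ box2.Nodup := by
  decide +kernel

theorem Conf.no_ham (C : Conf) {p : Fin 5 → Fin 5} (hp : p ∈ hamL)
    (hadj : ∀ k, PieceAdj (C.piece (p k)) (C.piece (p (k + 1)))) : False := by
  obtain ⟨C', h | h⟩ := C.boxed hp hadj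
  · refine C'.no_box (fun e he => by have := h e he; omega) box1 (fun e he => ?_) box_check.2.2.1 sets_check1
    have := h e he
    have e1 : code e = e.1.toNat + 24 * e.2.toNat := by unfold code; omega
    rw [e1]
    refine box_check.1 _ ?_ _ ?_ <;> simp only [List.mem_cons, List.not_mem_nil, or_false] <;> omega
  · refine C'.no_box (fun e he => by have := h e he; omega) box2 (fun e he => ?_) box_check.2.2.2 sets_check2
    have := h e he
    have e1 : code e = e.1.toNat + 24 * e.2.toNat := by unfold code; omega
    rw [e1]
    refine box_check.2.1 _ ?_ _ ?_ <;> simp only [List.mem_cons, List.not_mem_nil, or_false] <;> omega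

end TF
namespace TF
/-! ### The upper bound -/

theorem Conf.false (C : Conf) : False := by
  rcases C.graph with ⟨p, hp, h⟩ | ⟨p, hp, h0, h12, h34⟩ | ⟨p, hp, h, h23, h24, h34⟩
  · exact C.no_ham hp h
  · exact C.no_bow hp h0 h12 h34 (bow_surj p hp)
  · exact C.no_k23 hp h h23 h24 h34

theorem area_le (F : TetFence) : F.area ≤ 9 := by
  by_contra hlt
  have h10 : 10 ≤ Set.ncard {c | Enclosed (⋃ i, F.piece i) c} := by
    have : F.area = Set.ncard {c | Enclosed (⋃ i, F.piece i) c} := rfl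
    omega
  have hfin : {c | Enclosed (⋃ i, F.piece i) c}.Finite := Set.finite_of_ncard_pos (by omega)
  refine Conf.false ⟨F.piece, F.placement, F.disj, F.adj2, hfin.toFinset, ?_, ?_, ?_⟩
  · rwa [Set.ncard_eq_toFinset_card _ hfin] at h10
  · intro e he i hi
    have he' : Enclosed (⋃ i, F.piece i) e := by simpa using he
    exact he'.1 (Set.mem_iUnion.2 ⟨i, hi⟩)
  · intro e he d hed
    have he' : Enclosed (⋃ i, F.piece i) e := by simpa using he
    by_cases hd : d ∈ ⋃ i, F.piece i
    · exact Or.inr (Set.mem_iUnion.1 hd)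
    · left
      have : Enclosed (⋃ i, F.piece i) d := by
        refine ⟨hd, he'.2.subset ?_⟩
        intro x hx
        exact Relation.ReflTransGen.head ⟨hed, he'.1, hd⟩ hx
      simpa using this

/-! ### A fence with enclosed area 9 -/

def exL : Fin 5 → List Cell :=
  ![[(4,3),(4,4),(4,5),(4,6)], [(7,3),(8,3),(8,4),(8,5)], [(7,7),(7,8),(8,6),(8,7)],
    [(5,2),(5,3),(6,2),(6,3)], [(4,7),(5,7),(5,8),(6,7)]]

def exP (i : Fin 5) : Set Cell := {c | c ∈ exL i}

def walk : List Cell :=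
  [(4,3),(4,4),(4,5),(4,6),(4,7),(5,7),(5,8),(5,7),(6,7),(7,7),(7,8),(7,7),(8,7),(8,6),(8,5),(8,4),
   (8,3),(7,3),(6,3),(6,2),(5,2),(5,3)]

theorem mem_ex (c : Cell) : c ∈ (⋃ i, exP i) ↔ c ∈ walk := by
  simp only [Set.mem_iUnion, exP, Set.mem_ofPred_eq]
  constructor
  · rintro ⟨i, hi⟩
    revert c
    revert i
    decide +kernel
  · revert c
    show ∀ c ∈ walk, ∃ i, c ∈ exL i
    decide +kernel

theorem mem_walk (c : Cell) : c ∈ walk ↔ (c.1 = 4 ∧ 3 ≤ c.2 ∧ c.2 ≤ 7) ∨ (c.1 = 8 ∧ 3 ≤ c.2 ∧ c.2 ≤ 7) ∨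
    (c.1 = 5 ∧ (c.2 = 2 ∨ c.2 = 3 ∨ c.2 = 7 ∨ c.2 = 8)) ∨ (c.1 = 6 ∧ (c.2 = 2 ∨ c.2 = 3 ∨ c.2 = 7)) ∨
    (c.1 = 7 ∧ (c.2 = 3 ∨ c.2 = 7 ∨ c.2 = 8)) := by
  constructor
  · revert c
    decide +kernel
  · obtain ⟨x, y⟩ := c
    rintro (⟨h, h1, h2⟩ | ⟨h, h1, h2⟩ | ⟨h, h1 | h1 | h1 | h1⟩ | ⟨h, h1 | h1 | h1⟩ | ⟨h, h1 | h1 | h1⟩) <;>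
      simp only at h h1
    · subst h
      interval_cases y <;> decide +kernel
    · subst h
      interval_cases y <;> decide +kernel
    all_goals
      subst h h1
      decide +kernel

theorem chain_reach {R : Cell → Cell → Prop} (l : List Cell) : ∀ a, List.IsChain R (a :: l) →
    ∀ x ∈ a :: l, Relation.ReflTransGen R a x := by
  induction l with
  | nil =>
    intro a _ x hx
    simp at hx
    subst hx
    exact .refl
  | cons b l ih =>
    intro a h x hx
    rw [List.isChain_cons_cons] at h
    rcases List.mem_cons.1 hx with rfl | hx
    · exact .refl
    · exact .head h.1 (ih b h.2 x hx)

theorem adj_symm {p q : Cell} (h : Adj p q) : Adj q p := by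
  unfold Adj at *
  omega

theorem walk_chain : List.IsChain (fun x y : Cell => Adj x y ∧ x ∈ walk ∧ y ∈ walk) walk := by
  simp [walk, Adj]

theorem ex_conn : SetConnected (⋃ i, exP i) := by
  have e : (⋃ i, exP i) = {c | c ∈ walk} := Set.ext mem_ex
  rw [e]
  have h1 : ∀ x ∈ walk, ReachIn {c | c ∈ walk} (4, 3) x := chain_reach _ _ walk_chain
  intro p hp q hq
  refine Relation.ReflTransGen.trans ?_ (h1 q hq)
  have h2 := h1 p hp
  induction h2 with
  | refl => exact .refl
  | tail _ h ih => exact .head ⟨adj_symm h.1, h.2.2, h.2.1⟩ (ih h.2.1)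

theorem ray_infinite {F : Set Cell} {c d : Cell} (hd : Adj 0 d)
    (h : ∀ n : ℕ, (c.1 + n * d.1, c.2 + n * d.2) ∉ F) : ¬ (component Fᶜ c).Finite := by
  have hr : ∀ n : ℕ, ((c.1 + n * d.1, c.2 + n * d.2) : Cell) ∈ component Fᶜ c := by
    intro n
    induction n with
    | zero => simp [component, ReachIn]; exact .refl
    | succ n ih =>
      refine Relation.ReflTransGen.tail ih ⟨?_, h n, h (n + 1)⟩
      unfold Adj at *
      simp at hd ⊢
      have e1 : n * d.1 - (n + 1) * d.1 = - d.1 := by ring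
      have e2 : n * d.2 - (n + 1) * d.2 = - d.2 := by ring
      rw [e1, e2]
      omega
  intro hfin
  refine Set.infinite_of_injective_forall_mem (f := fun n : ℕ => ((c.1 + n * d.1, c.2 + n * d.2) : Cell)) ?_ hr hfin
  intro n m hnm
  simp only [Prod.mk.injEq, add_right_inj, mul_eq_mul_right_iff, Nat.cast_inj] at hnm
  unfold Adj at hd
  simp at hd
  omega

theorem ex_enclosed (c : Cell) : Enclosed (⋃ i, exP i) c ↔ 5 ≤ c.1 ∧ c.1 ≤ 7 ∧ 4 ≤ c.2 ∧ c.2 ≤ 6 := by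
  constructor
  · rintro ⟨h1, h2⟩
    rw [mem_ex, mem_walk] at h1
    by_contra hc
    have ray := fun (d : Cell) (hd : Adj 0 d) (h : ∀ n : ℕ, (c.1 + n * d.1, c.2 + n * d.2) ∉ ⋃ i, exP i) =>
      ray_infinite (F := ⋃ i, exP i) (c := c) hd h h2
    simp only [mem_ex, mem_walk] at ray
    have cases4 : 7 ≤ c.2 ∨ c.2 ≤ 3 ∨ (4 ≤ c.2 ∧ c.2 ≤ 6 ∧ c.1 ≤ 3) ∨ (4 ≤ c.2 ∧ c.2 ≤ 6 ∧ 9 ≤ c.1) := by omega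
    rcases cases4 with h | h | h | h
    · exact ray (0, 1) (by simp [Adj]) (fun n => by simp only; omega)
    · exact ray (0, -1) (by simp [Adj]) (fun n => by simp only; omega)
    · exact ray (-1, 0) (by simp [Adj]) (fun n => by simp only; omega)
    · exact ray (1, 0) (by simp [Adj]) (fun n => by simp only; omega)
  · intro hc
    refine ⟨by rw [mem_ex, mem_walk]; omega, ?_⟩
    refine (Finset.finite_toSet (Finset.Icc (5 : ℤ) 7 ×ˢ Finset.Icc (4 : ℤ) 6)).subset ?_
    intro x hx
    have : 5 ≤ x.1 ∧ x.1 ≤ 7 ∧ 4 ≤ x.2 ∧ x.2 ≤ 6 := by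
      induction hx with
      | refl => exact hc
      | tail _ h ih =>
        obtain ⟨ha, -, hy⟩ := h
        rw [Set.mem_compl_iff, mem_ex, mem_walk] at hy
        unfold Adj at ha
        omega
    simp only [Finset.coe_product, Finset.coe_Icc, Set.mem_prod, Set.mem_Icc]
    omega

theorem ex_area : encArea (⋃ i, exP i) = 9 := by
  have e : {c | Enclosed (⋃ i, exP i) c} = ((Finset.Icc (5 : ℤ) 7 ×ˢ Finset.Icc (4 : ℤ) 6 : Finset Cell) : Set Cell) := by
    ext c
    rw [Set.mem_ofPred_eq, ex_enclosed]
    simp only [Finset.coe_product, Finset.coe_Icc, Set.mem_prod, Set.mem_Icc]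
    omega
  unfold encArea
  rw [e, Set.ncard_coe_finset]
  rfl

theorem ex_placement (i : Fin 5) : IsPlacement (tets i) (exP i) := by
  have key : ∀ f ∈ symms, ∀ t : Cell, (∀ c ∈ exL i, ∃ p ∈ canon i, f ((p.1 : ℤ), (p.2 : ℤ)) + t = c) →
      (∀ p ∈ canon i, f ((p.1 : ℤ), (p.2 : ℤ)) + t ∈ exL i) → IsPlacement (tets i) (exP i) := by
    intro f hf t h1 h2
    refine ⟨f, hf, t, ?_⟩
    rw [tets_eq]
    ext c
    constructor
    · intro hc
      obtain ⟨p, hp, e⟩ := h1 c hc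
      exact ⟨_, ⟨p, hp, rfl⟩, e⟩
    · rintro ⟨_, ⟨p, hp, rfl⟩, rfl⟩
      exact h2 p hp
  fin_cases i
  · exact key (fun p => (p.1, p.2)) (by simp [symms]) (4, 3) (by decide +kernel) (by decide +kernel)
  · exact key (fun p => (-p.1, p.2)) (by simp [symms]) (8, 3) (by decide +kernel) (by decide +kernel)
  · exact key (fun p => (-p.2, p.1)) (by simp [symms]) (8, 6) (by decide +kernel) (by decide +kernel)
  · exact key (fun p => (p.1, p.2)) (by simp [symms]) (5, 2) (by decide +kernel) (by decide +kernel)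
  · exact key (fun p => (p.1, p.2)) (by simp [symms]) (4, 7) (by decide +kernel) (by decide +kernel)

theorem ex_disj : Pairwise fun i j => Disjoint (exP i) (exP j) := by
  have h : ∀ i j : Fin 5, i ≠ j → ∀ c ∈ exL i, c ∉ exL j := by decide +kernel
  intro i j hij
  rw [Set.disjoint_left]
  exact h i j hij

theorem ex_adj2 (i : Fin 5) : 2 ≤ Set.ncard {j | j ≠ i ∧ PieceAdj (exP i) (exP j)} := by
  have key : ∀ j k : Fin 5, j ≠ k → j ≠ i → k ≠ i →
      (∃ a ∈ exL i, ∃ b ∈ exL j, (a.1 - b.1).natAbs + (a.2 - b.2).natAbs = 1) →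
      (∃ a ∈ exL i, ∃ b ∈ exL k, (a.1 - b.1).natAbs + (a.2 - b.2).natAbs = 1) →
      2 ≤ Set.ncard {j | j ≠ i ∧ PieceAdj (exP i) (exP j)} := by
    intro j k hjk hj hk h1 h2
    rw [← Set.ncard_pair hjk]
    refine Set.ncard_le_ncard ?_ (Set.toFinite _)
    rintro x (rfl | rfl)
    · exact ⟨hj, h1⟩
    · exact ⟨hk, h2⟩
  fin_cases i
  · exact key 3 4 (by decide) (by decide) (by decide) (by decide +kernel) (by decide +kernel)
  · exact key 2 3 (by decide) (by decide) (by decide) (by decide +kernel) (by decide +kernel)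
  · exact key 1 4 (by decide) (by decide) (by decide) (by decide +kernel) (by decide +kernel)
  · exact key 0 1 (by decide) (by decide) (by decide) (by decide +kernel) (by decide +kernel)
  · exact key 0 2 (by decide) (by decide) (by decide) (by decide +kernel) (by decide +kernel)

/-- A fence with enclosed area 9. -/
def exFence : TetFence := ⟨exP, ex_placement, ex_disj, ex_conn, ex_adj2⟩

end TF

/-- The maximum of the enclosed area over all tetromino fences equals 9. -/
theorem tetromino_fence_max_area :
    IsGreatest {n : ℕ | ∃ F : TetFence, F.area = n} 9 := by
  refine ⟨⟨TF.exFence, TF.ex_area⟩, ?_⟩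
  rintro n ⟨F, rfl⟩
  exact TF.area_le F
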